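/- arXiv:1702.03787 — 2 statements merged into one kernel-verified Lean document; each statement's English description precedes it below -/
import Mathlib

section
/- Assume that for each simple graph T on ℕ a coding bijection φ_T : G_T → ℕ is given, with induced group operation ⋆_T on ℕ, in such a way that the map X_Gr → ℕ^(ℕ×ℕ), T ↦ ⋆_T, is Borel. Let B ⊆ X_Gr be a Borel set such that every T ∈ B is rigid, i.e., the identity is the only graph automorphism of T. Then for every injective finite sequence s of natural numbers, the set {T ∈ B : some group automorphism of (ℕ, ⋆_T) extends s} is Borel. -/
/-- The Polish space of simple graphs on `ℕ`, coded as symmetric irreflexive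
`{0,1}`-valued functions on `ℕ × ℕ`. -/
abbrev XGr := { A : ℕ × ℕ → Bool // (∀ a b, A (a, b) = A (b, a)) ∧ ∀ a, A (a, a) = false }

/-- The relators of Williams' group `G_T` associated to a graph with adjacency relation
`Adj`: the relators are `v_i^7`, `(v_i v_j)^11` for adjacent `i, j`, and `(v_i v_j)^13`
for distinct non-adjacent `i, j`. -/
def grRels (Adj : ℕ → ℕ → Prop) : Set (FreeGroup ℕ) :=
  {r | (∃ i, r = FreeGroup.of i ^ 7) ∨
    (∃ i j, Adj i j ∧ r = (FreeGroup.of i * FreeGroup.of j) ^ 11) ∨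
    (∃ i j, i ≠ j ∧ ¬ Adj i j ∧ r = (FreeGroup.of i * FreeGroup.of j) ^ 13)}

/-- Williams' group `G_T`, presented by the generators `v_i` and the relators above. -/
abbrev GT (Adj : ℕ → ℕ → Prop) : Type := PresentedGroup (grRels Adj)

/-- The generator `v_i` of `G_T`. -/
def gen (Adj : ℕ → ℕ → Prop) (i : ℕ) : GT Adj := PresentedGroup.of i

/-- A coding bijection for `G_T`: a bijection `φ : G_T → ℕ` together with an assignment to
each element of `G_T` of a reduced word (i.e. a free group element) representing it, such
that `φ(1) = 0`, `φ(v_i) = 3i+1`, `φ(v_i⁻¹) = 3i+2`, the obvious words are assigned to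
`1`, `v_i`, `v_i⁻¹`, and every proper subword of the word assigned to `φ⁻¹(n)` represents
an element with `φ`-value strictly less than `n`. -/
structure CodingBijection (Adj : ℕ → ℕ → Prop) where
  toEquiv : GT Adj ≃ ℕ
  word : GT Adj → FreeGroup ℕ
  word_mk : ∀ g, (QuotientGroup.mk (word g) : GT Adj) = g
  word_one : word 1 = 1
  word_gen : ∀ i, word (gen Adj i) = FreeGroup.of i
  word_gen_inv : ∀ i, word (gen Adj i)⁻¹ = (FreeGroup.of i)⁻¹
  map_one : toEquiv 1 = 0
  map_gen : ∀ i, toEquiv (gen Adj i) = 3 * i + 1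
  map_gen_inv : ∀ i, toEquiv (gen Adj i)⁻¹ = 3 * i + 2
  subword_lt : ∀ (n : ℕ) (u : FreeGroup ℕ),
    u.toWord <:+: (word (toEquiv.symm n)).toWord →
    u.toWord ≠ (word (toEquiv.symm n)).toWord →
    toEquiv (QuotientGroup.mk u : GT Adj) < n

/-- The group operation on `ℕ` induced by a coding bijection:
`n ⋆ m = φ(φ⁻¹(n) · φ⁻¹(m))`. -/
def CodingBijection.star {Adj : ℕ → ℕ → Prop} (c : CodingBijection Adj) (n m : ℕ) : ℕ :=
  c.toEquiv (c.toEquiv.symm n * c.toEquiv.symm m)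


namespace SC

/-- One step along a polygon: a state is a vertex with an incoming and an outgoing letter. -/
def step {X : Type} (E : ℕ → X → X → Prop) (s s' : X × ℕ × ℕ) : Prop :=
  E s.2.2 s.1 s'.1 ∧ s'.2.1 = s.2.2 ∧ s'.2.2 = s.2.1

/-- Iterated steps. -/
def It {X : Type} (E : ℕ → X → X → Prop) : ℕ → X × ℕ × ℕ → X × ℕ × ℕ → Prop
  | 0, s, s' => s = s'
  | k + 1, s, s' => ∃ u, step E s u ∧ It E k u s'

structure PInj {X : Type} (E : ℕ → X → X → Prop) : Prop where
  fn : ∀ {i x y z}, E i x y → E i x z → y = z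
  inj : ∀ {i x y z}, E i x z → E i y z → x = y

section basic
variable {X : Type} {E : ℕ → X → X → Prop}

lemma step_fn (hE : PInj E) {s u v} (h1 : step E s u) (h2 : step E s v) : u = v := by
  obtain ⟨a, b, c⟩ := u
  obtain ⟨a', b', c'⟩ := v
  simp only [step] at h1 h2
  obtain ⟨h1, rfl, rfl⟩ := h1
  obtain ⟨h2, rfl, rfl⟩ := h2
  rw [hE.fn h1 h2]

lemma step_inj (hE : PInj E) {s u v} (h1 : step E u s) (h2 : step E v s) : u = v := by
  obtain ⟨a, b, c⟩ := u
  obtain ⟨a', b', c'⟩ := v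
  obtain ⟨x, i, j⟩ := s
  simp only [step] at h1 h2
  obtain ⟨h1, rfl, rfl⟩ := h1
  obtain ⟨h2, rfl, rfl⟩ := h2
  rw [hE.inj h1 h2]

lemma It_add (a b : ℕ) (s s') : It E (a + b) s s' ↔ ∃ u, It E a s u ∧ It E b u s' := by
  induction a generalizing s with
  | zero => simp [It]
  | succ a ih =>
    rw [Nat.succ_add]
    simp only [It, ih]
    constructor
    · rintro ⟨u, h, v, h1, h2⟩; exact ⟨v, ⟨u, h, h1⟩, h2⟩
    · rintro ⟨v, ⟨u, h, h1⟩, h2⟩; exact ⟨u, h, v, h1, h2⟩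

lemma It_one (s s') : It E 1 s s' ↔ step E s s' := by simp [It]

lemma It_fn (hE : PInj E) {k s u v} (h1 : It E k s u) (h2 : It E k s v) : u = v := by
  induction k generalizing s with
  | zero => simp only [It] at h1 h2; rw [← h1, ← h2]
  | succ k ih =>
    obtain ⟨a, h1, h1'⟩ := h1
    obtain ⟨b, h2, h2'⟩ := h2
    obtain rfl := step_fn hE h1 h2
    exact ih h1' h2'

lemma It_inj (hE : PInj E) {k s u v} (h1 : It E k u s) (h2 : It E k v s) : u = v := by
  induction k generalizing u v with
  | zero => simp only [It] at h1 h2; rw [h1, h2]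
  | succ k ih =>
    obtain ⟨a, h1, h1'⟩ := h1
    obtain ⟨b, h2, h2'⟩ := h2
    obtain rfl := ih h1' h2'
    exact step_inj hE h1 h2

lemma closed_fwd (hE : PInj E) {k L s u} (h : It E k s u) (hs : It E L s s) : It E L u u := by
  have h1 : It E (L + k) s u := (It_add _ _ _ _).2 ⟨s, hs, h⟩
  rw [add_comm, It_add] at h1
  obtain ⟨v, h1, h2⟩ := h1
  rwa [It_fn hE h1 h] at h2

lemma closed_bwd (hE : PInj E) {k L s u} (h : It E k s u) (hs : It E L u u) : It E L s s := by
  have h1 : It E (k + L) s u := (It_add _ _ _ _).2 ⟨u, h, hs⟩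
  rw [add_comm, It_add] at h1
  obtain ⟨v, h1, h2⟩ := h1
  rwa [It_inj hE h2 h] at h1

lemma It_letters {k s u} (h : It E k s u) : u.2 = Prod.swap^[k] s.2 := by
  induction k generalizing s with
  | zero => simp only [It] at h; simp [h]
  | succ k ih =>
    obtain ⟨a, h1, h2⟩ := h
    rw [ih h2, Function.iterate_succ_apply]
    congr 1
    obtain ⟨_, h3, h4⟩ := h1
    exact Prod.ext h3 h4

lemma It_le {k l s u} (hkl : k ≤ l) (h : It E l s u) : ∃ v, It E k s v := by
  obtain ⟨m, rfl⟩ := Nat.exists_eq_add_of_le hkl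
  obtain ⟨v, hv, _⟩ := (It_add _ _ _ _).1 h
  exact ⟨v, hv⟩

lemma It_map {Z : Type} {E' : ℕ → Z → Z → Prop} (f : X → Z)
    (hf : ∀ i x y, E i x y → E' i (f x) (f y)) {k s u} (h : It E k s u) :
    It E' k (f s.1, s.2) (f u.1, u.2) := by
  induction k generalizing s with
  | zero => simp only [It] at h; subst h; simp [It]
  | succ k ih =>
    obtain ⟨a, h1, h2⟩ := h
    exact ⟨(f a.1, a.2), ⟨hf _ _ _ h1.1, h1.2⟩, ih h2⟩

end basic

/-- Admissible length functions. -/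
structure LenOK (l : ℕ → ℕ → ℕ) : Prop where
  symm : ∀ i j, l i j = l j i
  seven : ∀ i j, 7 ≤ l i j
  even : ∀ i j, i ≠ j → Even (l i j)

structure Good (l : ℕ → ℕ → ℕ) {X : Type} (E : ℕ → X → X → Prop) : Prop extends PInj E where
  H : ∀ s s', It E (l s.2.1 s.2.2 - 3) s s' → It E (l s.2.1 s.2.2) s s

section extension
variable {l : ℕ → ℕ → ℕ} {X : Type} {E : ℕ → X → X → Prop}

lemma len_It (hl : LenOK l) {k s u} (h : It E k s u) : l u.2.1 u.2.2 = l s.2.1 s.2.2 := by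
  induction k generalizing s with
  | zero => simp only [It] at h; rw [h]
  | succ k ih =>
    obtain ⟨a, h1, h2⟩ := h
    rw [ih h2, h1.2.1, h1.2.2, hl.symm]

lemma swap_iter (hl : LenOK l) (p : ℕ × ℕ) : Prod.swap^[l p.1 p.2] p = p := by
  obtain ⟨i, j⟩ := p
  by_cases h : i = j
  · subst h
    exact Function.iterate_fixed rfl _
  · obtain ⟨m, hm⟩ := hl.even i j h
    simp only [hm, ← two_mul, Function.iterate_mul]
    apply Function.iterate_fixed
    rfl

/-- New vertices. -/
inductive Nw (X : Type) : Type
  | old (x : X)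
  | out (x : X) (i : ℕ)
  | inn (x : X) (i : ℕ)
  | arc (s : X × ℕ × ℕ) (t : ℕ)

def Run (l : ℕ → ℕ → ℕ) (E : ℕ → X → X → Prop) (s0 s : X × ℕ × ℕ) (k : ℕ) : Prop :=
  It E k s0 s ∧ (∀ y, ¬ E s0.2.1 y s0.1) ∧ (∀ y, ¬ E s.2.2 s.1 y) ∧ k + 4 ≤ l s0.2.1 s0.2.2

inductive NE (l : ℕ → ℕ → ℕ) (E : ℕ → X → X → Prop) : ℕ → Nw X → Nw X → Prop
  | old (i x y) : E i x y → NE l E i (.old x) (.old y)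
  | out (i x) : (∀ y, ¬ E i x y) → NE l E i (.old x) (.out x i)
  | inn (i x) : (∀ y, ¬ E i y x) → NE l E i (.inn x i) (.old x)
  | fst (s0 x j i k) : Run l E s0 (x, j, i) k → NE l E j (.out x i) (.arc (x, j, i) 0)
  | mid (s0 s k t a) : Run l E s0 s k → t + 1 + k + 3 < l s0.2.1 s0.2.2 →
      a = (Prod.swap^[t] s.2).2 → NE l E a (.arc s t) (.arc s (t + 1))
  | lst (y c d s k t) : Run l E (y, c, d) s k → t + 1 + k + 3 = l c d →
      NE l E d (.arc s t) (.inn y c)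

lemma Run_k (hE : PInj E) {s0 s0' s k k'} (h : Run l E s0 s k) (h' : Run l E s0' s k') :
    k = k' ∧ s0 = s0' := by
  wlog hk : k ≤ k' generalizing k k' s0 s0'
  · obtain ⟨h1, h2⟩ := this h' h (by omega)
    exact ⟨h1.symm, h2.symm⟩
  obtain ⟨m, rfl⟩ := Nat.exists_eq_add_of_le' hk
  obtain ⟨u, h1, h2⟩ := (It_add _ _ _ _).1 h'.1
  obtain rfl := It_inj hE h2 h.1
  cases m with
  | zero => simp only [It] at h1; exact ⟨by simp, h1.symm⟩
  | succ m =>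
    obtain ⟨v, _, h3⟩ := (It_add _ _ _ _).1 h1
    rw [It_one] at h3
    exact absurd (h3.2.1 ▸ h3.1) (h.2.1 _)

lemma Run_k' (hE : PInj E) {s0 s s' k k'} (h : Run l E s0 s k) (h' : Run l E s0 s' k') :
    k = k' ∧ s = s' := by
  wlog hk : k ≤ k' generalizing k k' s s'
  · obtain ⟨h1, h2⟩ := this h' h (by omega)
    exact ⟨h1.symm, h2.symm⟩
  obtain ⟨m, rfl⟩ := Nat.exists_eq_add_of_le hk
  obtain ⟨u, h1, h2⟩ := (It_add _ _ _ _).1 h'.1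
  obtain rfl := It_fn hE h1 h.1
  cases m with
  | zero => simp only [It] at h2; exact ⟨by simp, h2⟩
  | succ m =>
    obtain ⟨v, h3, _⟩ := h2
    exact absurd h3.1 (h.2.2.1 _)

lemma NE_pinj (hE : PInj E) : PInj (NE l E) := by
  constructor
  · intro i x y z h1 h2
    cases h1 with
    | old _ x y h =>
      cases h2 with
      | old _ _ z h' => rw [hE.fn h h']
      | out _ _ h' => exact absurd h (h' _)
    | out _ x h =>
      cases h2 with
      | old _ _ z h' => exact absurd h' (h _)
      | out _ _ h' => rfl
    | inn _ x h => cases h2; rfl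
    | fst s0 x j i k h => cases h2; rfl
    | mid s0 s k t a h ht ha =>
      cases h2 with
      | mid => rfl
      | lst y c d _ k' _ h' ht' =>
        obtain ⟨rfl, rfl⟩ := Run_k hE h h'
        simp only at ht; omega
    | lst y c d s k t h ht =>
      cases h2 with
      | mid s0 _ k' _ _ h' ht' _ =>
        obtain ⟨rfl, rfl⟩ := Run_k hE h h'
        simp only at ht'; omega
      | lst y' c' _ _ k' _ h' ht' =>
        obtain ⟨rfl, h3⟩ := Run_k hE h h'
        simp only [Prod.mk.injEq] at h3
        rw [h3.1, h3.2.1]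
  · intro i x y z h1 h2
    cases h1 with
    | old _ x y h =>
      cases h2 with
      | old _ _ z h' => rw [hE.inj h h']
      | inn _ _ h' => exact absurd h (h' _)
    | out _ x h => cases h2; rfl
    | inn _ x h =>
      cases h2 with
      | old _ _ z h' => exact absurd h' (h _)
      | inn => rfl
    | fst s0 x j i k h => cases h2; rfl
    | mid s0 s k t a h ht ha => cases h2; rfl
    | lst y c d s k t h ht =>
      cases h2 with
      | lst _ _ _ s' k' t' h' ht' =>
        obtain ⟨rfl, rfl⟩ := Run_k' hE h h'
        have : t = t' := by omega
        rw [this]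

lemma Run_arc (s0 s : X × ℕ × ℕ) (k : ℕ) (h : Run l E s0 s k) (t : ℕ)
    (ht : t + k + 3 < l s0.2.1 s0.2.2) :
    It (NE l E) (2 + t) (.old s.1, s.2) (.arc s t, Prod.swap^[t] s.2) := by
  induction t with
  | zero =>
    refine ⟨(.out s.1 s.2.2, s.2.2, s.2.1), ⟨NE.out _ _ h.2.2.1, rfl, rfl⟩, ?_⟩
    refine ⟨(.arc s 0, s.2.1, s.2.2), ⟨?_, rfl, rfl⟩, ?_⟩
    · exact NE.fst s0 s.1 s.2.1 s.2.2 k h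
    · rfl
  | succ t ih =>
    refine (It_add (2 + t) 1 _ _).2 ⟨_, ih (by omega), ?_⟩
    rw [It_one]
    refine ⟨NE.mid s0 s k t _ h (by omega) rfl, ?_, ?_⟩
    · rw [Function.iterate_succ_apply']; rfl
    · rw [Function.iterate_succ_apply']; rfl

lemma Run_closed (hl : LenOK l) (s0 s : X × ℕ × ℕ) (k : ℕ) (h : Run l E s0 s k) :
    It (NE l E) (l s0.2.1 s0.2.2) (.old s0.1, s0.2) (.old s0.1, s0.2) := by
  obtain ⟨y, c, d⟩ := s0
  have h1 : It (NE l E) k (.old y, c, d) (.old s.1, s.2) :=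
    It_map (E' := NE l E) Nw.old (fun i x y h => NE.old i x y h) h.1
  have hk := h.2.2.2
  simp only at hk ⊢
  obtain ⟨t, ht⟩ := Nat.exists_eq_add_of_le hk
  have h2 := Run_arc _ _ _ h t (by simp only; omega)
  have hs : Prod.swap^[t] s.2 = (c, d) := by
    rw [It_letters h.1, ← Function.iterate_add_apply]
    have := swap_iter hl (c, d)
    simp only [ht] at this
    rw [show k + 4 + t = (t + k) + 2 * 2 by ring, Function.iterate_add_apply] at this
    exact this
  rw [hs] at h2
  have h3 : It (NE l E) 2 (.arc s t, c, d) (.old y, c, d) := by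
    refine ⟨(.inn y c, d, c), ⟨NE.lst y c d s k t h (by omega), rfl, rfl⟩, ?_⟩
    refine ⟨(.old y, c, d), ⟨NE.inn _ _ h.2.1, rfl, rfl⟩, rfl⟩
  have := (It_add _ _ _ _).2 ⟨_, h1, (It_add _ _ _ _).2 ⟨_, h2, h3⟩⟩
  convert this using 1
  omega

lemma fwd_end {s : X × ℕ × ℕ} (N : ℕ) (h : ¬ ∃ s', It E N s s') :
    ∃ k u, It E k s u ∧ ∀ y, ¬ E u.2.2 u.1 y := by
  induction N with
  | zero => exact absurd ⟨s, rfl⟩ h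
  | succ N ih =>
    by_cases h' : ∃ s', It E N s s'
    · obtain ⟨u, hu⟩ := h'
      refine ⟨N, u, hu, fun y hy => h ⟨(y, u.2.2, u.2.1), (It_add _ _ _ _).2 ⟨u, hu, ?_⟩⟩⟩
      rw [It_one]; exact ⟨hy, rfl, rfl⟩
    · exact ih h'

lemma bwd_end {s : X × ℕ × ℕ} (N : ℕ) (h : ¬ ∃ s', It E N s' s) :
    ∃ k u, It E k u s ∧ ∀ y, ¬ E u.2.1 y u.1 := by
  induction N with
  | zero => exact absurd ⟨s, rfl⟩ h
  | succ N ih =>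
    by_cases h' : ∃ s', It E N s' s
    · obtain ⟨u, hu⟩ := h'
      refine ⟨N, u, hu, fun y hy => h ⟨(y, u.2.2, u.2.1), ⟨u, ⟨hy, rfl, rfl⟩, hu⟩⟩⟩
    · exact ih h'

lemma old_closed (hl : LenOK l) (hE : Good l E) (s : X × ℕ × ℕ) :
    It (NE l E) (l s.2.1 s.2.2) (.old s.1, s.2) (.old s.1, s.2) := by
  have hmap : ∀ {k s u}, It E k s u → It (NE l E) k (.old s.1, s.2) (.old u.1, u.2) :=
    fun h => It_map (E' := NE l E) Nw.old (fun i x y h => NE.old i x y h) h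
  by_cases hc : It E (l s.2.1 s.2.2) s s
  · exact hmap hc
  have h1 : ¬ ∃ s', It E (l s.2.1 s.2.2 - 3) s s' := by
    rintro ⟨s', h⟩
    exact hc (hE.H _ _ h)
  have h2 : ¬ ∃ s', It E (l s.2.1 s.2.2 - 3) s' s := by
    rintro ⟨s', h⟩
    have e := len_It hl h
    rw [e] at h hc
    exact hc (closed_fwd hE.toPInj h (hE.H _ _ h))
  obtain ⟨k1, u, hu, hu'⟩ := fwd_end _ h1
  obtain ⟨k2, v, hv, hv'⟩ := bwd_end _ h2
  have e := len_It hl hv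
  have hvu : It E (k2 + k1) v u := (It_add _ _ _ _).2 ⟨s, hv, hu⟩
  have hrun : Run l E v u (k2 + k1) := by
    refine ⟨hvu, hv', hu', ?_⟩
    by_contra hlt
    obtain ⟨w, hw⟩ := It_le (k := l v.2.1 v.2.2 - 3) (by omega) hvu
    have hcl := closed_fwd hE.toPInj hv (hE.H _ _ hw)
    rw [e] at hc
    exact hc hcl
  rw [e]
  exact closed_fwd (NE_pinj hE.toPInj) (hmap hv) (Run_closed hl _ _ _ hrun)

lemma NE_good (hl : LenOK l) (hE : Good l E) : Good l (NE l E) := by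
  have hP : PInj (NE l E) := NE_pinj hE.toPInj
  refine ⟨hP, ?_⟩
  intro s s' h
  have h7 := hl.seven s.2.1 s.2.2
  obtain ⟨u, hu⟩ := It_le (k := 2) (by omega) h
  obtain ⟨v, hv, w, hw, -⟩ := hu
  have hsv : It (NE l E) 1 s v := (It_one _ _).2 hv
  have e := len_It hl hsv
  have hvw : It (NE l E) 1 v w := (It_one _ _).2 hw
  have e' := len_It hl hvw
  rw [← e]
  apply closed_bwd hP hsv
  obtain ⟨s, a, b⟩ := s
  obtain ⟨v, a', b'⟩ := v
  obtain ⟨w, a'', b''⟩ := w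
  obtain ⟨hv, hh1, hh2⟩ := hv
  obtain ⟨hw, hh3, hh4⟩ := hw
  simp only at hv hw hh1 hh2 hh3 hh4 e e'
  subst hh1 hh2 hh3 hh4
  cases v with
  | old x => exact old_closed hl hE (x, _, _)
  | out x i =>
    cases hv with
    | out _ _ h =>
      have := closed_fwd hP hsv (old_closed hl hE (x, _, _))
      rwa [← e] at this
  | inn x i =>
    cases hw with
    | inn _ _ h =>
      have := closed_bwd hP hvw (old_closed hl hE (x, _, _))
      rwa [e'] at this
  | arc r t =>
    have key : ∃ s0 k, Run l E s0 r k ∧ t + k + 3 < l s0.2.1 s0.2.2 ∧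
        a'' = (Prod.swap^[t] r.2).2 := by
      cases hw with
      | mid s0 _ k _ _ hr ht hb => exact ⟨s0, k, hr, by omega, hb⟩
      | lst y c _ _ k _ hr ht =>
        refine ⟨_, k, hr, by simp only; omega, ?_⟩
        have := swap_iter hl (c, a'')
        simp only [← ht] at this
        rw [It_letters hr.1, ← Function.iterate_add_apply]
        rw [show t + 1 + k + 3 = (t + k) + 2 * 2 by ring, Function.iterate_add_apply] at this
        change Prod.swap^[t + k] (c, a'') = (c, a'') at this
        rw [this]
    obtain ⟨s0, k, hr, ht, hb⟩ := key
    have ha : b'' = (Prod.swap^[t] r.2).1 := by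
      cases hv with
      | fst s0 x j i k h => rfl
      | mid s0 _ k t _ _ _ ha =>
        rw [ha, Function.iterate_succ_apply']; rfl
    have harc := Run_arc _ _ _ hr t ht
    have hst : (Prod.swap^[t] r.2) = (b'', a'') := by rw [ha, hb]
    rw [hst] at harc
    have := closed_fwd hP harc (old_closed hl hE r)
    have e2 := len_It hl harc
    simp only at e2 ⊢
    rwa [← e2] at this

end extension

/-- A good partial structure. -/
structure GPS (l : ℕ → ℕ → ℕ) where
  X : Type
  E : ℕ → X → X → Prop
  good : Good l E

section limit
variable {l : ℕ → ℕ → ℕ}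

def nextG (hl : LenOK l) (g : GPS l) : GPS l := ⟨Nw g.X, NE l g.E, NE_good hl g.good⟩

def stage (hl : LenOK l) (g : GPS l) : ℕ → GPS l
  | 0 => g
  | n + 1 => nextG hl (stage hl g n)

def oldS (hl : LenOK l) (g : GPS l) (n : ℕ) (x : (stage hl g n).X) : (stage hl g (n + 1)).X :=
  Nw.old x

def emb (hl : LenOK l) (g : GPS l) {n m : ℕ} (h : n ≤ m) (x : (stage hl g n).X) :
    (stage hl g m).X :=
  Nat.leRecOn (C := fun k => (stage hl g k).X) h (fun {k} => oldS hl g k) x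

variable (hl : LenOK l) (g : GPS l)

lemma emb_self {n : ℕ} (x : (stage hl g n).X) : emb hl g le_rfl x = x :=
  Nat.leRecOn_self _

lemma emb_succ {n m : ℕ} (h : n ≤ m) (x : (stage hl g n).X) :
    emb hl g (Nat.le_succ_of_le h) x = oldS hl g m (emb hl g h x) :=
  Nat.leRecOn_succ h _

lemma emb_trans {n m k : ℕ} (h : n ≤ m) (h' : m ≤ k) (x : (stage hl g n).X) :
    emb hl g (h.trans h') x = emb hl g h' (emb hl g h x) :=
  Nat.leRecOn_trans h h' _

lemma emb_inj {n m : ℕ} (h : n ≤ m) : Function.Injective (emb hl g h) := by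
  exact Nat.leRecOn_injective (C := fun k => (stage hl g k).X) h (fun {k} => oldS hl g k)
    (fun k a b hab => Nw.old.inj hab)

lemma emb_E {n m : ℕ} (h : n ≤ m) (i : ℕ) (x y : (stage hl g n).X)
    (hE : (stage hl g n).E i x y) : (stage hl g m).E i (emb hl g h x) (emb hl g h y) := by
  induction m, h using Nat.le_induction with
  | base => simpa only [emb_self] using hE
  | succ m h ih =>
    rw [emb_succ hl g h, emb_succ hl g h]
    exact NE.old _ _ _ ih

def limSetoid : Setoid (Σ n, (stage hl g n).X) where
  r p q := ∃ (k : ℕ) (h : p.1 ≤ k) (h' : q.1 ≤ k), emb hl g h p.2 = emb hl g h' q.2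
  iseqv := by
    constructor
    · intro p; exact ⟨p.1, le_rfl, le_rfl, rfl⟩
    · rintro p q ⟨k, h, h', e⟩; exact ⟨k, h', h, e.symm⟩
    · rintro p q r ⟨k, h, h', e⟩ ⟨k', h1, h1', e'⟩
      refine ⟨max k k', h.trans (le_max_left _ _), h1'.trans (le_max_right _ _), ?_⟩
      rw [emb_trans hl g h (le_max_left _ _), e, emb_trans hl g h1' (le_max_right _ _), ← e',
        ← emb_trans, ← emb_trans]

def Lim : Type := Quotient (limSetoid hl g)

def mkL (n : ℕ) (x : (stage hl g n).X) : Lim hl g := Quotient.mk (limSetoid hl g) ⟨n, x⟩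

lemma mkL_emb {n m : ℕ} (h : n ≤ m) (x : (stage hl g n).X) :
    mkL hl g m (emb hl g h x) = mkL hl g n x := by
  apply Quotient.sound
  refine ⟨m, le_rfl, h, ?_⟩
  exact emb_self _ _ _

lemma mkL_inj (n : ℕ) : Function.Injective (mkL hl g n) := by
  intro x y h
  obtain ⟨k, h, h', e⟩ := Quotient.exact h
  exact emb_inj hl g h e

lemma mkL_surj (p : Lim hl g) : ∃ n x, p = mkL hl g n x := by
  induction p using Quotient.inductionOn with
  | h p => exact ⟨p.1, p.2, rfl⟩

def EL (i : ℕ) (p q : Lim hl g) : Prop :=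
  ∃ n x y, p = mkL hl g n x ∧ q = mkL hl g n y ∧ (stage hl g n).E i x y

lemma EL_up {i : ℕ} {p q : Lim hl g} (h : EL hl g i p q) : ∃ n, ∀ m, n ≤ m → ∃ x y,
    p = mkL hl g m x ∧ q = mkL hl g m y ∧ (stage hl g m).E i x y := by
  obtain ⟨n, x, y, h1, h2, h3⟩ := h
  refine ⟨n, fun m hm => ⟨emb hl g hm x, emb hl g hm y, ?_, ?_, emb_E _ _ _ _ _ _ h3⟩⟩
  · rw [mkL_emb, h1]
  · rw [mkL_emb, h2]

lemma EL_pinj : PInj (EL hl g) := by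
  constructor
  · intro i x y z h1 h2
    obtain ⟨n, h1⟩ := EL_up _ _ h1
    obtain ⟨m, h2⟩ := EL_up _ _ h2
    obtain ⟨a, b, rfl, rfl, h1'⟩ := h1 (max n m) (le_max_left _ _)
    obtain ⟨c, d, h3, rfl, h2'⟩ := h2 (max n m) (le_max_right _ _)
    obtain rfl := mkL_inj _ _ _ h3
    rw [(stage hl g (max n m)).good.fn h1' h2']
  · intro i x y z h1 h2
    obtain ⟨n, h1⟩ := EL_up _ _ h1
    obtain ⟨m, h2⟩ := EL_up _ _ h2
    obtain ⟨a, b, rfl, rfl, h1'⟩ := h1 (max n m) (le_max_left _ _)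
    obtain ⟨c, d, rfl, h3, h2'⟩ := h2 (max n m) (le_max_right _ _)
    obtain rfl := mkL_inj _ _ _ h3
    rw [(stage hl g (max n m)).good.inj h1' h2']

lemma EL_closed (s : Lim hl g × ℕ × ℕ) : It (EL hl g) (l s.2.1 s.2.2) s s := by
  obtain ⟨p, i, j⟩ := s
  obtain ⟨n, x, rfl⟩ := mkL_surj _ _ p
  have h := old_closed hl (stage hl g n).good (x, i, j)
  have h2 := It_map (E := (stage hl g (n + 1)).E) (E' := EL hl g) (mkL hl g (n + 1))
    (fun i x y h => ⟨n + 1, x, y, rfl, rfl, h⟩) h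
  have h3 : mkL hl g (n + 1) (Nw.old x) = mkL hl g n x := by
    rw [← mkL_emb hl g (Nat.le_succ n) x, emb_succ hl g le_rfl, emb_self]; rfl
  simp only [h3] at h2
  exact h2

end limit

theorem exists_action {l : ℕ → ℕ → ℕ} (hl : LenOK l) {X : Type} {E : ℕ → X → X → Prop}
    (hE : Good l E) : ∃ (Y : Type) (σ : ℕ → Equiv.Perm Y) (f : X → Y), Function.Injective f ∧
      (∀ i x y, E i x y → σ i (f x) = f y) ∧ (∀ i, σ i ^ l i i = 1) ∧
      (∀ i j m, l i j = 2 * m → (σ i * σ j) ^ m = 1) := by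
  let g : GPS l := ⟨X, E, hE⟩
  have hP := EL_pinj hl g
  have htot : ∀ i (p : Lim hl g), ∃ q, EL hl g i p q := by
    intro i p
    obtain ⟨u, hu⟩ := It_le (k := 1) (by have := hl.seven i i; simp only; omega)
      (EL_closed hl g (p, i, i))
    rw [It_one] at hu
    exact ⟨u.1, hu.1⟩
  have hsur : ∀ i (q : Lim hl g), ∃ p, EL hl g i p q := by
    intro i p
    have h := EL_closed hl g (p, i, i)
    have h7 := hl.seven i i
    simp only at h
    rw [show l i i = (l i i - 1) + 1 by omega, It_add] at h
    obtain ⟨u, -, hu⟩ := h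
    rw [It_one] at hu
    obtain ⟨h1, h2, h3⟩ := hu
    simp only at h1 h2 h3
    rw [← h2] at h1
    exact ⟨u.1, h1⟩
  choose F hF using htot
  have hbij : ∀ i, Function.Bijective (F i) := by
    intro i
    constructor
    · intro a b hab
      have := hF i a
      rw [hab] at this
      exact hP.inj this (hF i b)
    · intro q
      obtain ⟨p, hp⟩ := hsur i q
      exact ⟨p, hP.fn (hF i p) hp⟩
  let σ : ℕ → Equiv.Perm (Lim hl g) := fun i => Equiv.ofBijective (F i) (hbij i)
  have hσ : ∀ i p, EL hl g i p (σ i p) := hF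
  have hstep : ∀ (s u : Lim hl g × ℕ × ℕ), step (EL hl g) s u →
      u = (σ s.2.2 s.1, s.2.2, s.2.1) := by
    rintro s ⟨u, a, b⟩ ⟨h1, h2, h3⟩
    simp only at h1 h2 h3
    rw [hP.fn h1 (hσ _ _), h2, h3]
  refine ⟨Lim hl g, σ, mkL hl g 0, mkL_inj _ _ _, ?_, ?_, ?_⟩
  · intro i x y h
    exact hP.fn (hσ _ _) ⟨0, x, y, rfl, rfl, h⟩
  · intro i
    have aux : ∀ k (p : Lim hl g) u, It (EL hl g) k (p, i, i) u → u.1 = (σ i ^ k) p := by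
      intro k
      induction k with
      | zero => intro p u h; simp only [It] at h; rw [← h]; rfl
      | succ k ih =>
        rintro p u ⟨v, h1, h2⟩
        have := hstep _ _ h1
        subst this
        rw [ih _ _ h2, pow_succ]; rfl
    ext p
    rw [← aux _ p _ (EL_closed hl g (p, i, i))]; rfl
  · intro i j m hm
    have aux : ∀ k (p : Lim hl g) u, It (EL hl g) (2 * k) (p, i, j) u →
        u.1 = ((σ i * σ j) ^ k) p := by
      intro k
      induction k with
      | zero => intro p u h; simp only [It] at h; rw [← h]; rfl
      | succ k ih =>
        rintro p u ⟨v, h1, w, h2, h3⟩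
        have := hstep _ _ h1
        subst this
        have := hstep _ _ h2
        subst this
        rw [ih _ _ h3, pow_succ]; rfl
    ext p
    have := EL_closed hl g (p, i, j)
    simp only [hm] at this
    rw [← aux _ p _ this]; rfl

end SC


namespace SC

lemma take_isInfix {α : Type} (n : ℕ) (w : List α) : w.take n <:+: w :=
  ⟨[], w.drop n, by simp⟩

/-- Alternating one-signed words. -/
def run (i j : ℕ) (e : Bool) : ℕ → List (ℕ × Bool)
  | 0 => []
  | k + 1 => (i, e) :: run j i e k

/-- Evaluation of a word in a group. -/
def ev {G : Type} [Group G] (v : ℕ → G) (w : List (ℕ × Bool)) : G :=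
  (w.map (fun x => cond x.2 (v x.1) (v x.1)⁻¹)).prod

section ev
variable {G : Type} [Group G] (v : ℕ → G)

@[simp] lemma ev_nil : ev v [] = 1 := rfl
@[simp] lemma ev_cons (x w) : ev v (x :: w) = cond x.2 (v x.1) (v x.1)⁻¹ * ev v w := by
  simp [ev]
@[simp] lemma ev_append (w w') : ev v (w ++ w') = ev v w * ev v w' := by simp [ev]
lemma ev_eq_lift (w) : ev v w = FreeGroup.lift v (FreeGroup.mk w) := by
  rw [FreeGroup.lift_mk]; rfl
@[simp] lemma ev_invRev (w) : ev v (FreeGroup.invRev w) = (ev v w)⁻¹ := by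
  rw [ev_eq_lift, ev_eq_lift, ← FreeGroup.inv_mk, map_inv]
lemma ev_reduce (w) : ev v (FreeGroup.reduce w) = ev v w := by
  rw [ev_eq_lift, ev_eq_lift, FreeGroup.reduce.self]
lemma ev_replicate (n i) (e : Bool) : ev v (List.replicate n (i, e)) = (cond e (v i) (v i)⁻¹) ^ n := by
  simp [ev]
lemma ev_flatten_replicate (n w) : ev v (List.replicate n w).flatten = ev v w ^ n := by
  induction n with
  | zero => simp
  | succ n ih => simp [List.replicate_succ, ih, pow_succ']

end ev

@[simp] lemma run_length (i j e k) : (run i j e k).length = k := by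
  induction k generalizing i j with
  | zero => rfl
  | succ k ih => simp [run, ih]

lemma run_getElem? (i j e k t) (h : t < k) :
    (run i j e k)[t]? = some (if Even t then i else j, e) := by
  induction k generalizing i j t with
  | zero => omega
  | succ k ih =>
    cases t with
    | zero => simp [run]
    | succ t =>
      simp only [run, List.getElem?_cons_succ]
      rw [ih _ _ _ (by omega)]
      by_cases ht : Even t <;> simp [ht, Nat.even_add_one]

lemma run_append (i j e a b) : run i j e (a + b) =
    run i j e a ++ run (if Even a then i else j) (if Even a then j else i) e b := by
  induction a generalizing i j with
  | zero => simp [run]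
  | succ a ih =>
    rw [show a + 1 + b = (a + b) + 1 by ring]
    simp only [run, ih, List.cons_append]
    by_cases ha : Even a <;> simp [ha, Nat.even_add_one]

lemma run_reverse (i j e k) : (run i j e k).reverse =
    run (if Even k then j else i) (if Even k then i else j) e k := by
  induction k generalizing i j with
  | zero => simp [run]
  | succ k ih =>
    rw [run, List.reverse_cons, ih, run_append _ _ _ k 1]
    by_cases hk : Even k <;> simp [hk, Nat.even_add_one, run]

/-- The linear graph of a word. -/
def WE (w : List (ℕ × Bool)) (i a b : ℕ) : Prop :=
  (a = b + 1 ∧ w[b]? = some (i, true)) ∨ (b = a + 1 ∧ w[a]? = some (i, false))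

lemma red_consec {w : List (ℕ × Bool)} (hw : FreeGroup.IsReduced w) {a i e e'}
    (h : w[a]? = some (i, e)) (h' : w[a + 1]? = some (i, e')) : e = e' := by
  obtain ⟨h1, h2⟩ := List.getElem?_eq_some_iff.1 h
  obtain ⟨h3, h4⟩ := List.getElem?_eq_some_iff.1 h'
  have := List.isChain_iff_getElem.1 hw a h3
  rw [h2, h4] at this
  exact this rfl

lemma WE_pinj {w : List (ℕ × Bool)} (hw : FreeGroup.IsReduced w) : PInj (WE w) := by
  constructor
  · rintro i x y z (⟨rfl, h1⟩ | ⟨rfl, h1⟩) (⟨h2, h3⟩ | ⟨rfl, h3⟩)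
    · omega
    · exact absurd (red_consec hw h1 h3) (by simp)
    · subst h2; exact absurd (red_consec hw h3 h1) (by simp)
    · rfl
  · rintro i x y z (⟨rfl, h1⟩ | ⟨rfl, h1⟩) (⟨h2, h3⟩ | ⟨h2, h3⟩)
    · omega
    · subst h2; exact absurd (red_consec hw h3 h1) (by simp)
    · subst h2; exact absurd (red_consec hw h1 h3) (by simp)
    · omega

lemma up_run {w : List (ℕ × Bool)} (k p a i j m) (s')
    (hp : w[p]? = some (m, false)) (ha : a = p + 1)
    (h : It (WE w) k (a, i, j) s') : run j i false k <+: w.drop a := by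
  induction k generalizing p a i j m with
  | zero => simp [run]
  | succ k ih =>
    obtain ⟨⟨b, i', j'⟩, ⟨h1, h2, h3⟩, h4⟩ := h
    simp only at h1 h2 h3
    subst h2 h3
    rcases h1 with ⟨h1, h5⟩ | ⟨h1, h5⟩
    · obtain rfl : b = p := by omega
      rw [hp] at h5; simp at h5
    · have := ih a b _ _ _ h5 h1 h4
      obtain ⟨h6, h7⟩ := List.getElem?_eq_some_iff.1 h5
      rw [List.drop_eq_getElem_cons h6, h7, run, List.cons_prefix_cons]
      rw [h1] at this
      exact ⟨rfl, this⟩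

lemma down_run {w : List (ℕ × Bool)} (k a i j m) (s')
    (hp : w[a]? = some (m, true))
    (h : It (WE w) k (a, i, j) s') : run j i true k <+: (w.take a).reverse := by
  induction k generalizing a i j m with
  | zero => simp [run]
  | succ k ih =>
    obtain ⟨⟨b, i', j'⟩, ⟨h1, h2, h3⟩, h4⟩ := h
    simp only at h1 h2 h3
    subst h2 h3
    rcases h1 with ⟨h1, h5⟩ | ⟨h1, h5⟩
    · have := ih b _ _ _ h5 h4
      obtain ⟨h6, h7⟩ := List.getElem?_eq_some_iff.1 h5
      rw [h1, List.take_add_one, h5]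
      simp only [Option.toList_some, List.reverse_append, List.reverse_cons, List.reverse_nil,
        List.nil_append, List.singleton_append]
      rw [run, List.cons_prefix_cons]
      exact ⟨rfl, this⟩
    · rw [hp] at h5; simp at h5

lemma It_run {w : List (ℕ × Bool)} (k i j) (s s') (h : It (WE w) k s s')
    (hij : s.2 = (i, j)) :
    ∃ e, run j i e k <:+: w ∨ run i j e k <:+: w := by
  obtain ⟨a, i', j'⟩ := s
  obtain ⟨rfl, rfl⟩ := Prod.mk.inj hij
  cases k with
  | zero => exact ⟨true, Or.inl (by simp [run])⟩
  | succ k =>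
    obtain ⟨⟨b, i', j'⟩, ⟨h1, h2, h3⟩, h4⟩ := h
    simp only at h1 h2 h3
    subst h2 h3
    rcases h1 with ⟨h1, h5⟩ | ⟨h1, h5⟩
    · have := down_run _ _ _ _ _ _ h5 h4
      obtain ⟨h6, h7⟩ := List.getElem?_eq_some_iff.1 h5
      have h8 : run i' j' true (k + 1) <+: (w.take (b + 1)).reverse := by
        rw [List.take_add_one, h5]
        simp only [Option.toList_some, List.reverse_append, List.reverse_cons, List.reverse_nil,
          List.nil_append, List.singleton_append]
        rw [run, List.cons_prefix_cons]
        exact ⟨rfl, this⟩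
      have h9 : (run i' j' true (k + 1)).reverse <:+: w := by
        have := h8.isInfix.reverse
        rw [List.reverse_reverse] at this
        exact this.trans (take_isInfix _ _)
      rw [run_reverse] at h9
      refine ⟨true, ?_⟩
      by_cases hk : Even (k + 1)
      · right; simpa [hk] using h9
      · left; simpa [hk] using h9
    · have := up_run _ _ _ _ _ _ _ h5 h1 h4
      obtain ⟨h6, h7⟩ := List.getElem?_eq_some_iff.1 h5
      refine ⟨false, Or.inl ?_⟩
      have h8 : run i' j' false (k + 1) <+: w.drop a := by
        rw [List.drop_eq_getElem_cons h6, h7, run, List.cons_prefix_cons]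
        rw [h1] at this
        exact ⟨rfl, this⟩
      exact h8.isInfix.trans (List.drop_suffix _ _).isInfix

theorem greendlinger {l : ℕ → ℕ → ℕ} (hl : LenOK l) {w : List (ℕ × Bool)}
    (hw : FreeGroup.IsReduced w) (hne : w ≠ [])
    (hno : ∀ i j e, ¬ run i j e (l i j - 3) <:+: w) :
    ∃ (Y : Type) (σ : ℕ → Equiv.Perm Y), (∀ i, σ i ^ l i i = 1) ∧
      (∀ i j m, l i j = 2 * m → (σ i * σ j) ^ m = 1) ∧ ev σ w ≠ 1 := by
  have hG : Good l (WE w) := by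
    refine ⟨WE_pinj hw, ?_⟩
    intro s s' h
    exfalso
    obtain ⟨e, h | h⟩ := It_run _ _ _ _ _ h rfl
    · rw [hl.symm] at h; exact hno _ _ _ h
    · exact hno _ _ _ h
  obtain ⟨Y, σ, f, hf, hE, h1, h2⟩ := exists_action hl hG
  refine ⟨Y, σ, h1, h2, fun hev => ?_⟩
  have key : ∀ k, k ≤ w.length → ev σ (w.drop (w.length - k)) (f w.length) = f (w.length - k) := by
    intro k
    induction k with
    | zero => simp
    | succ k ih =>
      intro hk
      have ih := ih (by omega)
      have hlt : w.length - (k + 1) < w.length := by omega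
      rw [List.drop_eq_getElem_cons hlt, ev_cons]
      have e : w.length - (k + 1) + 1 = w.length - k := by omega
      rw [e, Equiv.Perm.mul_apply, ih]
      have hget := List.getElem?_eq_getElem hlt
      rcases hx : w[w.length - (k + 1)] with ⟨i, b⟩
      rw [hx] at hget
      cases b with
      | true => exact hE _ _ _ (Or.inl ⟨e.symm, hget⟩)
      | false =>
        simp only [cond_false]
        rw [Equiv.Perm.inv_eq_iff_eq]
        exact (hE _ _ _ (Or.inr ⟨e.symm, hget⟩)).symm
  have := key w.length le_rfl
  simp only [Nat.sub_self, List.drop_zero, hev] at this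
  have h3 := hf this
  simp at h3
  exact hne h3

end SC


namespace SC

/-- A letter of a given sign. -/
def lt {G : Type} [Group G] (v : ℕ → G) (e : Bool) (i : ℕ) : G := cond e (v i) (v i)⁻¹

/-- Abstract setting: a group satisfying the relations and the Greendlinger property. -/
structure SCG {G : Type} [Group G] (v : ℕ → G) (l : ℕ → ℕ → ℕ) : Prop where
  diag : ∀ i, l i i = 7
  off : ∀ i j, i ≠ j → l i j = 22 ∨ l i j = 26
  symm : ∀ i j, l i j = l j i
  pow7 : ∀ i, v i ^ 7 = 1
  pow : ∀ i j, i ≠ j → (v i * v j) ^ (l i j / 2) = 1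
  gen : ∀ x, ∃ w, ev v w = x
  gr : ∀ w, FreeGroup.IsReduced w → w ≠ [] → ev v w = 1 →
    ∃ i j e, run i j e (l i j - 3) <:+: w

section
variable {G : Type} [Group G] {v : ℕ → G} {l : ℕ → ℕ → ℕ}

lemma lt_pow7 (S : SCG v l) (e i) : lt v e i ^ 7 = 1 := by
  cases e <;> simp [lt, S.pow7]

lemma lt_pow (S : SCG v l) (e i j) (h : i ≠ j) : (lt v e i * lt v e j) ^ (l i j / 2) = 1 := by
  cases e
  · simp only [lt, cond_false]
    rw [← mul_inv_rev, inv_pow, S.symm i j, S.pow j i h.symm, inv_one]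
  · exact S.pow i j h

lemma ev_run_two (e i j m) : ev v (run i j e (2 * m)) = (lt v e i * lt v e j) ^ m := by
  induction m with
  | zero => simp [run]
  | succ m ih =>
    rw [show 2 * (m + 1) = 2 * m + 1 + 1 by ring]
    simp only [run, ev_cons, ih, pow_succ']
    simp [lt, mul_assoc]

lemma run_same (e i m) : run i i e m = List.replicate m (i, e) := by
  induction m with
  | zero => simp [run]
  | succ m ih => simp [run, ih, List.replicate_succ]

lemma ev_run_same (e i m) : ev v (run i i e m) = lt v e i ^ m := by
  rw [run_same, ev_replicate]; rfl

lemma ev_run_full (S : SCG v l) (e i j) : ev v (run i j e (l i j)) = 1 := by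
  by_cases h : i = j
  · subst h; rw [ev_run_same, S.diag, lt_pow7 S]
  · have : l i j = 2 * (l i j / 2) := by rcases S.off i j h with h | h <;> omega
    rw [this, ev_run_two, lt_pow S _ _ _ h]

lemma shorten (S : SCG v l) {e i j k w} (h : run i j e k <:+: w) (hk : k ≤ l i j)
    (hk2 : l i j < 2 * k) : ∃ w', w'.length < w.length ∧ ev v w' = ev v w := by
  obtain ⟨p, q, rfl⟩ := h
  obtain ⟨m, hm⟩ := Nat.exists_eq_add_of_le hk
  have h1 := ev_run_full S e i j
  rw [hm, run_append, ev_append] at h1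
  refine ⟨p ++ FreeGroup.invRev (run (if Even k then i else j) (if Even k then j else i) e m) ++ q,
    ?_, ?_⟩
  · simp; omega
  · simp only [ev_append, ev_invRev]
    rw [← eq_inv_of_mul_eq_one_left h1]

lemma run_of_getElem {w : List (ℕ × Bool)} {q i j e k}
    (h : ∀ t < k, w[q + t]? = some (if Even t then i else j, e)) : run i j e k <:+: w := by
  have : run i j e k = (w.drop q).take k := by
    apply List.ext_getElem?
    intro t
    by_cases ht : t < k
    · rw [run_getElem? _ _ _ _ _ ht, List.getElem?_take_of_lt ht, List.getElem?_drop, h t ht]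
    · rw [List.getElem?_eq_none (by simp; omega), List.getElem?_eq_none (by simp; omega)]
  rw [this]
  exact (take_isInfix _ _).trans (List.drop_suffix _ _).isInfix

lemma getElem_of_run {w : List (ℕ × Bool)} {i j e k} (h : run i j e k <:+: w) :
    ∃ q, ∀ t < k, w[q + t]? = some (if Even t then i else j, e) := by
  obtain ⟨p, s, rfl⟩ := h
  refine ⟨p.length, fun t ht => ?_⟩
  rw [List.append_assoc, List.getElem?_append_right (by omega),
    List.getElem?_append_left (by simp; omega)]
  simp [run_getElem? _ _ _ _ _ ht]

lemma flat_getElem (w : List (ℕ × Bool)) (N t : ℕ) (h : t < N * w.length) :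
    (List.replicate N w).flatten[t]? = w[t % w.length]? := by
  induction N generalizing t with
  | zero => omega
  | succ N ih =>
    rw [List.replicate_succ, List.flatten_cons]
    by_cases ht : t < w.length
    · rw [List.getElem?_append_left ht, Nat.mod_eq_of_lt ht]
    · rw [List.getElem?_append_right (by omega), ih _ (by rw [Nat.add_mul] at h; omega)]
      rw [Nat.mod_eq_sub_mod (by omega : w.length ≤ t)]

lemma cyc (S : SCG v l) {w : List (ℕ × Bool)} (hw : FreeGroup.IsCyclicallyReduced w)
    (hne : w ≠ []) {N : ℕ} (hN : 0 < N) (h : ev v w ^ N = 1) :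
    ∃ i j e p, p < w.length ∧ ∀ t < l i j - 3,
      w[(p + t) % w.length]? = some (if Even t then i else j, e) := by
  rw [← ev_flatten_replicate] at h
  have hlen : 0 < w.length := List.length_pos_iff.2 hne
  have hfl : (List.replicate N w).flatten.length = N * w.length := by simp
  obtain ⟨i, j, e, hr⟩ := S.gr _ (hw.flatten_replicate N).isReduced (by
    intro h0; have := Nat.mul_pos hN hlen; rw [← hfl, h0] at this; simp at this) h
  obtain ⟨q, hq⟩ := getElem_of_run hr
  refine ⟨i, j, e, q % w.length, Nat.mod_lt _ hlen, fun t ht => ?_⟩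
  have h1 := hq t ht
  have h2 : q + t < N * w.length := by
    have := (List.getElem?_eq_some_iff.1 h1).1
    omega
  rw [flat_getElem _ _ _ h2] at h1
  rw [Nat.mod_add_mod, h1]

lemma min_red {w : List (ℕ × Bool)}
    (h : ∀ w', ev v w' = ev v w → w.length ≤ w'.length) : FreeGroup.IsReduced w := by
  have h1 := h _ (ev_reduce v w)
  rw [FreeGroup.isReduced_iff_reduce_eq]
  exact ((FreeGroup.reduce.red (L := w)).sublist).eq_of_length_le h1

lemma off_or (S : SCG v l) (i j) : (i = j ∧ l i j = 7) ∨ (i ≠ j ∧ l i j = 22) ∨ (i ≠ j ∧ l i j = 26) := by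
  by_cases h : i = j
  · subst h; exact Or.inl ⟨rfl, S.diag i⟩
  · rcases S.off i j h with h' | h'
    · exact Or.inr (Or.inl ⟨h, h'⟩)
    · exact Or.inr (Or.inr ⟨h, h'⟩)

lemma eq_one_of_coprime {x : G} {a b : ℕ} (h : Nat.Coprime a b) (ha : x ^ a = 1) (hb : x ^ b = 1) :
    x = 1 := by
  have h1 := orderOf_dvd_of_pow_eq_one ha
  have h2 := orderOf_dvd_of_pow_eq_one hb
  have h3 := Nat.dvd_gcd h1 h2
  rw [h] at h3
  exact orderOf_eq_one_iff.1 (Nat.dvd_one.1 h3)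

lemma prod_pow7 (S : SCG v l) {e i j} (h : i ≠ j) {x : G} (hx : x = lt v e i * lt v e j) {q : ℕ}
    (h7 : (x ^ q) ^ 7 = 1) : x ^ q = 1 := by
  have h1 : (x ^ q) ^ (l i j / 2) = 1 := by
    rw [← pow_mul, mul_comm, pow_mul, hx, lt_pow S _ _ _ h, one_pow]
  refine eq_one_of_coprime (a := 7) ?_ h7 h1
  rcases S.off i j h with h | h <;> rw [h] <;> decide

theorem torsion (S : SCG v l) {x : G} (hx : x ≠ 1) (h7 : x ^ 7 = 1) :
    ∃ g a, ∃ k : ℤ, x = g * v a ^ k * g⁻¹ := by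
  classical
  have hex : ∃ n w g, w.length = n ∧ ev v w = g * x * g⁻¹ := by
    obtain ⟨w, hw⟩ := S.gen x
    exact ⟨_, w, 1, rfl, by simp [hw]⟩
  obtain ⟨w, g, hn, hw⟩ := Nat.find_spec hex
  have hmin : ∀ w' g', ev v w' = g' * x * g'⁻¹ → w.length ≤ w'.length := by
    intro w' g' h
    rw [hn]
    exact Nat.find_min' hex ⟨w', g', rfl, h⟩
  have hred : FreeGroup.IsReduced w := min_red (v := v) (fun w' h => hmin w' g (h.trans hw))
  have hcr : FreeGroup.IsCyclicallyReduced w := by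
    have h1 := FreeGroup.reduceCyclically.conj_conjugator_reduceCyclically w
    have h2 : ev v (FreeGroup.reduceCyclically w) = ((ev v (FreeGroup.reduceCyclically.conjugator w))⁻¹ * g) * x *
        ((ev v (FreeGroup.reduceCyclically.conjugator w))⁻¹ * g)⁻¹ := by
      have h3 := congrArg (ev v) h1
      simp only [ev_append, ev_invRev] at h3
      rw [hw] at h3
      rw [mul_inv_rev, inv_inv]
      calc _ = (ev v (FreeGroup.reduceCyclically.conjugator w))⁻¹ * (ev v (FreeGroup.reduceCyclically.conjugator w) * ev v (FreeGroup.reduceCyclically w) * (ev v (FreeGroup.reduceCyclically.conjugator w))⁻¹) * ev v (FreeGroup.reduceCyclically.conjugator w) := by group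
        _ = _ := by rw [h3]; group
    have h4 := hmin _ _ h2
    have h5 := congrArg List.length h1
    simp at h5
    have h6 : FreeGroup.reduceCyclically.conjugator w = [] := by
      rw [← List.length_eq_zero_iff]; omega
    rw [h6] at h1
    simp at h1
    rw [← h1]
    exact FreeGroup.reduceCyclically.isCyclicallyReduced hred
  have hne : w ≠ [] := by
    rintro rfl
    apply hx
    simp only [ev_nil] at hw
    have : x = g⁻¹ * (g * x * g⁻¹) * g := by group
    rw [this, ← hw]; group
  obtain ⟨i, j, e, p, hp, hr⟩ := cyc S hcr hne (N := 7) (by norm_num) (by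
    rw [hw, conj_pow, h7]; group)
  -- rotate
  have hw' : ∃ g', ev v (w.rotate p) = g' * x * g'⁻¹ := by
    rw [List.rotate_eq_drop_append_take hp.le, ev_append]
    refine ⟨(ev v (w.take p))⁻¹ * g, ?_⟩
    have : ev v (w.take p) * ev v (w.drop p) = g * x * g⁻¹ := by
      rw [← ev_append, List.take_append_drop, hw]
    rw [mul_inv_rev, inv_inv]
    calc _ = (ev v (w.take p))⁻¹ * (ev v (w.take p) * ev v (w.drop p)) * ev v (w.take p) := by group
      _ = _ := by rw [this]; group
  obtain ⟨g', hg'⟩ := hw'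
  have hlen : 0 < w.length := List.length_pos_iff.2 hne
  have hr' : ∀ t, t < l i j - 3 → t < w.length →
      (w.rotate p)[t]? = some (if Even t then i else j, e) := by
    intro t ht ht'
    rw [List.getElem?_rotate ht', add_comm t p, hr t ht]
  have hll : 4 ≤ l i j - 3 ∧ l i j < 2 * (l i j - 3) := by
    rcases off_or S i j with h | h | h <;> omega
  rcases le_or_gt (l i j - 3) w.length with hK | hK
  · exfalso
    have : run i j e (l i j - 3) <:+: w.rotate p := by
      apply run_of_getElem (q := 0)
      intro t ht
      rw [zero_add]
      exact hr' t ht (by omega)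
    obtain ⟨w', h1, h2⟩ := shorten S this (by omega) (by omega)
    have := hmin w' g' (h2.trans hg')
    rw [List.length_rotate] at h1
    omega
  · have hrun : w.rotate p = run i j e w.length := by
      apply List.ext_getElem?
      intro t
      by_cases ht : t < w.length
      · rw [hr' t (by omega) ht, run_getElem? _ _ _ _ _ ht]
      · rw [List.getElem?_eq_none (by simp; omega), List.getElem?_eq_none (by simp; omega)]
    rw [hrun] at hg'
    by_cases hij : i = j
    · subst hij
      rw [ev_run_same] at hg'
      have hx' : x = g'⁻¹ * (lt v e i ^ w.length) * g' := by rw [hg']; group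
      cases e
      · refine ⟨g'⁻¹, i, -(w.length : ℤ), ?_⟩
        rw [hx']; simp [lt]
      · refine ⟨g'⁻¹, i, w.length, ?_⟩
        rw [hx']; simp [lt]
    · exfalso
      have h0 := hr 0 (by omega)
      have h1 := hr w.length (by omega)
      rw [Nat.add_mod_right] at h1
      rw [add_zero, h1] at h0
      have hev : Even w.length := by
        by_contra hodd
        simp [hodd] at h0
        exact hij h0.symm
      obtain ⟨q, hq⟩ := hev
      rw [hq, ← two_mul, ev_run_two] at hg'
      have := prod_pow7 S hij rfl (q := q) (e := e) (by rw [hg', conj_pow, h7]; group)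
      rw [this] at hg'
      apply hx
      have h3 : x = g'⁻¹ * (g' * x * g'⁻¹) * g' := by group
      rw [h3, ← hg']; group

end
end SC


namespace SC
section
variable {G : Type} [Group G] {v : ℕ → G} {l : ℕ → ℕ → ℕ}

lemma invRev_zero (u : List (ℕ × Bool)) :
    (FreeGroup.invRev u)[0]? = (u[u.length - 1]?).map (fun x => (x.1, !x.2)) := by
  rw [FreeGroup.invRev, ← List.head?_eq_getElem?, List.head?_reverse, ← List.getLast?_eq_getElem?,
    List.getLast?_map]

lemma invRev_last (u : List (ℕ × Bool)) :
    (FreeGroup.invRev u)[(FreeGroup.invRev u).length - 1]? = (u[0]?).map (fun x => (x.1, !x.2)) := by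
  rw [FreeGroup.invRev, ← List.head?_eq_getElem?, ← List.getLast?_eq_getElem?,
    List.getLast?_reverse, List.head?_map]

lemma half {A u B : List (ℕ × Bool)} (hu : u ≠ []) {r K : ℕ} {f : ℕ → ℕ} {e : Bool}
    (hr : r < A.length + u.length)
    (h : ∀ t < K, (A ++ u ++ B ++ FreeGroup.invRev u)[(r + t) %
      (A ++ u ++ B ++ FreeGroup.invRev u).length]? = some (f t, e)) :
    r + K ≤ A.length + u.length + B.length := by
  by_contra hc
  have hlen : 0 < u.length := List.length_pos_iff.2 hu
  have hn : (A ++ u ++ B ++ FreeGroup.invRev u).length = A.length + u.length + B.length + u.length := by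
    simp; ring
  have h1 := h (A.length + u.length - 1 - r) (by omega)
  have h2 := h (A.length + u.length + B.length - r) (by omega)
  rw [Nat.mod_eq_of_lt (by omega)] at h1 h2
  rw [List.getElem?_append_left (by simp; omega), List.getElem?_append_left (by simp; omega),
    List.getElem?_append_right (by omega)] at h1
  rw [List.getElem?_append_right (by simp; omega)] at h2
  rw [show r + (A.length + u.length - 1 - r) - A.length = u.length - 1 by omega] at h1
  rw [show r + (A.length + u.length + B.length - r) - (A ++ u ++ B).length = 0 by simp; omega,
    invRev_zero, h1] at h2
  simp at h2

lemma core (S : SCG v l) {a b p q : ℕ} {α β : Bool} {u : List (ℕ × Bool)} (hp : p ≤ 3) (hq : q ≤ 3)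
    (hu : u ≠ []) (h0 : ∀ e, u[0]? ≠ some (a, e)) (h1 : ∀ e, u[u.length - 1]? ≠ some (b, e))
    {i j r : ℕ} {e : Bool}
    (hr : ∀ t < l i j - 3, (List.replicate p (a, α) ++ u ++ List.replicate q (b, β))[r + t]?
      = some (if Even t then i else j, e)) :
    ∃ w', w'.length < u.length ∧ ev v w' = ev v u := by
  have hlen : 0 < u.length := List.length_pos_iff.2 hu
  have hA : ∀ t < l i j - 3, r + t < p → (a, α) = (if Even t then i else j, e) := by
    intro t ht h
    have := hr t ht
    rw [List.getElem?_append_left (by simp; omega), List.getElem?_append_left (by simp; omega),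
      List.getElem?_replicate_of_lt h] at this
    exact Option.some.inj this
  have hU : ∀ t < l i j - 3, p ≤ r + t → r + t < p + u.length →
      u[r + t - p]? = some (if Even t then i else j, e) := by
    intro t ht h h'
    have := hr t ht
    rw [List.getElem?_append_left (by simp; omega), List.getElem?_append_right (by simp; omega)] at this
    simpa using this
  have hB : ∀ t < l i j - 3, p + u.length ≤ r + t → (b, β) = (if Even t then i else j, e) := by
    intro t ht h
    have := hr t ht
    rw [List.getElem?_append_right (by simp; omega)] at this
    have h3 := List.getElem?_eq_some_iff.1 this
    obtain ⟨h3, h4⟩ := h3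
    rw [← h4]; simp
  have hend : r + (l i j - 3) ≤ p + u.length + q := by
    by_contra hc
    have hK : 0 < l i j - 3 := by rcases off_or S i j with h | h | h <;> omega
    have := (List.getElem?_eq_some_iff.1 (hr (l i j - 3 - 1) (by omega))).1
    simp at this
    omega
  rcases off_or S i j with ⟨hij, hl⟩ | hij
  · subst hij
    have hl' := hl
    simp only [ite_self, hl] at hA hU hB hend hr
    norm_num at hA hU hB hend
    have hrp : p ≤ r := by
      by_contra hc
      have e1 := hA 0 (by omega) (by omega)
      have e2 := hU (p - r) (by omega) (by omega) (by omega)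
      rw [show r + (p - r) - p = 0 by omega] at e2
      apply h0 e; rw [e2, e1.1]
    have hrq : r + 4 ≤ p + u.length := by
      by_contra hc
      have e1 := hB 3 (by omega) (by omega)
      have e2 := hU (p + u.length - 1 - r) (by omega) (by omega) (by omega)
      rw [show r + (p + u.length - 1 - r) - p = u.length - 1 by omega] at e2
      apply h1 e; rw [e2, e1.1]
    have hrun : run i i e 4 <:+: u := by
      apply run_of_getElem (q := r - p)
      intro t ht
      have := hU t ht (by omega) (by omega)
      rw [ite_self, ← this]; congr 1; omega
    exact shorten S hrun (by omega) (by omega)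
  · have hne : i ≠ j := by rcases hij with h | h <;> exact h.1
    have hl : l i j = 22 ∨ l i j = 26 := by
      rcases hij with h | h
      · exact Or.inl h.2
      · exact Or.inr h.2
    have hrp : p ≤ r + 1 := by
      by_contra hc
      have e1 := hA 0 (by omega) (by omega)
      have e2 := hA 1 (by omega) (by omega)
      rw [e1] at e2
      simp at e2
      exact hne e2
    have hrq : r + (l i j - 3) ≤ p + u.length + 1 := by
      by_contra hc
      have e1 := hB (l i j - 3 - 1) (by omega) (by omega)
      have e2 := hB (l i j - 3 - 2) (by omega) (by omega)
      rw [e1] at e2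
      rcases hl with h | h <;> rw [h] at e2 <;> norm_num at e2
      · exact hne (by simpa [Nat.even_iff] using e2)
      · exact hne (by simpa [Nat.even_iff] using e2)
    have hrun : run j i e (l i j - 5) <:+: u := by
      apply run_of_getElem (q := r + 1 - p)
      intro t ht
      have := hU (t + 1) (by omega) (by omega) (by omega)
      rw [show r + 1 - p + t = r + (t + 1) - p by omega, this]
      by_cases hte : Even t <;> simp [hte, Nat.even_add_one]
    rw [S.symm] at hl
    rw [S.symm i j] at hrun
    exact shorten S hrun (by omega) (by omega)

lemma zpow_letter (S : SCG v l) (a : ℕ) (k : ℤ) (h : v a ^ k ≠ 1) :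
    ∃ p α, 1 ≤ p ∧ p ≤ 3 ∧ v a ^ k = ev v (List.replicate p (a, α)) := by
  have h7 := S.pow7 a
  have hk : v a ^ k = v a ^ (k % 7).toNat := by
    rw [← zpow_natCast, Int.toNat_of_nonneg (Int.emod_nonneg _ (by norm_num))]
    conv_lhs => rw [← Int.emod_add_mul_ediv k 7, zpow_add, zpow_mul]
    norm_cast
    rw [h7]; simp
  have hlt : (k % 7).toNat < 7 := by omega
  generalize (k % 7).toNat = m at hk hlt
  rw [hk] at h ⊢
  have hinv : ∀ s t : ℕ, s + t = 7 → v a ^ s = (v a)⁻¹ ^ t := by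
    intro s t hst
    rw [inv_pow, eq_inv_iff_mul_eq_one, ← pow_add, hst, h7]
  interval_cases m
  · simp at h
  · exact ⟨1, true, by norm_num, by norm_num, by rw [ev_replicate]; rfl⟩
  · exact ⟨2, true, by norm_num, by norm_num, by rw [ev_replicate]; rfl⟩
  · exact ⟨3, true, by norm_num, by norm_num, by rw [ev_replicate]; rfl⟩
  · exact ⟨3, false, by norm_num, by norm_num, by rw [ev_replicate]; exact hinv _ _ rfl⟩
  · exact ⟨2, false, by norm_num, by norm_num, by rw [ev_replicate]; exact hinv _ _ rfl⟩
  · exact ⟨1, false, by norm_num, by norm_num, by rw [ev_replicate]; exact hinv _ _ rfl⟩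

lemma red_replicate (n : ℕ) (x : ℕ × Bool) : FreeGroup.IsReduced (List.replicate n x) := by
  rw [FreeGroup.isReduced_iff_reduce_eq, FreeGroup.reduce_replicate]

lemma red_invRev {u : List (ℕ × Bool)} (h : FreeGroup.IsReduced u) :
    FreeGroup.IsReduced (FreeGroup.invRev u) := by
  rw [FreeGroup.isReduced_iff_reduce_eq] at h ⊢
  rw [FreeGroup.reduce_invRev, h]

lemma cr_W {a b p q : ℕ} {α β : Bool} {u : List (ℕ × Bool)} (hp : 1 ≤ p) (hq : 1 ≤ q)
    (hu : u ≠ []) (h0 : ∀ e, u[0]? ≠ some (a, e)) (h1 : ∀ e, u[u.length - 1]? ≠ some (b, e))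
    (hred : FreeGroup.IsReduced u) :
    FreeGroup.IsCyclicallyReduced (List.replicate p (a, α) ++ u ++ List.replicate q (b, β) ++
      FreeGroup.invRev u) := by
  have g0 : ∀ x ∈ u.head?, x.1 ≠ a := by
    intro x hx e
    rw [List.head?_eq_getElem?] at hx
    apply h0 x.2; rw [← e]; exact hx
  have g1 : ∀ x ∈ u.getLast?, x.1 ≠ b := by
    intro x hx e
    rw [List.getLast?_eq_getElem?] at hx
    apply h1 x.2; rw [← e]; exact hx
  have g2 : ∀ x ∈ (FreeGroup.invRev u).head?, x.1 ≠ b := by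
    intro x hx
    simp only [FreeGroup.invRev, List.head?_reverse, List.getLast?_map] at hx
    simp only [Option.mem_def, Option.map_eq_some_iff] at hx
    obtain ⟨y, hy, rfl⟩ := hx
    exact g1 y hy
  have g3 : ∀ x ∈ (FreeGroup.invRev u).getLast?, x.1 ≠ a := by
    intro x hx
    simp only [FreeGroup.invRev, List.getLast?_reverse, List.head?_map] at hx
    simp only [Option.mem_def, Option.map_eq_some_iff] at hx
    obtain ⟨y, hy, rfl⟩ := hx
    exact g0 y hy
  have hu' : FreeGroup.invRev u ≠ [] := by
    intro h; apply hu; rw [← List.length_eq_zero_iff, ← FreeGroup.invRev_length, h]; rfl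
  have hpa : ∀ (n : ℕ) (x y : ℕ × Bool), 1 ≤ n → (y ∈ (List.replicate n x).getLast? ↔ y = x) := by
    intro n x y hn
    rw [List.getLast?_replicate, if_neg (by omega)]; simp [eq_comm]
  have hpa' : ∀ (n : ℕ) (x y : ℕ × Bool), 1 ≤ n → (y ∈ (List.replicate n x).head? ↔ y = x) := by
    intro n x y hn
    rw [List.head?_replicate, if_neg (by omega)]; simp [eq_comm]
  constructor
  · rw [FreeGroup.IsReduced, List.isChain_append, List.isChain_append, List.isChain_append]
    refine ⟨⟨⟨red_replicate _ _, hred, ?_⟩, red_replicate _ _, ?_⟩, red_invRev hred, ?_⟩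
    · intro x hx y hy e
      rw [hpa _ _ _ hp] at hx
      subst hx
      exact absurd e.symm (g0 y hy)
    · intro x hx y hy e
      rw [hpa' _ _ _ hq] at hy
      rw [List.getLast?_append_of_ne_nil _ hu] at hx
      subst hy
      exact absurd e (g1 x hx)
    · intro x hx y hy e
      rw [List.getLast?_append_of_ne_nil _ (by simp; omega), hpa _ _ _ hq] at hx
      subst hx
      exact absurd e.symm (g2 y hy)
  · intro x hx y hy e
    rw [List.getLast?_append_of_ne_nil _ hu'] at hx
    rw [List.append_assoc, List.append_assoc, List.head?_append_of_ne_nil _ (by simp; omega),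
      hpa' _ _ _ hp] at hy
    subst hy
    exact absurd e (g3 x hx)

lemma halfcore (S : SCG v l) {a b p q : ℕ} {α β : Bool} {u : List (ℕ × Bool)} (hp : p ≤ 3) (hq : q ≤ 3)
    (hu : u ≠ []) (h0 : ∀ e, u[0]? ≠ some (a, e)) (h1 : ∀ e, u[u.length - 1]? ≠ some (b, e))
    {W : List (ℕ × Bool)}
    (hW : W = List.replicate p (a, α) ++ u ++ List.replicate q (b, β) ++ FreeGroup.invRev u)
    {i j r : ℕ} {e : Bool} (hr : r < p + u.length)
    (h : ∀ t < l i j - 3, W[(r + t) % W.length]? = some (if Even t then i else j, e)) :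
    ∃ w', w'.length < u.length ∧ ev v w' = ev v u := by
  subst hW
  have hlen : 0 < u.length := List.length_pos_iff.2 hu
  have hle := half hu (f := fun t => if Even t then i else j) (by simpa using hr) h
  simp only [List.length_replicate] at hle
  apply core S hp hq hu h0 h1 (α := α) (β := β) (i := i) (j := j) (r := r) (e := e)
  intro t ht
  rw [← h t ht, Nat.mod_eq_of_lt (by simp; omega)]
  rw [List.getElem?_append_left (l₂ := FreeGroup.invRev u) (by simp; omega)]

theorem lemmaD (S : SCG v l) {a b : ℕ} {k n : ℤ} {g : G} {N : ℕ} (hN : 0 < N)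
    (hk : v a ^ k ≠ 1) (hn : v b ^ n ≠ 1)
    (h : (v a ^ k * g * v b ^ n * g⁻¹) ^ N = 1) : ∃ p q : ℤ, g = v a ^ p * v b ^ q := by
  classical
  have hex : ∃ m, ∃ w, ∃ p q : ℤ, w.length = m ∧ ev v w = v a ^ p * g * v b ^ q := by
    obtain ⟨w, hw⟩ := S.gen g
    exact ⟨_, w, 0, 0, rfl, by simp [hw]⟩
  obtain ⟨u, p', q', hm, hue⟩ := Nat.find_spec hex
  have hmin : ∀ w' (p q : ℤ), ev v w' = v a ^ p * g * v b ^ q → u.length ≤ w'.length := by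
    intro w' p q h
    rw [hm]
    exact Nat.find_min' hex ⟨w', p, q, rfl, h⟩
  have hg : g = v a ^ (-p') * ev v u * v b ^ (-q') := by rw [hue]; group
  by_cases hu : u = []
  · refine ⟨-p', -q', ?_⟩
    rw [hg, hu]; simp
  exfalso
  have hmin' : ∀ w', ev v w' = ev v u → u.length ≤ w'.length :=
    fun w' h => hmin w' p' q' (h.trans hue)
  have hred : FreeGroup.IsReduced u := min_red (v := v) hmin'
  obtain ⟨p, α, hp1, hp3, hpe⟩ := zpow_letter S a k hk
  obtain ⟨q, β, hq1, hq3, hqe⟩ := zpow_letter S b n hn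
  have h0 : ∀ e, u[0]? ≠ some (a, e) := by
    intro e he
    rw [← List.head?_eq_getElem?] at he
    obtain ⟨x, hx⟩ : ∃ x, u = (a, e) :: x := by
      cases u with
      | nil => simp at he
      | cons y x => simp at he; exact ⟨x, by rw [he]⟩
    have hev : ev v u = cond e (v a) (v a)⁻¹ * ev v x := by rw [hx]; simp
    have : x.length < u.length := by rw [hx]; simp
    rw [hue] at hev
    cases e
    · have := hmin x (1 + p') q' (by
        simp only [cond_false] at hev
        rw [zpow_add, zpow_one, mul_assoc (v a), mul_assoc (v a), hev]; group)
      omega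
    · have := hmin x (-1 + p') q' (by
        simp only [cond_true] at hev
        rw [zpow_add, mul_assoc (v a ^ (-1 : ℤ)), mul_assoc (v a ^ (-1 : ℤ)), hev]; group)
      omega
  have h1 : ∀ e, u[u.length - 1]? ≠ some (b, e) := by
    intro e he
    rw [← List.getLast?_eq_getElem?] at he
    obtain ⟨x, hx⟩ : ∃ x, u = x ++ [(b, e)] := List.getLast?_eq_some_iff.1 he
    have hev : ev v u = ev v x * cond e (v b) (v b)⁻¹ := by rw [hx]; simp
    have : x.length < u.length := by rw [hx]; simp
    rw [hue] at hev
    cases e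
    · have := hmin x p' (q' + 1) (by
        simp only [cond_false] at hev
        rw [zpow_add, zpow_one, ← mul_assoc, hev]; group)
      omega
    · have := hmin x p' (q' + -1) (by
        simp only [cond_true] at hev
        rw [zpow_add, ← mul_assoc, hev]; group)
      omega
  obtain ⟨W, hW⟩ : ∃ W, W = List.replicate p (a, α) ++ u ++ List.replicate q (b, β) ++
    FreeGroup.invRev u := ⟨_, rfl⟩
  have hcr : FreeGroup.IsCyclicallyReduced W := by
    rw [hW]; exact cr_W hp1 hq1 hu h0 h1 hred
  have hWne : W ≠ [] := by rw [hW]; simp [hu]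
  have hWe : ev v W = v a ^ p' * (v a ^ k * g * v b ^ n * g⁻¹) * (v a ^ p')⁻¹ := by
    rw [hW]
    simp only [ev_append, ev_invRev, ← hpe, ← hqe, hue]
    group
  obtain ⟨i, j, e, r, hr, hcy⟩ := cyc S hcr hWne hN (by rw [hWe, conj_pow, h]; group)
  have hu' : FreeGroup.invRev u ≠ [] := by
    intro h; apply hu; rw [← List.length_eq_zero_iff, ← FreeGroup.invRev_length, h]; rfl
  rcases lt_or_ge r (p + u.length) with hlt | hge
  · obtain ⟨w', h2, h3⟩ := halfcore S hp3 hq3 hu h0 h1 hW hlt hcy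
    have := hmin' w' h3
    omega
  · have hWl : W.length = p + u.length + q + u.length := by rw [hW]; simp; ring
    obtain ⟨w', h2, h3⟩ := halfcore S (a := b) (b := a) (α := β) (β := α) hq3 hp3 hu' (by
        intro e he
        rw [invRev_zero, Option.map_eq_some_iff] at he
        obtain ⟨y, hy, he⟩ := he
        apply h1 y.2
        rw [hy, ← (Prod.mk.inj he).1]) (by
        intro e he
        rw [invRev_last, Option.map_eq_some_iff] at he
        obtain ⟨y, hy, he⟩ := he
        apply h0 y.2
        rw [hy, ← (Prod.mk.inj he).1]) (W := W.rotate (p + u.length)) (by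
        rw [FreeGroup.invRev_invRev, hW, List.append_assoc]
        rw [show p + u.length = (List.replicate p (a, α) ++ u).length by simp]
        rw [List.rotate_append_length_eq]
        simp) (r := r - (p + u.length)) (by simp; omega) (i := i) (j := j) (e := e) (by
        intro t ht
        have hpos : 0 < W.length := List.length_pos_iff.2 hWne
        rw [List.length_rotate, List.getElem?_rotate (Nat.mod_lt _ hpos), Nat.mod_add_mod, ← hcy t ht]
        congr 2
        omega)
    have := hmin' (FreeGroup.invRev w') (by rw [ev_invRev, h3]; simp)
    simp at this h2
    omega

theorem lemmaD' (S : SCG v l) {a b : ℕ} (hab : a ≠ b) {k n : ℤ} {N : ℕ} (hN : 0 < N)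
    (hk : v a ^ k ≠ 1) (hn : v b ^ n ≠ 1)
    (h : (v a ^ k * v b ^ n) ^ N = 1) : ∃ e, v a ^ k = lt v e a ∧ v b ^ n = lt v e b := by
  obtain ⟨p, α, hp1, hp3, hpe⟩ := zpow_letter S a k hk
  obtain ⟨q, β, hq1, hq3, hqe⟩ := zpow_letter S b n hn
  obtain ⟨W, hW⟩ : ∃ W, W = List.replicate p (a, α) ++ List.replicate q (b, β) := ⟨_, rfl⟩
  have hcr : FreeGroup.IsCyclicallyReduced W := by
    rw [hW]
    constructor
    · rw [FreeGroup.IsReduced, List.isChain_append]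
      refine ⟨red_replicate _ _, red_replicate _ _, ?_⟩
      intro x hx y hy e
      rw [List.getLast?_replicate, if_neg (by omega)] at hx
      rw [List.head?_replicate, if_neg (by omega)] at hy
      simp at hx hy
      subst hx hy
      exact absurd e hab
    · intro x hx y hy e
      rw [List.getLast?_append_of_ne_nil _ (by simp; omega), List.getLast?_replicate,
        if_neg (by omega)] at hx
      rw [List.head?_append_of_ne_nil _ (by simp; omega), List.head?_replicate,
        if_neg (by omega)] at hy
      simp at hx hy
      subst hx hy
      exact absurd e hab.symm
  have hWl : W.length = p + q := by rw [hW]; simp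
  have hWne : W ≠ [] := by intro h; rw [h] at hWl; simp at hWl; omega
  obtain ⟨i, j, e, r, hr, hcy⟩ := cyc S hcr hWne hN (by
    rw [hW, ev_append, ← hpe, ← hqe]; exact h)
  have hA : ∀ s, s < p → W[s]? = some (a, α) := by
    intro s hs
    rw [hW, List.getElem?_append_left (by simpa using hs), List.getElem?_replicate_of_lt hs]
  have hB : ∀ s, p ≤ s → s < p + q → W[s]? = some (b, β) := by
    intro s hs hs'
    rw [hW, List.getElem?_append_right (by simpa using hs), List.getElem?_replicate_of_lt
      (by simp; omega)]
  rw [hWl] at hcy hr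
  have hK := off_or S i j
  by_cases hij : i = j
  · exfalso
    subst hij
    rw [S.diag] at hcy
    simp only [ite_self] at hcy
    have e0 := hcy 0 (by norm_num)
    rw [add_zero, Nat.mod_eq_of_lt hr] at e0
    rcases lt_or_ge r p with hrp | hrp
    · have e1 := hcy (p - r) (by omega)
      rw [Nat.mod_eq_of_lt (by omega), hB _ (by omega) (by omega)] at e1
      rw [hA _ hrp, ← e1] at e0
      simp at e0; exact hab e0.1
    · have e1 := hcy (p + q - r) (by omega)
      rw [show r + (p + q - r) = p + q by omega, Nat.mod_self, hA _ (by omega)] at e1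
      rw [hB _ hrp hr, ← e1] at e0
      simp at e0; exact hab e0.1.symm
  · have hK' : 19 ≤ l i j - 3 := by rcases hK with h | h | h <;> omega
    have hcy' : ∀ s, s < p + q → W[s]? = some (if Even (p + q - r + s) then i else j, e) := by
      intro s hs
      have := hcy (p + q - r + s) (by omega)
      rwa [show r + (p + q - r + s) = s + (p + q) by omega, Nat.add_mod_right,
        Nat.mod_eq_of_lt hs] at this
    have hcons : ∀ s, s + 1 < p + q → W[s]? ≠ W[s + 1]? := by
      intro s hs he
      rw [hcy' s (by omega), hcy' (s + 1) hs, ← add_assoc] at he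
      by_cases hev : Even (p + q - r + s)
      · simp [hev, Nat.even_add_one] at he; exact hij he
      · simp [hev, Nat.even_add_one] at he; exact hij he.symm
    obtain rfl : p = 1 := by
      by_contra hp
      apply hcons 0 (by omega)
      rw [hA 0 (by omega), hA _ (by omega)]
    obtain rfl : q = 1 := by
      by_contra hp
      apply hcons 1 (by omega)
      rw [hB 1 (by omega) (by omega), hB _ (by omega) (by omega)]
    have e0 := hcy' 0 (by omega)
    have e1 := hcy' 1 (by omega)
    rw [hA 0 (by omega)] at e0
    rw [hB 1 (by omega) (by omega)] at e1
    simp only [Option.some.injEq, Prod.mk.injEq] at e0 e1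
    refine ⟨e, ?_, ?_⟩
    · rw [hpe, e0.2]; simp [lt]
    · rw [hqe, e1.2]; simp [lt]

end
end SC


namespace SC
section
variable {G : Type} [Group G] {v : ℕ → G} {l : ℕ → ℕ → ℕ}

lemma short_ne (S : SCG v l) {w : List (ℕ × Bool)} (hw : FreeGroup.IsReduced w) (hne : w ≠ [])
    (hlen : w.length < 4) : ev v w ≠ 1 := by
  intro h
  obtain ⟨i, j, e, hr⟩ := S.gr w hw hne h
  have := hr.length_le
  rw [run_length] at this
  rcases off_or S i j with h | h | h <;> omega

lemma lt_ne (S : SCG v l) (e i) : lt v e i ≠ 1 := by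
  have := short_ne S (w := [(i, e)]) (by simp) (by simp) (by simp)
  simpa [lt] using this

lemma lt_mul_ne (S : SCG v l) (e i j) : lt v e i * lt v e j ≠ 1 := by
  have := short_ne S (w := [(i, e), (j, e)]) (by simp [FreeGroup.IsReduced]) (by simp) (by simp)
  simpa [lt] using this

/-- sign as an integer -/
def sg (e : Bool) : ℤ := cond e 1 (-1)

lemma lt_zpow (e i) : lt v e i = v i ^ sg e := by cases e <;> simp [lt, sg]

lemma lt_sign (S : SCG v l) {e e' i} (h : lt v e i = lt v e' i) : e = e' := by
  by_contra hne
  apply lt_mul_ne S e i i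
  nth_rw 1 [h]
  clear h
  cases e <;> cases e' <;> simp [lt] at hne ⊢

theorem conj_lemma (S : SCG v l) {a b : ℕ} {k n : ℤ} {g : G} (hk : v a ^ k ≠ 1)
    (h : v a ^ k = g * v b ^ n * g⁻¹) :
    a = b ∧ v a ^ k = v a ^ n ∧ ∃ t : ℤ, g = v a ^ t := by
  have hn : v b ^ (-n) ≠ 1 := by
    intro h'
    apply hk
    rw [zpow_neg, inv_eq_one] at h'
    rw [h, h']; group
  obtain ⟨p, q, hg⟩ := lemmaD S (N := 1) (by norm_num) hk hn (g := g) (by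
    rw [h]; group)
  have h2 : v a ^ k = v b ^ n := by
    have : v a ^ k = (v a ^ p)⁻¹ * v a ^ k * v a ^ p := by group
    rw [this, h, hg]; group
  have hab : a = b := by
    by_contra hab
    obtain ⟨e, h3, h4⟩ := lemmaD' S hab (N := 1) (by norm_num) hk hn (by rw [h2]; group)
    apply lt_mul_ne S e a b
    rw [← h3, ← h4, h2]; group
  subst hab
  exact ⟨rfl, h2, p + q, by rw [hg, zpow_add]⟩

lemma conj_lt (S : SCG v l) {a b : ℕ} {e e' : Bool} {g : G}
    (h : lt v e a = g * lt v e' b * g⁻¹) : a = b ∧ e = e' ∧ ∃ t : ℤ, g = v a ^ t := by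
  have hne := lt_ne S e a
  rw [lt_zpow] at hne
  rw [lt_zpow, lt_zpow] at h
  obtain ⟨h1, h2, h3⟩ := conj_lemma S hne h
  rw [← lt_zpow, ← lt_zpow] at h2
  exact ⟨h1, lt_sign S h2, h3⟩

lemma zpow_pow7 (S : SCG v l) (a) (k : ℤ) : (v a ^ k) ^ 7 = 1 := by
  rw [← zpow_natCast, ← zpow_mul, mul_comm, zpow_mul, zpow_natCast, S.pow7, one_zpow]

theorem pairs (S : SCG v l) {x y : G} {i j : ℕ} (hij : i ≠ j) (hx : x ≠ 1) (hy : y ≠ 1)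
    (hx7 : x ^ 7 = 1) (hy7 : y ^ 7 = 1) (hxy : (x * y) ^ (l i j / 2) = 1) (hxy1 : x * y ≠ 1) :
    ∃ g e a b, a ≠ b ∧ l a b = l i j ∧ x = g * lt v e a * g⁻¹ ∧ y = g * lt v e b * g⁻¹ := by
  obtain ⟨g, a, k, hg⟩ := torsion S hx hx7
  obtain ⟨h, b, n, hh⟩ := torsion S hy hy7
  have hk : v a ^ k ≠ 1 := by intro h'; apply hx; rw [hg, h']; group
  have hn : v b ^ n ≠ 1 := by intro h'; apply hy; rw [hh, h']; group
  have hm : 0 < l i j / 2 ∧ Nat.Coprime 7 (l i j / 2) := by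
    rcases S.off i j hij with h | h <;> rw [h] <;> decide
  obtain ⟨p, q, hpq⟩ := lemmaD S hm.1 hk hn (g := g⁻¹ * h) (by
    have : v a ^ k * (g⁻¹ * h) * v b ^ n * (g⁻¹ * h)⁻¹ = g⁻¹ * (x * y) * g⁻¹⁻¹ := by
      rw [hg, hh]; group
    rw [this, conj_pow, hxy]; group)
  have hh' : h = g * v a ^ p * v b ^ q := by rw [mul_assoc, ← hpq]; group
  have hx' : x = (g * v a ^ p) * v a ^ k * (g * v a ^ p)⁻¹ := by rw [hg]; group
  have hy' : y = (g * v a ^ p) * v b ^ n * (g * v a ^ p)⁻¹ := by rw [hh, hh']; group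
  generalize g * v a ^ p = g' at hx' hy'
  have hprod : x * y = g' * (v a ^ k * v b ^ n) * g'⁻¹ := by rw [hx', hy']; group
  have hprod' : v a ^ k * v b ^ n = g'⁻¹ * (x * y) * g'⁻¹⁻¹ := by rw [hprod]; group
  have hab : a ≠ b := by
    rintro rfl
    apply hxy1
    refine eq_one_of_coprime hm.2 ?_ hxy
    rw [hprod, ← zpow_add, conj_pow, zpow_pow7 S]; group
  have hpow : (v a ^ k * v b ^ n) ^ (l i j / 2) = 1 := by rw [hprod', conj_pow, hxy]; group
  obtain ⟨e, he1, he2⟩ := lemmaD' S hab hm.1 hk hn hpow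
  refine ⟨g', e, a, b, hab, ?_, by rw [← he1]; exact hx', by rw [← he2]; exact hy'⟩
  by_contra hl
  apply lt_mul_ne S e a b
  have h1 := lt_pow S e a b hab
  rw [he1, he2] at hpow
  refine eq_one_of_coprime ?_ h1 hpow
  rcases S.off i j hij with h | h <;> rcases S.off a b hab with h' | h' <;> rw [h, h'] <;>
    first | decide | (exfalso; omega)

/-- A system of elements behaving like the generators. -/
structure Sys (l : ℕ → ℕ → ℕ) (x : ℕ → G) : Prop where
  ne : ∀ i, x i ≠ 1
  p7 : ∀ i, x i ^ 7 = 1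
  pm : ∀ i j, i ≠ j → (x i * x j) ^ (l i j / 2) = 1
  mne : ∀ i j, i ≠ j → x i * x j ≠ 1

lemma Sys.map {H : Type} [Group H] {x : ℕ → G} (h : Sys l x) (f : G →* H)
    (hf : Function.Injective f) : Sys l (fun i => f (x i)) := by
  have h1 : ∀ y, f y = 1 ↔ y = 1 := fun y => map_eq_one_iff f hf
  constructor
  · intro i; rw [ne_eq, h1]; exact h.ne i
  · intro i; rw [← map_pow, h1, h.p7]
  · intro i j hij; rw [← map_mul, ← map_pow, h1, h.pm i j hij]
  · intro i j hij; rw [← map_mul, ne_eq, h1]; exact h.mne i j hij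

lemma sys_v (S : SCG v l) : Sys l v :=
  ⟨fun i => lt_ne S true i, S.pow7, S.pow, fun i j _ => lt_mul_ne S true i j⟩

lemma Sys.pairs (S : SCG v l) {x : ℕ → G} (X : Sys l x) {i j : ℕ} (hij : i ≠ j) :
    ∃ g e a b, a ≠ b ∧ l a b = l i j ∧ x i = g * lt v e a * g⁻¹ ∧ x j = g * lt v e b * g⁻¹ :=
  SC.pairs S hij (X.ne i) (X.ne j) (X.p7 i) (X.p7 j) (X.pm i j hij) (X.mne i j hij)

theorem step3 (S : SCG v l) {x : ℕ → G} (X : Sys l x) :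
    ∃ (g : G) (e : Bool) (ρ : ℕ → ℕ), (∀ i, x i = g * lt v e (ρ i) * g⁻¹) ∧
      ∀ i j, i ≠ j → ρ i ≠ ρ j ∧ l (ρ i) (ρ j) = l i j := by
  obtain ⟨g, e, a, b, hab, -, h0, h1⟩ := X.pairs S (i := 0) (j := 1) (by norm_num)
  have Y := X.map (MulAut.conj g⁻¹).toMonoidHom (MulAut.conj g⁻¹).injective
  have hy0 : (MulAut.conj g⁻¹).toMonoidHom (x 0) = lt v e a := by
    simp [MulAut.conj_apply, h0]; group
  have hy1 : (MulAut.conj g⁻¹).toMonoidHom (x 1) = lt v e b := by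
    simp [MulAut.conj_apply, h1]; group
  have hxy : ∀ j, x j = g * ((MulAut.conj g⁻¹).toMonoidHom (x j)) * g⁻¹ := by
    intro j; simp [MulAut.conj_apply]; group
  generalize hy : (fun i => (MulAut.conj g⁻¹).toMonoidHom (x i)) = y at Y
  have hy' : ∀ i, (MulAut.conj g⁻¹).toMonoidHom (x i) = y i := fun i => congrFun hy i
  rw [hy'] at hy0 hy1
  simp only [hy'] at hxy
  have key : ∀ j, ∃ c, y j = lt v e c := by
    intro j
    by_cases hj0 : j = 0
    · exact ⟨a, by rw [hj0, hy0]⟩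
    by_cases hj1 : j = 1
    · exact ⟨b, by rw [hj1, hy1]⟩
    obtain ⟨g1, e1, a1, c, hac, -, h2, h3⟩ := Y.pairs S (i := 0) (j := j) (Ne.symm hj0)
    rw [hy0] at h2
    obtain ⟨rfl, rfl, t, rfl⟩ := conj_lt S h2
    obtain ⟨g2, e2, b1, d, hbd, -, h4, h5⟩ := Y.pairs S (i := 1) (j := j) (Ne.symm hj1)
    rw [hy1] at h4
    obtain ⟨rfl, rfl, s, rfl⟩ := conj_lt S h4
    have h6 : lt v e c = ((v a ^ t)⁻¹ * v b ^ s) * lt v e d * ((v a ^ t)⁻¹ * v b ^ s)⁻¹ := by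
      have : lt v e c = (v a ^ t)⁻¹ * y j * v a ^ t := by rw [h3]; group
      rw [this, h5]; group
    obtain ⟨rfl, -, r, hr⟩ := conj_lt S h6
    rw [← zpow_neg] at hr
    have hta : v a ^ (-t) = 1 := by
      by_contra hta
      by_cases hsb : v b ^ s = 1
      · rw [hsb, mul_one] at hr
        exact hac (conj_lemma S (b := c) (n := r) hta (g := 1) (by rw [hr]; group)).1
      · have h7 : (v a ^ (-t) * v b ^ s) ^ 7 = 1 := by rw [hr, zpow_pow7 S]
        obtain ⟨f, hf1, hf2⟩ := lemmaD' S hab (N := 7) (by norm_num) hta hsb h7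
        have := prod_pow7 S hab rfl (e := f) (q := 1) (by rw [pow_one, ← hf1, ← hf2]; exact h7)
        rw [pow_one] at this
        exact lt_mul_ne S f a b this
    rw [zpow_neg, inv_eq_one] at hta
    exact ⟨c, by rw [h3, hta]; group⟩
  choose ρ hρ using key
  refine ⟨g, e, ρ, fun i => by rw [hxy i, hρ i], fun i j hij => ?_⟩
  obtain ⟨g1, e1, a1, b1, h2, h3, h4, h5⟩ := Y.pairs S hij
  rw [hρ] at h4 h5
  obtain ⟨rfl, -, -⟩ := conj_lt S h4
  obtain ⟨rfl, -, -⟩ := conj_lt S h5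
  exact ⟨h2, h3⟩

lemma map_lt {H : Type} [Group H] (f : G →* H) (e i) : f (lt v e i) = lt (fun i => f (v i)) e i := by
  cases e <;> simp [lt]

lemma lt_conj_lt (g : G) (e e' : Bool) (ρ : ℕ → ℕ) (i : ℕ) :
    ∃ e'', lt (fun i => g * lt v e (ρ i) * g⁻¹) e' i = g * lt v e'' (ρ i) * g⁻¹ := by
  cases e'
  · refine ⟨!e, ?_⟩
    cases e <;> simp [lt, mul_assoc]
  · exact ⟨e, rfl⟩

theorem auto_class (S : SCG v l) (h : G ≃* G) :
    ∃ (g : G) (e : Bool) (ρ : ℕ ≃ ℕ), (∀ i, h (v i) = g * lt v e (ρ i) * g⁻¹) ∧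
      ∀ i j, l (ρ i) (ρ j) = l i j := by
  obtain ⟨g, e, ρ, h1, h2⟩ := step3 S ((sys_v S).map h.toMonoidHom h.injective)
  obtain ⟨g', e', ρ', h1', -⟩ := step3 S ((sys_v S).map h.symm.toMonoidHom h.symm.injective)
  have hinj : Function.Injective ρ := by
    intro i j hij
    by_contra hne
    exact (h2 i j hne).1 hij
  have hsur : Function.Surjective ρ := by
    intro i
    refine ⟨ρ' i, ?_⟩
    have h3 := congrArg h.toMonoidHom (h1' i)
    simp only [map_mul, map_inv, map_lt] at h3
    simp only [h1] at h3
    obtain ⟨e'', he⟩ := lt_conj_lt (v := v) g e e' ρ (ρ' i)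
    rw [he] at h3
    have h4 : lt v true i = (h.toMonoidHom g' * g) * lt v e'' (ρ (ρ' i)) *
        (h.toMonoidHom g' * g)⁻¹ := by
      have : lt v true i = h.toMonoidHom (h.symm.toMonoidHom (v i)) := by simp [lt]
      rw [this, h3]; group
    exact (conj_lt S h4).1.symm
  refine ⟨g, e, Equiv.ofBijective ρ ⟨hinj, hsur⟩, h1, fun i j => ?_⟩
  by_cases hij : i = j
  · subst hij; rw [S.diag, S.diag]
  · exact (h2 i j hij).2

end
end SC


namespace SC

open Classical in
/-- Lengths of the relators. -/
noncomputable def len (Adj : ℕ → ℕ → Prop) (i j : ℕ) : ℕ :=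
  if i = j then 7 else if Adj i j then 22 else 26

section
variable {Adj : ℕ → ℕ → Prop}

lemma ev_gen (w) : ev (gen Adj) w = PresentedGroup.mk (grRels Adj) (FreeGroup.mk w) := by
  rw [ev_eq_lift]
  have : FreeGroup.lift (gen Adj) = PresentedGroup.mk (grRels Adj) := by
    ext i; simp [gen, PresentedGroup.of]
  rw [this]

lemma map_ev {G H : Type} [Group G] [Group H] (f : G →* H) (v : ℕ → G) (w) :
    f (ev v w) = ev (fun i => f (v i)) w := by
  induction w with
  | nil => simp
  | cons x w ih => cases hx : x.2 <;> simp [hx, ih]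

lemma gen_pow7 (i) : gen Adj i ^ 7 = 1 := by
  have : FreeGroup.of i ^ 7 ∈ grRels Adj := Or.inl ⟨i, rfl⟩
  simpa [gen, PresentedGroup.of] using PresentedGroup.one_of_mem this

lemma gen_pow11 {i j} (h : Adj i j) : (gen Adj i * gen Adj j) ^ 11 = 1 := by
  have : (FreeGroup.of i * FreeGroup.of j) ^ 11 ∈ grRels Adj := Or.inr (Or.inl ⟨i, j, h, rfl⟩)
  simpa [gen, PresentedGroup.of] using PresentedGroup.one_of_mem this

lemma gen_pow13 {i j} (hij : i ≠ j) (h : ¬ Adj i j) : (gen Adj i * gen Adj j) ^ 13 = 1 := by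
  have : (FreeGroup.of i * FreeGroup.of j) ^ 13 ∈ grRels Adj :=
    Or.inr (Or.inr ⟨i, j, hij, h, rfl⟩)
  simpa [gen, PresentedGroup.of] using PresentedGroup.one_of_mem this

lemma exists_hom {H : Type} [Group H] (σ : ℕ → H) (h7 : ∀ i, σ i ^ 7 = 1)
    (h11 : ∀ i j, Adj i j → (σ i * σ j) ^ 11 = 1)
    (h13 : ∀ i j, i ≠ j → ¬ Adj i j → (σ i * σ j) ^ 13 = 1) :
    ∃ f : GT Adj →* H, ∀ i, f (gen Adj i) = σ i := by
  have h : ∀ r ∈ grRels Adj, FreeGroup.lift σ r = 1 := by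
    rintro r (⟨i, rfl⟩ | ⟨i, j, ha, rfl⟩ | ⟨i, j, hij, ha, rfl⟩)
    · simp [h7]
    · simp [h11 i j ha]
    · simp [h13 i j hij ha]
  exact ⟨PresentedGroup.toGroup h, fun i => PresentedGroup.toGroup.of h⟩

theorem scg (hs : ∀ i j, Adj i j → Adj j i) (hi : ∀ i, ¬ Adj i i) :
    SCG (gen Adj) (len Adj) where
  diag i := by simp [len]
  off i j h := by simp only [len, h, if_false]; split_ifs <;> simp
  symm i j := by
    have : Adj i j ↔ Adj j i := ⟨hs _ _, hs _ _⟩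
    by_cases h : i = j
    · rw [h]
    · by_cases ha : Adj i j
      · simp [len, h, Ne.symm h, ha, this.1 ha]
      · simp [len, h, Ne.symm h, ha, mt this.2 ha]
  pow7 := gen_pow7
  pow i j h := by
    simp only [len, h, if_false]
    split_ifs with ha
    · exact gen_pow11 ha
    · exact gen_pow13 h ha
  gen x := by
    obtain ⟨y, rfl⟩ := PresentedGroup.mk_surjective _ x
    exact ⟨y.toWord, by rw [ev_gen, FreeGroup.mk_toWord]⟩
  gr w hw hne h1 := by
    by_contra hno
    push Not at hno
    have hl : LenOK (len Adj) := by
      refine ⟨fun i j => ?_, fun i j => ?_, fun i j h => ?_⟩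
      · have : Adj i j ↔ Adj j i := ⟨hs _ _, hs _ _⟩
        by_cases h : i = j
        · rw [h]
        · by_cases ha : Adj i j
          · simp [len, h, Ne.symm h, ha, this.1 ha]
          · simp [len, h, Ne.symm h, ha, mt this.2 ha]
      · simp only [len]; split_ifs <;> simp
      · simp only [len, h, if_false]; split_ifs <;> decide
    obtain ⟨Y, σ, h7, h2, hσ⟩ := greendlinger hl hw hne hno
    obtain ⟨f, hf⟩ := exists_hom (Adj := Adj) σ (fun i => by simpa [len] using h7 i)
      (fun i j ha => h2 i j 11 (by
        have : i ≠ j := by rintro rfl; exact hi _ ha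
        simp [len, this, ha]))
      (fun i j hij ha => h2 i j 13 (by simp [len, hij, ha]))
    apply hσ
    have := map_ev f (gen Adj) w
    rw [h1, map_one] at this
    simp only [hf] at this
    exact this.symm

/-- Change all signs if `e` is false. -/
def flip (e : Bool) (w : List (ℕ × Bool)) : List (ℕ × Bool) :=
  w.map fun x => (x.1, cond e x.2 (!x.2))

lemma ev_flip {G : Type} [Group G] (v : ℕ → G) (e w) : ev v (flip e w) = ev (lt v e) w := by
  induction w with
  | nil => rfl
  | cons x w ih =>
    have : flip e (x :: w) = (x.1, cond e x.2 (!x.2)) :: flip e w := rfl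
    rw [this, ev_cons, ev_cons, ih]
    cases e <;> cases hx : x.2 <;> simp [lt]

theorem auto_rigid (hs : ∀ i j, Adj i j → Adj j i) (hi : ∀ i, ¬ Adj i i)
    (hr : ∀ ρ : ℕ ≃ ℕ, (∀ m n, Adj m n ↔ Adj (ρ m) (ρ n)) → ρ = Equiv.refl ℕ)
    (h : GT Adj ≃* GT Adj) :
    ∃ (g : GT Adj) (e : Bool), ∀ w, h (ev (gen Adj) w) = g * ev (gen Adj) (flip e w) * g⁻¹ := by
  obtain ⟨g, e, ρ, h1, h2⟩ := auto_class (scg hs hi) h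
  have hρ : ρ = Equiv.refl ℕ := by
    apply hr
    intro m n
    have h3 := h2 m n
    by_cases hmn : m = n
    · subst hmn; simp [hi]
    · have h4 : ρ m ≠ ρ n := fun h => hmn (ρ.injective h)
      simp only [len, hmn, h4, if_false] at h3
      split_ifs at h3 <;> simp_all
  subst hρ
  refine ⟨g, e, fun w => ?_⟩
  have h3 := map_ev h.toMonoidHom (gen Adj) w
  have h4 := map_ev (MulAut.conj g).toMonoidHom (lt (gen Adj) e) w
  simp only [MulEquiv.toMonoidHom_eq_coe, MonoidHom.coe_coe, MulAut.conj_apply] at h3 h4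
  rw [h3, ev_flip, h4]
  congr 1
  funext i
  exact h1 i

lemma flip_flip (e w) : flip e (flip e w) = w := by
  cases e <;> simp [flip, Function.comp_def]

theorem exists_auto (hs : ∀ i j, Adj i j → Adj j i) (hi : ∀ i, ¬ Adj i i) (g : GT Adj) (e : Bool) :
    ∃ h : GT Adj ≃* GT Adj, ∀ w, h (ev (gen Adj) w) = g * ev (gen Adj) (flip e w) * g⁻¹ := by
  have S := scg hs hi
  obtain ⟨f, hf⟩ := exists_hom (Adj := Adj) (lt (gen Adj) e) (fun i => lt_pow7 S e i)
    (fun i j ha => by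
      have hij : i ≠ j := by rintro rfl; exact hi _ ha
      have := lt_pow S e i j hij
      simpa [len, hij, ha] using this)
    (fun i j hij ha => by
      have := lt_pow S e i j hij
      simpa [len, hij, ha] using this)
  have hfe : ∀ w, f (ev (gen Adj) w) = ev (gen Adj) (flip e w) := by
    intro w
    rw [map_ev, ev_flip]
    congr 1
    funext i; exact hf i
  have hff : ∀ x, f (f x) = x := by
    intro x
    obtain ⟨w, rfl⟩ := S.gen x
    rw [hfe, hfe, flip_flip]
  let F : GT Adj ≃* GT Adj :=
    { toFun := f, invFun := f, left_inv := hff, right_inv := hff, map_mul' := map_mul f }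
  refine ⟨F.trans (MulAut.conj g), fun w => ?_⟩
  rw [MulEquiv.trans_apply, MulAut.conj_apply]
  change g * f _ * g⁻¹ = _
  rw [hfe]

/-- Product of a word of generators, computed with the coded operation. -/
def sprod (st : ℕ → ℕ → ℕ) : List (ℕ × Bool) → ℕ
  | [] => 0
  | x :: w => st (cond x.2 (3 * x.1 + 1) (3 * x.1 + 2)) (sprod st w)

lemma star_code (c : CodingBijection Adj) (x y) :
    c.star (c.toEquiv x) (c.toEquiv y) = c.toEquiv (x * y) := by
  simp [CodingBijection.star]

lemma sprod_eq (c : CodingBijection Adj) (w) :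
    sprod c.star w = c.toEquiv (ev (gen Adj) w) := by
  induction w with
  | nil => exact c.map_one.symm
  | cons x w ih =>
    rw [sprod, ih, ev_cons, ← star_code]
    cases x.2
    · simp [c.map_gen_inv]
    · simp [c.map_gen]

theorem char (hs : ∀ i j, Adj i j → Adj j i) (hi : ∀ i, ¬ Adj i i)
    (hr : ∀ ρ : ℕ ≃ ℕ, (∀ m n, Adj m n ↔ Adj (ρ m) (ρ n)) → ρ = Equiv.refl ℕ)
    (c : CodingBijection Adj) (s : List ℕ) :
    (∃ h : ℕ → ℕ, Function.Bijective h ∧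
        (∀ n m, h (c.star n m) = c.star (h n) (h m)) ∧
        ∀ (n : ℕ) (hn : n < s.length), h n = s.get ⟨n, hn⟩) ↔
    ∃ (g : ℕ) (e : Bool), ∀ n : Fin s.length, ∃ w : List (ℕ × Bool),
      sprod c.star w = n ∧ c.star g (sprod c.star (flip e w)) = c.star (s.get n) g := by
  have S := scg hs hi
  constructor
  · rintro ⟨h, hb, hm, hx⟩
    let H : GT Adj ≃* GT Adj :=
      { toEquiv := c.toEquiv.trans ((Equiv.ofBijective h hb).trans c.toEquiv.symm)
        map_mul' := by
          intro x y
          have := hm (c.toEquiv x) (c.toEquiv y)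
          rw [star_code] at this
          simp [this, CodingBijection.star] }
    have hH : ∀ x, h (c.toEquiv x) = c.toEquiv (H x) := by intro x; simp [H]
    obtain ⟨g, e, hge⟩ := auto_rigid hs hi hr H
    refine ⟨c.toEquiv g, e, fun n => ?_⟩
    obtain ⟨w, hw⟩ := S.gen (c.toEquiv.symm n)
    refine ⟨w, by rw [sprod_eq, hw]; simp, ?_⟩
    have h1 := hx n n.2
    have h2 := hH (ev (gen Adj) w)
    rw [hge, hw, Equiv.apply_symm_apply, h1] at h2
    rw [sprod_eq, star_code]
    change _ = c.star (s.get ⟨n, n.2⟩) _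
    rw [h2, star_code]
    group
  · rintro ⟨g, e, hge⟩
    obtain ⟨g, rfl⟩ := c.toEquiv.surjective g
    obtain ⟨H, hH⟩ := exists_auto hs hi g e
    refine ⟨fun n => c.toEquiv (H (c.toEquiv.symm n)), ?_, ?_, ?_⟩
    · exact c.toEquiv.bijective.comp (H.bijective.comp c.toEquiv.symm.bijective)
    · intro n m
      simp [CodingBijection.star]
    · intro n hn
      obtain ⟨w, h1, h2⟩ := hge ⟨n, hn⟩
      simp only at h1
      rw [sprod_eq] at h1
      obtain ⟨x, hx⟩ := c.toEquiv.surjective (s.get ⟨n, hn⟩)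
      rw [← hx, sprod_eq, star_code, star_code] at h2
      have h3 := c.toEquiv.injective h2
      have h4 : c.toEquiv.symm n = ev (gen Adj) w := by rw [← h1, Equiv.symm_apply_apply]
      simp only [h4]
      rw [hH, h3, ← hx, mul_inv_cancel_right]
end

lemma meas_star {X : Type} [MeasurableSpace X] {st : X → ℕ → ℕ → ℕ}
    (hst : Measurable fun T : X => fun p : ℕ × ℕ => st T p.1 p.2) {a b : X → ℕ}
    (ha : Measurable a) (hb : Measurable b) : Measurable fun T => st T (a T) (b T) := by
  have h1 : ∀ p : ℕ × ℕ, Measurable fun T => st T p.1 p.2 := fun p =>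
    (measurable_pi_apply p).comp hst
  have h2 : Measurable fun q : (ℕ × ℕ) × X => st q.2 q.1.1 q.1.2 :=
    measurable_from_prod_countable_right (fun p => h1 p)
  exact h2.comp ((ha.prodMk hb).prodMk measurable_id)

lemma meas_sprod {X : Type} [MeasurableSpace X] {st : X → ℕ → ℕ → ℕ}
    (hst : Measurable fun T : X => fun p : ℕ × ℕ => st T p.1 p.2) (w) :
    Measurable fun T => sprod (st T) w := by
  induction w with
  | nil => exact measurable_const
  | cons x w ih => exact meas_star hst measurable_const ih

end SC

theorem Sigma_borel_of_rigid
    (code : ∀ T : XGr, CodingBijection (fun m n => T.1 (m, n) = true))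
    (hcode : Measurable fun T : XGr => fun p : ℕ × ℕ => (code T).star p.1 p.2)
    (B : Set XGr) (hB : MeasurableSet B)
    (hrigid : ∀ T ∈ B, ∀ ρ : ℕ ≃ ℕ,
      (∀ m n, T.1 (m, n) = true ↔ T.1 (ρ m, ρ n) = true) → ρ = Equiv.refl ℕ) :
    ∀ s : List ℕ, s.Nodup →
      MeasurableSet {T : XGr | T ∈ B ∧ ∃ h : ℕ → ℕ, Function.Bijective h ∧
        (∀ n m, h ((code T).star n m) = (code T).star (h n) (h m)) ∧
        ∀ (n : ℕ) (hn : n < s.length), h n = s.get ⟨n, hn⟩} := by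
  intro s _
  have key : {T : XGr | T ∈ B ∧ ∃ h : ℕ → ℕ, Function.Bijective h ∧
        (∀ n m, h ((code T).star n m) = (code T).star (h n) (h m)) ∧
        ∀ (n : ℕ) (hn : n < s.length), h n = s.get ⟨n, hn⟩} =
      B ∩ ⋃ (g : ℕ), ⋃ (e : Bool), ⋂ (n : Fin s.length), ⋃ (w : List (ℕ × Bool)),
        ({T : XGr | SC.sprod (code T).star w = n} ∩
         {T : XGr | (code T).star g (SC.sprod (code T).star (SC.flip e w)) =
          (code T).star (s.get n) g}) := by
    ext T
    simp only [Set.mem_ofPred_eq, Set.mem_inter_iff, Set.mem_iUnion, Set.mem_iInter]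
    refine and_congr_right fun hT => ?_
    refine SC.char (fun i j h => ?_) (fun i => ?_) (hrigid T hT) (code T) s
    · rw [T.2.1]; exact h
    · simp [T.2.2]
  rw [key]
  refine hB.inter (MeasurableSet.iUnion fun g => MeasurableSet.iUnion fun e =>
    MeasurableSet.iInter fun n => MeasurableSet.iUnion fun w => MeasurableSet.inter ?_ ?_)
  · exact measurableSet_eq_fun (SC.meas_sprod hcode w) measurable_const
  · exact measurableSet_eq_fun
      (SC.meas_star hcode measurable_const (SC.meas_sprod hcode _))
      (SC.meas_star hcode measurable_const measurable_const)
end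

section
/- For all simple graphs T, S on vertex set ℕ: T ⊑_Gr S if and only if there exists an injective group homomorphism from G_T into G_S. -/
namespace WG

/-- Sizes of the polygons of the Cayley complex. -/
structure PD where
  N : ℕ → ℕ → ℕ
  symm : ∀ i j, N i j = N j i
  seven : ∀ i j, 7 ≤ N i j
  par : ∀ i j, i ≠ j → Even (N i j)

/-- Polygons of the developed complex. -/
inductive Ch
  | root (i j : ℕ)
  | E (Q : Ch) (p k : ℕ)
  | V (Q : Ch) (p i j : ℕ)

def Ch.inn : Ch → ℕ
  | .root i _ => i
  | .E _ _ k => k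
  | .V _ _ i _ => i

def Ch.out : Ch → ℕ
  | .root _ j => j
  | .E Q p _ => if Even p then Q.out else Q.inn
  | .V _ _ _ j => j

def Ch.s : Ch → ℕ
  | .root _ _ => 0
  | .E _ _ _ => 1
  | .V _ _ _ _ => 0

theorem Ch.s_root (i j : ℕ) : (Ch.root i j).s = 0 := rfl
theorem Ch.s_E (Q : Ch) (p k : ℕ) : (Ch.E Q p k).s = 1 := rfl
theorem Ch.s_V (Q : Ch) (p i j : ℕ) : (Ch.V Q p i j).s = 0 := rfl

def Ch.inl (Q : Ch) (p : ℕ) : ℕ := if Even p then Q.inn else Q.out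
def Ch.outl (Q : Ch) (p : ℕ) : ℕ := if Even p then Q.out else Q.inn

theorem Ch.inl_succ (Q : Ch) (p : ℕ) : Q.inl (p + 1) = Q.outl p := by
  unfold Ch.inl Ch.outl
  by_cases h : Even p
  · simp [h, Nat.even_add_one]
  · simp [h, Nat.even_add_one]

theorem Ch.outl_succ (Q : Ch) (p : ℕ) : Q.outl (p + 1) = Q.inl p := by
  unfold Ch.inl Ch.outl
  by_cases h : Even p
  · simp [h, Nat.even_add_one]
  · simp [h, Nat.even_add_one]

theorem Ch.inl_zero (Q : Ch) : Q.inl 0 = Q.inn := by simp [Ch.inl]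
theorem Ch.outl_zero (Q : Ch) : Q.outl 0 = Q.out := by simp [Ch.outl]
theorem Ch.inl_one (Q : Ch) : Q.inl 1 = Q.out := by simp [Ch.inl]
theorem Ch.outl_one (Q : Ch) : Q.outl 1 = Q.inn := by simp [Ch.outl]
theorem Ch.s_le (Q : Ch) : Q.s ≤ 1 := by cases Q <;> simp [Ch.s]
theorem Ch.out_E (Q : Ch) (p k : ℕ) : (Ch.E Q p k).out = Q.outl p := rfl
theorem Ch.inn_E (Q : Ch) (p k : ℕ) : (Ch.E Q p k).inn = k := rfl

def sz (D : PD) (Q : Ch) : ℕ := D.N Q.inn Q.out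

theorem sz_ge (D : PD) (Q : Ch) : 7 ≤ sz D Q := D.seven _ _

theorem Ch.inl_sz (D : PD) (Q : Ch) : Q.inl (sz D Q) = Q.inn := by
  by_cases h : Q.inn = Q.out
  · simp [Ch.inl, h]
  · simp [Ch.inl, sz, D.par _ _ h]

theorem Ch.outl_sz (D : PD) (Q : Ch) : Q.outl (sz D Q) = Q.out := by
  by_cases h : Q.inn = Q.out
  · simp [Ch.outl, h]
  · simp [Ch.outl, sz, D.par _ _ h]

theorem Ch.outl_last (D : PD) (Q : Ch) : Q.outl (sz D Q - 1) = Q.inn := by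
  have := sz_ge D Q
  rw [← Ch.inl_succ, Nat.sub_add_cancel (by omega), Ch.inl_sz]

theorem Ch.inl_last (D : PD) (Q : Ch) : Q.inl (sz D Q - 1) = Q.out := by
  have := sz_ge D Q
  rw [← Ch.outl_succ, Nat.sub_add_cancel (by omega), Ch.outl_sz]

theorem Ch.outl_last2 (D : PD) (Q : Ch) : Q.outl (sz D Q - 2) = Q.out := by
  have := sz_ge D Q
  rw [← Ch.inl_succ, show sz D Q - 2 + 1 = sz D Q - 1 by omega, Ch.inl_last]

theorem Ch.inl_last2 (D : PD) (Q : Ch) : Q.inl (sz D Q - 2) = Q.inn := by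
  have := sz_ge D Q
  rw [← Ch.outl_succ, show sz D Q - 2 + 1 = sz D Q - 1 by omega, Ch.outl_last]

def CValid (D : PD) : Ch → Prop
  | .root _ _ => True
  | .E Q p k => CValid D Q ∧ Q.s + 1 ≤ p ∧ p + 2 ≤ sz D Q ∧ k ≠ Q.inl p
  | .V Q p i j => CValid D Q ∧ Q.s + 2 ≤ p ∧ p + 2 ≤ sz D Q ∧ i ≠ Q.inl p ∧ j ≠ Q.outl p

/-- Vertices of the developed complex. -/
inductive Vt
  | base
  | free (Q : Ch) (p : ℕ)
  | so (x : Vt) (k : ℕ)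
  | si (x : Vt) (k : ℕ)

def upO : Vt → ℕ → Prop
  | .base, _ => True
  | .free Q p, k => k ≠ Q.outl p
  | .so _ _, _ => False
  | .si _ k', k => k ≠ k'

def upI : Vt → ℕ → Prop
  | .base, _ => True
  | .free Q p, k => k ≠ Q.inl p
  | .so _ k', k => k ≠ k'
  | .si _ _, _ => False

def VValid (D : PD) : Vt → Prop
  | .base => True
  | .free Q p => CValid D Q ∧ Q.s + 2 ≤ p ∧ p + 2 ≤ sz D Q
  | .so x k => VValid D x ∧ upO x k
  | .si x k => VValid D x ∧ upI x k

def flagAt (D : PD) : Vt → ℕ → ℕ → Ch × ℕ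
  | .base, i, j => (.root i j, 0)
  | .free Q p, i, j =>
      if i = Q.inl p then (if j = Q.outl p then (Q, p) else (.E Q (p - 1) j, 1))
      else (if j = Q.outl p then (.E Q p i, 0) else (.V Q p i j, 0))
  | .so x k, i, j =>
      if i = k then ((flagAt D x j k).1, (flagAt D x j k).1.s + 1)
      else (.E (flagAt D x j k).1 ((flagAt D x j k).1.s + 1) i, 0)
  | .si x k, i, j =>
      if j = k then ((flagAt D x k i).1, sz D (flagAt D x k i).1 - 1)
      else (.E (flagAt D x k i).1 (sz D (flagAt D x k i).1 - 2) j, 1)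

def vert (D : PD) : Ch → ℕ → Vt
  | .root i j, p => if p = 0 then .base else if p = 1 then .so .base j
      else if p + 1 = sz D (.root i j) then .si .base i else .free (.root i j) p
  | .E Q q k, p => if p = 0 then vert D Q q else if p = 1 then vert D Q (q + 1)
      else if p = 2 then .so (vert D Q (q + 1)) k
      else if p + 1 = sz D (.E Q q k) then .si (vert D Q q) k else .free (.E Q q k) p
  | .V Q q i j, p => if p = 0 then .free Q q else if p = 1 then .so (.free Q q) j
      else if p + 1 = sz D (.V Q q i j) then .si (.free Q q) i else .free (.V Q q i j) p

theorem vert_so (D : PD) (Q : Ch) : vert D Q (Q.s + 1) = .so (vert D Q Q.s) (Q.outl Q.s) := by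
  cases Q <;> simp [vert, Ch.s, Ch.outl, Ch.inn, Ch.out]

theorem vert_si (D : PD) (Q : Ch) : vert D Q (sz D Q - 1) = .si (vert D Q 0) Q.inn := by
  have := sz_ge D Q
  have h1 : sz D Q - 1 ≠ 0 := by omega
  have h2 : sz D Q - 1 ≠ 1 := by omega
  have h3 : sz D Q - 1 ≠ 2 := by omega
  have h4 : sz D Q - 1 + 1 = sz D Q := by omega
  cases Q <;> simp [vert, Ch.inn, h1, h2, h3, h4]

theorem vert_free (D : PD) (Q : Ch) (p : ℕ) (h : Q.s + 2 ≤ p) (h' : p + 2 ≤ sz D Q) :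
    vert D Q p = .free Q p := by
  have h4 : p + 1 ≠ sz D Q := by omega
  cases Q <;> simp only [Ch.s] at h
  all_goals
    have h1 : p ≠ 0 := by omega
    have h2 : p ≠ 1 := by omega
    simp [vert, h1, h2, h4]
  omega

theorem flagAt_spec (D : PD) (v : Vt) : VValid D v → ∀ i j,
    CValid D (flagAt D v i j).1 ∧ (flagAt D v i j).2 < sz D (flagAt D v i j).1 ∧
    (flagAt D v i j).1.inl (flagAt D v i j).2 = i ∧
    (flagAt D v i j).1.outl (flagAt D v i j).2 = j ∧
    (upO v j → (flagAt D v i j).2 = (flagAt D v i j).1.s) ∧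
    (upI v i → (flagAt D v i j).2 = 0) ∧
    vert D (flagAt D v i j).1 (flagAt D v i j).2 = v := by
  induction v with
  | base =>
    intro _ i j
    have := D.seven i j
    simp [flagAt, CValid, Ch.inl, Ch.outl, Ch.inn, Ch.out, Ch.s, upO, upI, vert, sz]
    omega
  | free Q p =>
    intro hv i j
    obtain ⟨hQ, h1, h2⟩ := hv
    have hvf := vert_free D Q p h1 h2
    have hp : p - 1 + 1 = p := by omega
    have e1 : Q.outl (p - 1) = Q.inl p := by rw [← Ch.inl_succ, hp]
    have e2 : Q.inl (p - 1) = Q.outl p := by rw [← Ch.outl_succ, hp]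
    by_cases hi : i = Q.inl p <;> by_cases hj : j = Q.outl p
    · simp [flagAt, hi, hj, hQ, upO, upI, hvf]; omega
    · simp only [flagAt, hi, hj, if_true, if_false]
      have := sz_ge D (.E Q (p-1) j)
      simp [CValid, hQ, Ch.inl_one, Ch.outl_one, Ch.out_E, Ch.inn_E, e1, e2, hj, upI, vert, hp, hvf, Ch.s_E]
      omega
    · simp only [flagAt, hi, hj, if_true, if_false]
      have := sz_ge D (.E Q p i)
      simp [CValid, hQ, Ch.inl_zero, Ch.outl_zero, Ch.out_E, Ch.inn_E, hi, upO, upI, vert, hvf]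
      omega
    · simp only [flagAt, hi, hj, if_false]
      have := sz_ge D (.V Q p i j)
      simp [CValid, hQ, Ch.inl_zero, Ch.outl_zero, Ch.out, Ch.inn, hi, hj, upO, upI, vert, Ch.s_V]
      omega
  | so x k ih =>
    intro hv i j
    obtain ⟨hx, hu⟩ := hv
    obtain ⟨c1, c2, c3, c4, c5, c6, c7⟩ := ih hx j k
    have hs := c5 hu
    set Q := (flagAt D x j k).1 with hQ
    rw [hs] at c2 c3 c4 c7
    have := sz_ge D Q
    have := Q.s_le
    have hvv := vert_so D Q
    rw [c7, c4] at hvv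
    by_cases hi : i = k
    · simp only [flagAt, hi, if_true, ← hQ]
      refine ⟨c1, by omega, by rw [Ch.inl_succ, c4], by rw [Ch.outl_succ, c3],
        by simp [upO], by simp [upI], hvv⟩
    · simp only [flagAt, hi, if_false, ← hQ]
      have := sz_ge D (.E Q (Q.s+1) i)
      refine ⟨⟨c1, le_rfl, by omega, by rw [Ch.inl_succ, c4]; exact hi⟩, by omega,
        by simp [Ch.inl_zero, Ch.inn_E], by rw [Ch.outl_zero, Ch.out_E, Ch.outl_succ, c3],
        by simp [upO], by simp, by simp [vert, hvv]⟩
  | si x k ih =>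
    intro hv i j
    obtain ⟨hx, hu⟩ := hv
    obtain ⟨c1, c2, c3, c4, c5, c6, c7⟩ := ih hx k i
    have hs := c6 hu
    set Q := (flagAt D x k i).1 with hQ
    rw [hs] at c2 c3 c4 c7
    rw [Ch.inl_zero] at c3
    rw [Ch.outl_zero] at c4
    have := sz_ge D Q
    have := Q.s_le
    have hvv := vert_si D Q
    rw [c7, c3] at hvv
    by_cases hi : j = k
    · simp only [flagAt, hi, if_true, ← hQ]
      refine ⟨c1, by omega, by rw [Ch.inl_last, c4], by rw [Ch.outl_last, c3],
        by simp [upO], by simp [upI], hvv⟩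
    · simp only [flagAt, hi, if_false, ← hQ]
      have := sz_ge D (.E Q (sz D Q - 2) j)
      refine ⟨⟨c1, by omega, by omega, by rw [Ch.inl_last2, c3]; exact hi⟩, by omega,
        by rw [Ch.inl_one, Ch.out_E, Ch.outl_last2, c4], by simp [Ch.outl_one, Ch.inn_E],
        by simp [Ch.s], by simp [upI], ?_⟩
      simp only [vert, one_ne_zero, if_false, if_true]
      rw [show sz D Q - 2 + 1 = sz D Q - 1 by omega, hvv]

end WG

namespace WG

theorem upO_vert (D : PD) (Q : Ch) (p k : ℕ) (h : Q.s + 2 ≤ p) (h' : p < sz D Q) (hk : k ≠ Q.outl p) :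
    upO (vert D Q p) k := by
  by_cases e : p + 2 ≤ sz D Q
  · rw [vert_free D Q p h e]; exact hk
  · have : p = sz D Q - 1 := by omega
    subst this
    rw [vert_si]; rw [Ch.outl_last] at hk; exact hk

theorem upI_vert (D : PD) (Q : Ch) (p k : ℕ) (h : Q.s + 1 ≤ p) (h' : p + 2 ≤ sz D Q) (hk : k ≠ Q.inl p) :
    upI (vert D Q p) k := by
  by_cases e : Q.s + 2 ≤ p
  · rw [vert_free D Q p e h']; exact hk
  · have : p = Q.s + 1 := by omega
    subst this
    rw [vert_so]; rw [Ch.inl_succ] at hk; exact hk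

theorem vert_valid (D : PD) (Q : Ch) : CValid D Q → ∀ p, p < sz D Q → VValid D (vert D Q p) := by
  induction Q with
  | root i j =>
    intro hQ p hp
    unfold vert
    split_ifs with h1 h2 h3
    · trivial
    · exact ⟨trivial, trivial⟩
    · exact ⟨trivial, trivial⟩
    · refine ⟨trivial, ?_, by omega⟩
      rw [Ch.s_root]; omega
  | E Q q k ih =>
    intro hQ p hp
    have hQ' := hQ
    obtain ⟨a, b, c, d⟩ := hQ
    unfold vert
    split_ifs with h1 h2 h3 h4
    · exact ih a _ (by omega)
    · exact ih a _ (by omega)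
    · exact ⟨ih a _ (by omega), upO_vert D Q _ _ (by omega) (by omega) (by rwa [Ch.outl_succ])⟩
    · exact ⟨ih a _ (by omega), upI_vert D Q _ _ (by omega) (by omega) d⟩
    · refine ⟨hQ', ?_, by omega⟩
      rw [Ch.s_E]; omega
  | V Q q i j ih =>
    intro hQ p hp
    have hQ' := hQ
    obtain ⟨a, b, c, d, e⟩ := hQ
    unfold vert
    split_ifs with h1 h2 h3
    · exact ⟨a, b, c⟩
    · exact ⟨⟨a, b, c⟩, e⟩
    · exact ⟨⟨a, b, c⟩, d⟩
    · refine ⟨hQ', ?_, by omega⟩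
      rw [Ch.s_V]; omega

def F2p (D : PD) (Q : Ch) (p : ℕ) : Prop := flagAt D (vert D Q p) (Q.inl p) (Q.outl p) = (Q, p)

theorem F2_aux (D : PD) (Q : Ch) (h0 : F2p D Q 0) (hs : F2p D Q Q.s) (p : ℕ) (hp : p < sz D Q) :
    F2p D Q p := by
  have hsz := sz_ge D Q
  have := Q.s_le
  by_cases e0 : p = 0
  · rw [e0]; exact h0
  by_cases e1 : p = Q.s
  · rw [e1]; exact hs
  by_cases e2 : p = Q.s + 1
  · subst e2
    unfold F2p at *
    rw [vert_so, Ch.inl_succ, Ch.outl_succ]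
    simp [flagAt, hs]
  by_cases e3 : p = sz D Q - 1
  · subst e3
    unfold F2p at *
    rw [Ch.inl_zero, Ch.outl_zero] at h0
    rw [vert_si, Ch.inl_last, Ch.outl_last]
    simp [flagAt, h0]
  unfold F2p
  rw [vert_free D Q p (by omega) (by omega)]
  simp [flagAt]

theorem F2 (D : PD) (Q : Ch) : CValid D Q → ∀ p, p < sz D Q → F2p D Q p := by
  induction Q with
  | root i j =>
    intro hQ
    refine F2_aux D _ ?_ ?_ <;> simp [F2p, Ch.s, vert, flagAt, Ch.inl, Ch.outl, Ch.inn, Ch.out]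
  | V Q q i j ih =>
    intro hQ
    obtain ⟨a, b, c, d, e⟩ := hQ
    refine F2_aux D _ ?_ ?_ <;> simp [F2p, Ch.s_V, vert, flagAt, Ch.inl_zero, Ch.outl_zero, Ch.inn, Ch.out, d, e]
  | E Q q k ih =>
    intro hQ
    obtain ⟨a, b, c, d⟩ := hQ
    have hsz := sz_ge D Q
    have := Q.s_le
    refine F2_aux D _ ?_ ?_
    · unfold F2p
      rw [Ch.inl_zero, Ch.outl_zero, Ch.inn_E, Ch.out_E]
      simp only [vert, if_true]
      by_cases e : q = Q.s + 1
      · subst e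
        have h := ih a Q.s (by omega)
        unfold F2p at h
        rw [Ch.inl_succ] at d
        rw [vert_so, Ch.outl_succ]
        simp [flagAt, d, h]
      · rw [vert_free D Q q (by omega) (by omega)]
        simp [flagAt, d]
    · unfold F2p
      rw [Ch.s_E, Ch.inl_one, Ch.outl_one, Ch.inn_E, Ch.out_E]
      simp only [vert, if_true, one_ne_zero, if_false]
      by_cases e : q + 1 = sz D Q - 1
      · have h := ih a 0 (by omega)
        unfold F2p at h
        rw [e]
        have e' : q = sz D Q - 2 := by omega
        subst e'
        rw [Ch.inl_zero, Ch.outl_zero] at h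
        rw [Ch.inl_last2] at d
        rw [vert_si, Ch.outl_last2]
        simp [flagAt, d, h]
      · rw [vert_free D Q (q+1) (by omega) (by omega)]
        simp [flagAt, Ch.inl_succ, Ch.outl_succ, d]

def mulv (D : PD) : Vt → ℕ → Vt
  | .base, b => .so .base b
  | .free Q p, b => if b = Q.outl p then vert D Q (p + 1) else .so (.free Q p) b
  | .so x k, b => vert D (flagAt D x b k).1 ((flagAt D x b k).1.s + 2)
  | .si x k, b => if b = k then x else .so (.si x k) b

def minv (D : PD) : Vt → ℕ → Vt
  | .base, b => .si .base b
  | .free Q p, b => if b = Q.inl p then vert D Q (p - 1) else .si (.free Q p) b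
  | .so x k, b => if b = k then x else .si (.so x k) b
  | .si x k, b => vert D (flagAt D x k b).1 (sz D (flagAt D x k b).1 - 2)

theorem mulv_flag (D : PD) (v : Vt) (hv : VValid D v) (i b : ℕ) :
    mulv D v b = vert D (flagAt D v i b).1 (((flagAt D v i b).2 + 1) % sz D (flagAt D v i b).1) := by
  cases v with
  | base =>
    have := sz_ge D (.root i b)
    simp only [mulv, flagAt]
    rw [Nat.mod_eq_of_lt (by omega)]
    simp [vert]
  | free Q p =>
    obtain ⟨hQ, h1, h2⟩ := hv
    have hvf := vert_free D Q p h1 h2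
    have hp : p - 1 + 1 = p := by omega
    by_cases hi : i = Q.inl p <;> by_cases hj : b = Q.outl p
    · simp only [mulv, flagAt, hi, hj, if_true]
      rw [Nat.mod_eq_of_lt (by omega)]
    · have := sz_ge D (.E Q (p-1) b)
      simp only [mulv, flagAt, hi, hj, if_true, if_false]
      rw [Nat.mod_eq_of_lt (by omega)]
      simp [vert, hp, hvf]
    · have := sz_ge D (.E Q p i)
      simp only [mulv, flagAt, hi, hj, if_true, if_false]
      rw [Nat.mod_eq_of_lt (by omega)]
      simp [vert]
    · have := sz_ge D (.V Q p i b)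
      simp only [mulv, flagAt, hi, hj, if_false]
      rw [Nat.mod_eq_of_lt (by omega)]
      simp [vert]
  | so x k =>
    simp only [mulv, flagAt]
    have := sz_ge D (flagAt D x b k).1
    have := (flagAt D x b k).1.s_le
    by_cases hi : i = k
    · simp only [hi, if_true]
      rw [Nat.mod_eq_of_lt (by omega)]
    · simp only [hi, if_false]
      have := sz_ge D (.E (flagAt D x b k).1 ((flagAt D x b k).1.s + 1) i)
      rw [Nat.mod_eq_of_lt (by omega)]
      simp [vert]
  | si x k =>
    simp only [mulv, flagAt]
    obtain ⟨hx, hu⟩ := hv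
    obtain ⟨c1, c2, c3, c4, c5, c6, c7⟩ := flagAt_spec D x hx k i
    have hs := c6 hu
    rw [hs] at c7 c3
    rw [Ch.inl_zero] at c3
    have := sz_ge D (flagAt D x k i).1
    by_cases hi : b = k
    · simp only [hi, if_true]
      rw [Nat.sub_add_cancel (by omega), Nat.mod_self, c7]
    · simp only [hi, if_false]
      have := sz_ge D (.E (flagAt D x k i).1 (sz D (flagAt D x k i).1 - 2) b)
      rw [Nat.mod_eq_of_lt (by omega)]
      simp only [vert, if_true]
      rw [if_neg (by omega), if_neg (by omega),
        show sz D (flagAt D x k i).1 - 2 + 1 = sz D (flagAt D x k i).1 - 1 by omega, vert_si, c7, c3]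

theorem minv_flag (D : PD) (v : Vt) (hv : VValid D v) (b j : ℕ) :
    minv D v b = vert D (flagAt D v b j).1
      (((flagAt D v b j).2 + (sz D (flagAt D v b j).1 - 1)) % sz D (flagAt D v b j).1) := by
  have key : ∀ n p, 0 < p → p < n → (p + (n - 1)) % n = p - 1 := by
    intro n p h h'
    rw [show p + (n - 1) = (p - 1) + n by omega, Nat.add_mod_right, Nat.mod_eq_of_lt (by omega)]
  have key0 : ∀ n, 0 < n → (0 + (n - 1)) % n = n - 1 := by
    intro n h
    rw [zero_add, Nat.mod_eq_of_lt (by omega)]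
  cases v with
  | base =>
    have := sz_ge D (.root b j)
    simp only [minv, flagAt]
    rw [key0 _ (by omega), vert_si]
    simp [vert, Ch.inn]
  | free Q p =>
    obtain ⟨hQ, h1, h2⟩ := hv
    have hvf := vert_free D Q p h1 h2
    have hp : p - 1 + 1 = p := by omega
    by_cases hi : b = Q.inl p <;> by_cases hj : j = Q.outl p
    · simp only [minv, flagAt, hi, hj, if_true]
      rw [key _ _ (by omega) (by omega)]
    · have := sz_ge D (.E Q (p-1) j)
      simp only [minv, flagAt, hi, hj, if_true, if_false]
      rw [key _ _ (by omega) (by omega)]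
      simp [vert]
    · have := sz_ge D (.E Q p b)
      simp only [minv, flagAt, hi, hj, if_true, if_false]
      rw [key0 _ (by omega), vert_si]
      simp [vert, hvf, Ch.inn]
    · have := sz_ge D (.V Q p b j)
      simp only [minv, flagAt, hi, hj, if_false]
      rw [key0 _ (by omega), vert_si]
      simp [vert, Ch.inn]
  | so x k =>
    simp only [minv, flagAt]
    obtain ⟨hx, hu⟩ := hv
    obtain ⟨c1, c2, c3, c4, c5, c6, c7⟩ := flagAt_spec D x hx j k
    have hs := c5 hu
    rw [hs] at c7 c4
    have := sz_ge D (flagAt D x j k).1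
    have := (flagAt D x j k).1.s_le
    by_cases hi : b = k
    · simp only [hi, if_true]
      rw [key _ _ (by omega) (by omega), Nat.add_sub_cancel, c7]
    · simp only [hi, if_false]
      have := sz_ge D (.E (flagAt D x j k).1 ((flagAt D x j k).1.s + 1) b)
      rw [key0 _ (by omega), vert_si]
      simp only [vert, if_true]
      rw [vert_so, c7, c4]
      rfl
  | si x k =>
    simp only [minv, flagAt]
    have := sz_ge D (flagAt D x k b).1
    by_cases hi : j = k
    · simp only [hi, if_true]
      rw [key _ _ (by omega) (by omega)]
      rfl
    · simp only [hi, if_false]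
      have := sz_ge D (.E (flagAt D x k b).1 (sz D (flagAt D x k b).1 - 2) j)
      rw [key _ _ (by omega) (by omega)]
      simp [vert]

theorem inl_mod (D : PD) (Q : Ch) (p : ℕ) : Q.inl (p % sz D Q) = Q.inl p := by
  by_cases h : Q.inn = Q.out
  · simp [Ch.inl, h]
  · have h2 := D.par _ _ h
    have : Even (p % sz D Q) ↔ Even p := by
      unfold sz
      rw [Nat.even_iff, Nat.even_iff, Nat.mod_mod_of_dvd _ h2.two_dvd]
    simp [Ch.inl, this]

theorem outl_mod (D : PD) (Q : Ch) (p : ℕ) : Q.outl (p % sz D Q) = Q.outl p := by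
  rw [← Ch.inl_succ, ← Ch.inl_succ, ← inl_mod D, ← inl_mod D Q (p + 1), Nat.mod_add_mod]

def vm (D : PD) (Q : Ch) (p : ℕ) : Vt := vert D Q (p % sz D Q)

theorem vm_valid (D : PD) (Q : Ch) (hQ : CValid D Q) (p : ℕ) : VValid D (vm D Q p) :=
  vert_valid D Q hQ _ (Nat.mod_lt _ (by have := sz_ge D Q; omega))

theorem mulv_vm (D : PD) (Q : Ch) (hQ : CValid D Q) (p : ℕ) :
    mulv D (vm D Q p) (Q.outl p) = vm D Q (p + 1) := by
  have h := F2 D Q hQ (p % sz D Q) (Nat.mod_lt _ (by have := sz_ge D Q; omega))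
  unfold F2p at h
  rw [mulv_flag D _ (vm_valid D Q hQ p) (Q.inl p)]
  rw [inl_mod, outl_mod] at h
  rw [show flagAt D (vm D Q p) (Q.inl p) (Q.outl p) = (Q, p % sz D Q) from h]
  simp [vm]

theorem minv_vm (D : PD) (Q : Ch) (hQ : CValid D Q) (p : ℕ) :
    minv D (vm D Q (p + 1)) (Q.outl p) = vm D Q p := by
  have hs := sz_ge D Q
  have h := F2 D Q hQ ((p + 1) % sz D Q) (Nat.mod_lt _ (by omega))
  unfold F2p at h
  rw [minv_flag D _ (vm_valid D Q hQ _) (Q.outl p) (Q.outl (p + 1))]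
  rw [inl_mod, outl_mod, Ch.inl_succ] at h
  rw [show flagAt D (vm D Q (p + 1)) (Q.outl p) (Q.outl (p + 1)) = (Q, (p + 1) % sz D Q) from h]
  simp only [vm]
  rw [Nat.mod_add_mod, show p + 1 + (sz D Q - 1) = p + sz D Q by omega, Nat.add_mod_right]

theorem sz_labels (D : PD) (Q : Ch) (p : ℕ) : sz D Q = D.N (Q.inl p) (Q.outl p) := by
  unfold sz Ch.inl Ch.outl
  split_ifs
  · rfl
  · exact D.symm _ _

theorem flag_vm (D : PD) (v : Vt) (hv : VValid D v) (i j : ℕ) :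
    ∃ Q p, CValid D Q ∧ Q.inl p = i ∧ Q.outl p = j ∧ vm D Q p = v ∧ p < sz D Q ∧ sz D Q = D.N i j := by
  obtain ⟨c1, c2, c3, c4, c5, c6, c7⟩ := flagAt_spec D v hv i j
  refine ⟨_, _, c1, c3, c4, ?_, c2, ?_⟩
  · rw [vm, Nat.mod_eq_of_lt c2, c7]
  · rw [sz_labels D _ (flagAt D v i j).2, c3, c4]

theorem mulv_valid (D : PD) (v : Vt) (hv : VValid D v) (b : ℕ) : VValid D (mulv D v b) := by
  obtain ⟨Q, p, hQ, h1, h2, rfl, h3, h4⟩ := flag_vm D v hv 0 b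
  rw [← h2, mulv_vm D Q hQ]; exact vm_valid D Q hQ _

theorem minv_mulv (D : PD) (v : Vt) (hv : VValid D v) (b : ℕ) : minv D (mulv D v b) b = v := by
  obtain ⟨Q, p, hQ, h1, h2, rfl, h3, h4⟩ := flag_vm D v hv 0 b
  rw [← h2, mulv_vm D Q hQ, minv_vm D Q hQ]

theorem flag_vm' (D : PD) (v : Vt) (hv : VValid D v) (b : ℕ) :
    ∃ Q p, CValid D Q ∧ Q.outl p = b ∧ vm D Q (p + 1) = v := by
  obtain ⟨Q, p, hQ, h1, h2, rfl, h3, h4⟩ := flag_vm D v hv b 0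
  have hs := sz_ge D Q
  refine ⟨Q, p + (sz D Q - 1), hQ, ?_, ?_⟩
  · rw [← Ch.inl_succ, ← inl_mod D, show p + (sz D Q - 1) + 1 = p + sz D Q by omega, Nat.add_mod_right,
      inl_mod, h1]
  · rw [vm, show p + (sz D Q - 1) + 1 = p + sz D Q by omega, Nat.add_mod_right, vm]

theorem minv_valid (D : PD) (v : Vt) (hv : VValid D v) (b : ℕ) : VValid D (minv D v b) := by
  obtain ⟨Q, p, hQ, h2, rfl⟩ := flag_vm' D v hv b
  rw [← h2, minv_vm D Q hQ]; exact vm_valid D Q hQ _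

theorem mulv_minv (D : PD) (v : Vt) (hv : VValid D v) (b : ℕ) : mulv D (minv D v b) b = v := by
  obtain ⟨Q, p, hQ, h2, rfl⟩ := flag_vm' D v hv b
  rw [← h2, minv_vm D Q hQ, mulv_vm D Q hQ]

/-- The permutation of the vertices given by a generator. -/
def perm (D : PD) (b : ℕ) : Equiv.Perm {v // VValid D v} where
  toFun v := ⟨mulv D v.1 b, mulv_valid D v.1 v.2 b⟩
  invFun v := ⟨minv D v.1 b, minv_valid D v.1 v.2 b⟩
  left_inv v := Subtype.ext (minv_mulv D v.1 v.2 b)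
  right_inv v := Subtype.ext (mulv_minv D v.1 v.2 b)

theorem perm_pow2 (D : PD) (Q : Ch) (hQ : CValid D Q) (p m : ℕ) :
    ((perm D (Q.inl p) * perm D (Q.outl p)) ^ m) ⟨vm D Q p, vm_valid D Q hQ p⟩
      = ⟨vm D Q (p + 2 * m), vm_valid D Q hQ _⟩ := by
  induction m generalizing p with
  | zero => rfl
  | succ m ih =>
    rw [pow_succ, Equiv.Perm.mul_apply]
    have : (perm D (Q.inl p) * perm D (Q.outl p)) ⟨vm D Q p, vm_valid D Q hQ p⟩
        = ⟨vm D Q (p + 2), vm_valid D Q hQ _⟩ := by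
      apply Subtype.ext
      show mulv D (mulv D (vm D Q p) (Q.outl p)) (Q.inl p) = _
      rw [mulv_vm D Q hQ, ← Ch.outl_succ, mulv_vm D Q hQ]
    rw [this]
    have h := ih (p + 2)
    rw [Ch.inl_succ, Ch.outl_succ, Ch.outl_succ, Ch.inl_succ] at h
    rw [h]
    apply Subtype.ext
    show vm D Q _ = vm D Q _
    congr 1; ring

theorem perm_rel2 (D : PD) (i j n : ℕ) (h : D.N i j = 2 * n) : (perm D i * perm D j) ^ n = 1 := by
  ext ⟨v, hv⟩
  obtain ⟨Q, p, hQ, rfl, rfl, rfl, h3, h4⟩ := flag_vm D v hv i j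
  rw [perm_pow2 D Q hQ, ← h, ← h4]
  simp [vm]

theorem perm_rel1 (D : PD) (i : ℕ) : (perm D i) ^ (D.N i i) = 1 := by
  have key : ∀ Q (hQ : CValid D Q) p m, Q.inl p = i → Q.outl p = i →
      ((perm D i) ^ m) ⟨vm D Q p, vm_valid D Q hQ p⟩ = ⟨vm D Q (p + m), vm_valid D Q hQ _⟩ := by
    intro Q hQ p m h1 h2
    induction m generalizing p with
    | zero => rfl
    | succ m ih =>
      rw [pow_succ, Equiv.Perm.mul_apply]
      have : (perm D i) ⟨vm D Q p, vm_valid D Q hQ p⟩ = ⟨vm D Q (p + 1), vm_valid D Q hQ _⟩ := by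
        apply Subtype.ext
        show mulv D (vm D Q p) i = _
        conv_lhs => rw [← h2]
        rw [mulv_vm D Q hQ]
      rw [this, ih (p + 1) (by rw [Ch.inl_succ, h2]) (by rw [Ch.outl_succ, h1])]
      apply Subtype.ext
      show vm D Q _ = vm D Q _
      congr 1; ring
  ext ⟨v, hv⟩
  obtain ⟨Q, p, hQ, h1, h2, rfl, h3, h4⟩ := flag_vm D v hv i i
  rw [key Q hQ p _ h1 h2, ← h4]
  simp [vm]

end WG

namespace WG

/-- Alternating words. -/
def alt : ℕ → ℕ → ℕ → Bool → List (ℕ × Bool)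
  | _, _, 0, _ => []
  | i, j, m + 1, ε => (i, ε) :: alt j i m ε

theorem alt_length (i j m : ℕ) (ε : Bool) : (alt i j m ε).length = m := by
  induction m generalizing i j with
  | zero => rfl
  | succ m ih => simp [alt, ih]

theorem alt_pfx (i j m m' : ℕ) (ε : Bool) (h : m ≤ m') : alt i j m ε <+: alt i j m' ε := by
  induction m generalizing i j m' with
  | zero => simp [alt]
  | succ m ih =>
    obtain ⟨m'', rfl⟩ : ∃ m'', m' = m'' + 1 := ⟨m' - 1, by omega⟩
    simp only [alt]
    exact List.cons_prefix_cons.2 ⟨rfl, ih _ _ _ (by omega)⟩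

def step (D : PD) (l : ℕ × Bool) (v : Vt) : Vt := if l.2 then mulv D v l.1 else minv D v l.1

def act (D : PD) (w : List (ℕ × Bool)) : Vt := w.foldr (step D) .base

def NoArc (D : PD) (w : List (ℕ × Bool)) : Prop := ∀ i j ε, ¬ alt i j (D.N i j - 3) ε <:+: w

inductive Inv (D : PD) : List (ℕ × Bool) → Vt → Prop
  | nil : Inv D [] .base
  | so (x : Vt) (k : ℕ) (w) : Inv D ((k, true) :: w) (.so x k)
  | si (x : Vt) (k : ℕ) (w) : Inv D ((k, false) :: w) (.si x k)
  | fp (Q : Ch) (p : ℕ) (w) (h1 : Q.s + 2 ≤ p) (h2 : p + 2 ≤ sz D Q)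
      (h : alt (Q.inl p) (Q.outl p) (p - Q.s) true <+: w) : Inv D w (.free Q p)
  | fn (Q : Ch) (p : ℕ) (w) (h1 : Q.s + 2 ≤ p) (h2 : p + 2 ≤ sz D Q)
      (h : alt (Q.outl p) (Q.inl p) (sz D Q - p) false <+: w) : Inv D w (.free Q p)

theorem inv_step (D : PD) (w : List (ℕ × Bool)) (v : Vt) (hv : VValid D v) (l : ℕ × Bool)
    (hr : FreeGroup.IsReduced (l :: w)) (hn : NoArc D (l :: w)) (hI : Inv D w v) :
    Inv D (l :: w) (step D l v) := by
  obtain ⟨b, ε⟩ := l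
  have hred : ∀ c ε' w', w = (c, ε') :: w' → b = c → ε = ε' := by
    rintro c ε' w' rfl rfl
    have := (List.isChain_cons_cons.1 hr).1
    simpa using this
  have harc : ∀ Q : Ch, ∀ p m, sz D Q ≤ m + 3 → ¬ alt (Q.inl p) (Q.outl p) m ε <+: (b, ε) :: w := by
    intro Q p m hm h
    refine hn (Q.inl p) (Q.outl p) ε (List.IsPrefix.isInfix ((alt_pfx _ _ _ _ _ ?_).trans h))
    rw [← sz_labels D Q p]; omega
  have hsp : ∀ Q : Ch, ∀ p, Q.s + 2 ≤ p → Q.inl (p - 1) = Q.outl p ∧ Q.outl (p - 1) = Q.inl p := by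
    intro Q p h
    obtain ⟨p, rfl⟩ : ∃ q, p = q + 1 := ⟨p - 1, by omega⟩
    simp [Ch.inl_succ, Ch.outl_succ]
  cases ε with
  | true =>
    show Inv D _ (mulv D v b)
    cases hI with
    | nil => exact Inv.so _ _ _
    | so x k w' =>
      simp only [mulv]
      obtain ⟨c1, c2, c3, c4, c5, c6, c7⟩ := flagAt_spec D x hv.1 b k
      rw [c5 hv.2] at c3 c4
      have := sz_ge D (flagAt D x b k).1
      have := (flagAt D x b k).1.s_le
      rw [vert_free D _ _ le_rfl (by omega)]
      refine Inv.fp _ _ _ le_rfl (by omega) ?_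
      rw [Nat.add_sub_cancel_left, Ch.inl_succ, Ch.outl_succ, Ch.outl_succ, Ch.inl_succ, c3, c4]
      exact ⟨w', rfl⟩
    | si x k w' =>
      have hbk : b ≠ k := fun h => by simpa using hred k false w' rfl h
      simp only [mulv, hbk, if_false]
      exact Inv.so _ _ _
    | fp Q p w h1 h2 h =>
      simp only [mulv]
      split_ifs with hb
      · have hpre : alt (Q.inl (p + 1)) (Q.outl (p + 1)) (p + 1 - Q.s) true <+: (b, true) :: w := by
          rw [show p + 1 - Q.s = (p - Q.s) + 1 by omega, Ch.inl_succ, Ch.outl_succ, alt, hb]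
          exact List.cons_prefix_cons.2 ⟨rfl, h⟩
        have := Q.s_le
        by_cases h3 : p + 3 ≤ sz D Q
        · rw [vert_free D Q _ (by omega) (by omega)]
          exact Inv.fp _ _ _ (by omega) (by omega) hpre
        · exact absurd hpre (harc Q _ _ (by omega))
      · exact Inv.so _ _ _
    | fn Q p w h1 h2 h =>
      have hb : b ≠ Q.outl p := by
        intro hb
        obtain ⟨w', hw⟩ := (alt_pfx _ _ 1 _ _ (by omega)).trans h
        simpa using hred (Q.outl p) false _ hw.symm hb
      simp only [mulv, hb, if_false]
      exact Inv.so _ _ _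
  | false =>
    show Inv D _ (minv D v b)
    cases hI with
    | nil => exact Inv.si _ _ _
    | so x k w' =>
      have hbk : b ≠ k := fun h => by simpa using hred k true w' rfl h
      simp only [minv, hbk, if_false]
      exact Inv.si _ _ _
    | si x k w' =>
      simp only [minv]
      obtain ⟨c1, c2, c3, c4, c5, c6, c7⟩ := flagAt_spec D x hv.1 k b
      rw [c6 hv.2] at c3 c4
      rw [Ch.inl_zero] at c3
      rw [Ch.outl_zero] at c4
      have := sz_ge D (flagAt D x k b).1
      have := (flagAt D x k b).1.s_le
      rw [vert_free D _ _ (by omega) (by omega)]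
      refine Inv.fn _ _ _ (by omega) (by omega) ?_
      rw [show sz D (flagAt D x k b).1 - (sz D (flagAt D x k b).1 - 2) = 2 by omega,
        Ch.outl_last2, Ch.inl_last2, c3, c4]
      exact ⟨w', rfl⟩
    | fp Q p w h1 h2 h =>
      have hb : b ≠ Q.inl p := by
        intro hb
        obtain ⟨w', hw⟩ := (alt_pfx _ _ 1 _ _ (by omega)).trans h
        simpa using hred (Q.inl p) true _ hw.symm hb
      simp only [minv, hb, if_false]
      exact Inv.si _ _ _
    | fn Q p w h1 h2 h =>
      simp only [minv]
      split_ifs with hb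
      · have hpre : alt (Q.inl p) (Q.outl p) (sz D Q - p + 1) false <+: (b, false) :: w := by
          rw [alt, hb]
          exact List.cons_prefix_cons.2 ⟨rfl, h⟩
        have := Q.s_le
        by_cases h3 : Q.s + 3 ≤ p
        · rw [vert_free D Q _ (by omega) (by omega)]
          refine Inv.fn _ _ _ (by omega) (by omega) ?_
          rw [(hsp Q p h1).1, (hsp Q p h1).2, show sz D Q - (p - 1) = sz D Q - p + 1 by omega]
          exact hpre
        · exact absurd hpre (harc Q _ _ (by omega))
      · exact Inv.si _ _ _

theorem act_valid (D : PD) (w : List (ℕ × Bool)) : VValid D (act D w) := by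
  induction w with
  | nil => trivial
  | cons l w ih =>
    show VValid D (step D l (act D w))
    unfold step
    split_ifs
    · exact mulv_valid D _ ih _
    · exact minv_valid D _ ih _

theorem act_inv (D : PD) (w : List (ℕ × Bool)) (hr : FreeGroup.IsReduced w) (hn : NoArc D w) :
    Inv D w (act D w) := by
  induction w with
  | nil => exact Inv.nil
  | cons l w ih =>
    refine inv_step D w _ (act_valid D w) l hr hn (ih ?_ ?_)
    · exact List.IsChain.tail hr
    · exact fun i j ε h => hn i j ε (h.trans (List.suffix_cons l w).isInfix)

theorem greendlinger (D : PD) (w : List (ℕ × Bool)) (hr : FreeGroup.IsReduced w) (hw : w ≠ [])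
    (ha : act D w = .base) : ∃ i j ε, alt i j (D.N i j - 3) ε <:+: w := by
  by_contra h
  push Not at h
  have := act_inv D w hr (fun i j ε => h i j ε)
  rw [ha] at this
  cases this
  exact hw rfl

end WG

namespace WG
open Classical in
/-- The polygon sizes of `G_S`. -/
noncomputable def pd (S : SimpleGraph ℕ) : PD where
  N i j := if i = j then 7 else if S.Adj i j then 22 else 26
  symm i j := by simp [eq_comm, S.adj_comm]
  seven i j := by split_ifs <;> omega
  par i j h := by rw [if_neg h]; split_ifs <;> decide

theorem pd_self (S : SimpleGraph ℕ) (i : ℕ) : (pd S).N i i = 7 := by simp [pd]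
theorem pd_adj (S : SimpleGraph ℕ) (i j : ℕ) (h : S.Adj i j) : (pd S).N i j = 22 := by
  simp [pd, h, h.ne]
theorem pd_nadj (S : SimpleGraph ℕ) (i j : ℕ) (hij : i ≠ j) (h : ¬ S.Adj i j) : (pd S).N i j = 26 := by
  simp [pd, h, hij]
theorem pd_cases (S : SimpleGraph ℕ) (i j : ℕ) : (i = j ∧ (pd S).N i j = 7) ∨
    (i ≠ j ∧ ((pd S).N i j = 22 ∨ (pd S).N i j = 26)) := by
  by_cases h : i = j
  · subst h; exact Or.inl ⟨rfl, pd_self S i⟩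
  · by_cases h' : S.Adj i j
    · exact Or.inr ⟨h, Or.inl (pd_adj S i j h')⟩
    · exact Or.inr ⟨h, Or.inr (pd_nadj S i j h h')⟩

def val (S : SimpleGraph ℕ) (w : List (ℕ × Bool)) : GT S.Adj :=
  PresentedGroup.mk (grRels S.Adj) (FreeGroup.mk w)

theorem val_nil (S : SimpleGraph ℕ) : val S [] = 1 := by
  simp only [val, ← FreeGroup.one_eq_mk, map_one]
theorem val_append (S : SimpleGraph ℕ) (w w' : List (ℕ × Bool)) :
    val S (w ++ w') = val S w * val S w' := by
  simp only [val, ← map_mul, FreeGroup.mul_mk]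
theorem val_invRev (S : SimpleGraph ℕ) (w : List (ℕ × Bool)) :
    val S (FreeGroup.invRev w) = (val S w)⁻¹ := by
  simp only [val, ← map_inv, FreeGroup.inv_mk]
theorem val_cons (S : SimpleGraph ℕ) (l : ℕ × Bool) (w : List (ℕ × Bool)) :
    val S (l :: w) = val S [l] * val S w := val_append S [l] w
theorem val_gen (S : SimpleGraph ℕ) (i : ℕ) : val S [(i, true)] = gen S.Adj i := rfl
theorem val_gen' (S : SimpleGraph ℕ) (i : ℕ) : val S [(i, false)] = (gen S.Adj i)⁻¹ := by
  rw [← val_gen, ← val_invRev]; rfl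
theorem val_reduce (S : SimpleGraph ℕ) (w : List (ℕ × Bool)) :
    val S (FreeGroup.reduce w) = val S w := by
  simp only [val, FreeGroup.reduce.self]
theorem val_surj (S : SimpleGraph ℕ) (x : GT S.Adj) : ∃ w, val S w = x := by
  obtain ⟨y, rfl⟩ := PresentedGroup.mk_surjective (grRels S.Adj) x
  exact ⟨y.toWord, by simp only [val, FreeGroup.mk_toWord]⟩
theorem val_rep (S : SimpleGraph ℕ) (w : List (ℕ × Bool)) (n : ℕ) :
    val S (List.replicate n w).flatten = val S w ^ n := by
  induction n with
  | zero => simp [val_nil]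
  | succ n ih => rw [List.replicate_succ, List.flatten_cons, val_append, ih, pow_succ']

theorem gen_rel (S : SimpleGraph ℕ) (r : FreeGroup ℕ) (h : r ∈ grRels S.Adj) :
    PresentedGroup.mk (grRels S.Adj) r = 1 := by
  exact PresentedGroup.one_of_mem h

theorem gen_pow (S : SimpleGraph ℕ) (i : ℕ) : gen S.Adj i ^ 7 = 1 :=
  gen_rel S _ (Or.inl ⟨i, rfl⟩)
theorem gen_adj (S : SimpleGraph ℕ) (i j : ℕ) (h : S.Adj i j) : (gen S.Adj i * gen S.Adj j) ^ 11 = 1 :=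
  gen_rel S _ (Or.inr (Or.inl ⟨i, j, h, rfl⟩))
theorem gen_nadj (S : SimpleGraph ℕ) (i j : ℕ) (hij : i ≠ j) (h : ¬ S.Adj i j) :
    (gen S.Adj i * gen S.Adj j) ^ 13 = 1 :=
  gen_rel S _ (Or.inr (Or.inr ⟨i, j, hij, h, rfl⟩))

theorem gen_pow2 (S : SimpleGraph ℕ) (i j n : ℕ) (h : (pd S).N i j = 2 * n) :
    (gen S.Adj i * gen S.Adj j) ^ n = 1 := by
  rcases pd_cases S i j with ⟨h1, h2⟩ | ⟨h1, h2⟩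
  · omega
  · by_cases h' : S.Adj i j
    · rw [pd_adj S i j h'] at h
      obtain rfl : n = 11 := by omega
      exact gen_adj S i j h'
    · rw [pd_nadj S i j h1 h'] at h
      obtain rfl : n = 13 := by omega
      exact gen_nadj S i j h1 h'

noncomputable def hom (S : SimpleGraph ℕ) : GT S.Adj →* Equiv.Perm {v // VValid (pd S) v} :=
  PresentedGroup.toGroup (f := perm (pd S)) (by
    rintro r (⟨i, rfl⟩ | ⟨i, j, h, rfl⟩ | ⟨i, j, hij, h, rfl⟩)
    · have := perm_rel1 (pd S) i
      rw [pd_self] at this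
      simpa using this
    · simpa using perm_rel2 (pd S) i j 11 (pd_adj S i j h)
    · simpa using perm_rel2 (pd S) i j 13 (pd_nadj S i j hij h))

theorem hom_gen (S : SimpleGraph ℕ) (i : ℕ) : hom S (gen S.Adj i) = perm (pd S) i :=
  PresentedGroup.toGroup.of _

theorem hom_val (S : SimpleGraph ℕ) (w : List (ℕ × Bool)) :
    hom S (val S w) ⟨.base, trivial⟩ = ⟨act (pd S) w, act_valid _ w⟩ := by
  induction w with
  | nil => rw [val_nil, map_one]; rfl
  | cons l w ih =>
    rw [val_cons, map_mul, Equiv.Perm.mul_apply, ih]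
    obtain ⟨i, ε⟩ := l
    cases ε
    · rw [val_gen', map_inv, hom_gen]; rfl
    · rw [val_gen, hom_gen]; rfl

theorem GR (S : SimpleGraph ℕ) (w : List (ℕ × Bool)) (hr : FreeGroup.IsReduced w) (hw : w ≠ [])
    (h1 : val S w = 1) : ∃ i j ε, alt i j ((pd S).N i j - 3) ε <:+: w := by
  refine greendlinger _ w hr hw ?_
  have h := hom_val S w
  rw [h1, map_one] at h
  exact (congrArg Subtype.val h).symm

theorem alt_double (S : SimpleGraph ℕ) (i j n : ℕ) (ε : Bool) :
    val S (alt i j (2 * n) ε) = (val S [(i, ε)] * val S [(j, ε)]) ^ n := by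
  induction n with
  | zero => exact val_nil S
  | succ n ih =>
    rw [show 2 * (n + 1) = 2 * n + 1 + 1 by ring, alt, alt, val_cons, val_cons S (j, ε), ih, pow_succ',
      mul_assoc]

theorem alt_self (i n : ℕ) (ε : Bool) : alt i i n ε = List.replicate n (i, ε) := by
  induction n with
  | zero => rfl
  | succ n ih => rw [alt, ih, List.replicate_succ]

theorem val_replicate (S : SimpleGraph ℕ) (l : ℕ × Bool) (n : ℕ) :
    val S (List.replicate n l) = val S [l] ^ n := by
  induction n with
  | zero => exact val_nil S
  | succ n ih => rw [List.replicate_succ, val_cons, ih, pow_succ']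

theorem pair_pow (S : SimpleGraph ℕ) (i j n : ℕ) (ε : Bool) (h : (pd S).N i j = 2 * n) :
    (val S [(i, ε)] * val S [(j, ε)]) ^ n = 1 := by
  cases ε
  · rw [val_gen', val_gen', ← mul_inv_rev, inv_pow, gen_pow2 S j i n (by rw [(pd S).symm, h]), inv_one]
  · rw [val_gen, val_gen, gen_pow2 S i j n h]

theorem single_pow (S : SimpleGraph ℕ) (i : ℕ) (ε : Bool) : (val S [(i, ε)]) ^ 7 = 1 := by
  cases ε
  · rw [val_gen', inv_pow, gen_pow, inv_one]
  · rw [val_gen, gen_pow]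

theorem alt_full (S : SimpleGraph ℕ) (i j : ℕ) (ε : Bool) : val S (alt i j ((pd S).N i j) ε) = 1 := by
  rcases pd_cases S i j with ⟨rfl, h2⟩ | ⟨h1, h2⟩
  · rw [h2, alt_self, val_replicate, single_pow]
  · obtain ⟨n, hn⟩ : ∃ n, (pd S).N i j = 2 * n := by
      rcases h2 with h2 | h2
      · exact ⟨11, h2⟩
      · exact ⟨13, h2⟩
    rw [hn, alt_double, pair_pow S i j n ε hn]

theorem alt_replace (S : SimpleGraph ℕ) (i j m : ℕ) (ε : Bool) (h : m ≤ (pd S).N i j) :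
    ∃ u, u.length = (pd S).N i j - m ∧ val S u = val S (alt i j m ε) := by
  obtain ⟨t, ht⟩ := alt_pfx i j m _ ε h
  refine ⟨FreeGroup.invRev t, ?_, ?_⟩
  · have := congrArg List.length ht
    rw [List.length_append, alt_length, alt_length] at this
    rw [FreeGroup.invRev_length]; omega
  · have := alt_full S i j ε
    rw [← ht, val_append] at this
    rw [val_invRev, eq_comm, eq_inv_iff_mul_eq_one, this]

/-- Words of minimal length with value in a given set. -/
def IsMin (S : SimpleGraph ℕ) (P : GT S.Adj → Prop) (w : List (ℕ × Bool)) : Prop :=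
  P (val S w) ∧ ∀ w', P (val S w') → w.length ≤ w'.length

theorem exists_min (S : SimpleGraph ℕ) (P : GT S.Adj → Prop) (x : GT S.Adj) (hx : P x) :
    ∃ w, IsMin S P w := by
  obtain ⟨w0, h0⟩ := val_surj S x
  obtain ⟨w, hw, hmin⟩ := WellFounded.has_min (measure (List.length (α := ℕ × Bool))).wf
    {w | P (val S w)} ⟨w0, by simpa [h0] using hx⟩
  exact ⟨w, hw, fun w' h' => not_lt.1 (hmin w' h')⟩

def NoLong (S : SimpleGraph ℕ) (w : List (ℕ × Bool)) : Prop :=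
  ∀ i j m ε, alt i j m ε <:+: w → m ≤ (pd S).N i j → 2 * m ≤ (pd S).N i j

theorem IsMin.reduced {S : SimpleGraph ℕ} {P : GT S.Adj → Prop} {w : List (ℕ × Bool)}
    (h : IsMin S P w) : FreeGroup.IsReduced w := by
  apply FreeGroup.IsReduced.of_forall_not_step
  intro w' hw
  have h1 := hw.length
  have : val S w' = val S w := by
    simp only [val, show FreeGroup.mk w' = FreeGroup.mk w from (Quot.sound hw).symm]
  have h2 := h.2 w' (by rw [this]; exact h.1)
  omega

theorem IsMin.noLong {S : SimpleGraph ℕ} {P : GT S.Adj → Prop} {w : List (ℕ × Bool)}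
    (h : IsMin S P w) : NoLong S w := by
  rintro i j m ε ⟨s, t, rfl⟩ hm
  obtain ⟨u, hu1, hu2⟩ := alt_replace S i j m ε hm
  have h2 := h.2 (s ++ u ++ t) (by
    rw [val_append, val_append, hu2, ← val_append, ← val_append]; exact h.1)
  simp only [List.length_append, alt_length] at h2
  omega

end WG

namespace WG

theorem alt_get (i j m : ℕ) (ε : Bool) (k : ℕ) (hk : k < m) :
    (alt i j m ε)[k]? = some (if Even k then i else j, ε) := by
  induction m generalizing i j k with
  | zero => omega
  | succ m ih =>
    cases k with
    | zero => simp [alt]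
    | succ k =>
      rw [alt, List.getElem?_cons_succ, ih j i k (by omega)]
      by_cases h : Even k <;> simp [h, Nat.even_add_one]

theorem alt_map (f : ℕ → ℕ) (i j m : ℕ) (ε : Bool) :
    (alt i j m ε).map (Prod.map f id) = alt (f i) (f j) m ε := by
  induction m generalizing i j with
  | zero => rfl
  | succ m ih => simp [alt, ih]

theorem alt_pull (f : ℕ → ℕ) (hf : Function.Injective f) (u : List (ℕ × Bool)) (i' j' m : ℕ) (ε : Bool)
    (hm : 2 ≤ m) (h : u.map (Prod.map f id) = alt i' j' m ε) :
    ∃ i j, f i = i' ∧ f j = j' ∧ u = alt i j m ε := by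
  have h0 := congrArg (fun l => l[0]?) h
  have h1 := congrArg (fun l => l[1]?) h
  simp only [alt_get _ _ _ _ 0 (by omega : 0 < m), alt_get _ _ _ _ 1 (by omega : 1 < m),
    List.getElem?_map, Option.map_eq_some_iff] at h0 h1
  obtain ⟨a, _, ha⟩ := h0
  obtain ⟨b, _, hb⟩ := h1
  simp [Prod.ext_iff] at ha hb
  refine ⟨a.1, b.1, ha.1, hb.1, ?_⟩
  have hinj : Function.Injective (Prod.map f (id : Bool → Bool)) := hf.prodMap Function.injective_id
  apply List.map_injective_iff.2 hinj
  rw [h, alt_map, ha.1, hb.1]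

theorem forward (T S : SimpleGraph ℕ) (f : ℕ → ℕ) (hf : Function.Injective f)
    (h : ∀ m n, T.Adj m n ↔ S.Adj (f m) (f n)) : ∃ φ : GT T.Adj →* GT S.Adj, Function.Injective φ := by
  have hN : ∀ i j, (pd T).N i j = (pd S).N (f i) (f j) := by
    intro i j
    by_cases h1 : i = j
    · rw [h1, pd_self, pd_self]
    · by_cases h2 : T.Adj i j
      · rw [pd_adj T i j h2, pd_adj S _ _ ((h i j).1 h2)]
      · rw [pd_nadj T i j h1 h2, pd_nadj S _ _ (hf.ne h1) (fun e => h2 ((h i j).2 e))]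
  let φ : GT T.Adj →* GT S.Adj := PresentedGroup.toGroup (f := fun i => gen S.Adj (f i)) (by
    rintro r (⟨i, rfl⟩ | ⟨i, j, h', rfl⟩ | ⟨i, j, hij, h', rfl⟩)
    · simpa using gen_pow S (f i)
    · simpa using gen_adj S (f i) (f j) ((h i j).1 h')
    · simpa using gen_nadj S (f i) (f j) (hf.ne hij) (fun e => h' ((h i j).2 e)))
  have hφ : ∀ i, φ (gen T.Adj i) = gen S.Adj (f i) := fun i => PresentedGroup.toGroup.of _
  have hv : ∀ w, φ (val T w) = val S (w.map (Prod.map f id)) := by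
    intro w
    induction w with
    | nil => simp [val_nil]
    | cons l w ih =>
      obtain ⟨i, ε⟩ := l
      rw [List.map_cons, val_cons, val_cons S, map_mul, ih]
      cases ε
      · simp only [Prod.map, id]; rw [val_gen', val_gen', map_inv, hφ]
      · simp only [Prod.map, id]; rw [val_gen, val_gen, hφ]
  refine ⟨φ, (injective_iff_map_eq_one φ).2 fun x hx => ?_⟩
  obtain ⟨w, hw⟩ := exists_min T (fun y => y = x) x rfl
  have hwx : val T w = x := hw.1
  by_cases hnil : w = []
  · rw [← hwx, hnil, val_nil]
  exfalso
  have hred : FreeGroup.IsReduced (w.map (Prod.map f id)) := by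
    unfold FreeGroup.IsReduced
    rw [List.isChain_map]
    refine hw.reduced.imp ?_
    intro a b hab
    simpa [hf.eq_iff] using hab
  obtain ⟨i', j', ε, s, t, hst⟩ := GR S _ hred (by simpa using hnil) (by rw [← hv, hwx, hx])
  rw [eq_comm, List.map_eq_append_iff] at hst
  obtain ⟨w1, t', rfl, hw1, -⟩ := hst
  rw [List.map_eq_append_iff] at hw1
  obtain ⟨s', u, rfl, -, hu⟩ := hw1
  have h7 := (pd S).seven i' j'
  obtain ⟨i, j, rfl, rfl, rfl⟩ := alt_pull f hf u i' j' _ ε (by omega) hu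
  rw [← hN] at *
  have := hw.noLong i j _ ε ⟨s', t', rfl⟩ (by omega)
  omega

theorem rep_get {α : Type} (w : List α) (n k : ℕ) (hk : k < n * w.length) :
    (List.replicate n w).flatten[k]? = w[k % w.length]? := by
  induction n generalizing k with
  | zero => simp at hk
  | succ n ih =>
    rw [List.replicate_succ, List.flatten_cons]
    by_cases h : k < w.length
    · rw [List.getElem?_append_left h, Nat.mod_eq_of_lt h]
    · rw [List.getElem?_append_right (by omega), ih _ (by rw [Nat.succ_mul] at hk; omega),
        ← Nat.mod_eq_sub_mod (by omega)]

theorem infix_rep {α : Type} (w u : List α) (n : ℕ) (h : u <:+: (List.replicate n w).flatten) :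
    ∃ r, ∀ k, k < u.length → w[(r + k) % w.length]? = u[k]? := by
  obtain ⟨s, t, hst⟩ := h
  refine ⟨s.length, fun k hk => ?_⟩
  have hl := congrArg List.length hst
  simp at hl
  rw [← rep_get w n _ (by omega), ← hst, List.append_assoc, List.getElem?_append_right (by omega),
    Nat.add_sub_cancel_left, List.getElem?_append_left hk]

theorem infix_of_get {α : Type} (L u : List α) (x : ℕ) (h : ∀ k, k < u.length → L[x + k]? = u[k]?) :
    u <:+: L := by
  have : u = (L.drop x).take u.length := by
    apply List.ext_getElem?
    intro k
    by_cases hk : k < u.length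
    · rw [List.getElem?_take_of_lt hk, List.getElem?_drop, h k hk]
    · rw [List.getElem?_eq_none (by omega), List.getElem?_eq_none (by simp; omega)]
  rw [this]
  exact (List.take_prefix _ _).isInfix.trans (List.drop_suffix _ _).isInfix

theorem val_rotate (S : SimpleGraph ℕ) (w : List (ℕ × Bool)) (r : ℕ) :
    IsConj (val S w) (val S (w.rotate r)) := by
  rw [← List.rotate_mod, List.rotate_eq_drop_append_take_mod, Nat.mod_mod]
  conv_lhs => rw [← List.take_append_drop (r % w.length) w]
  rw [val_append, val_append, isConj_iff]
  exact ⟨(val S (w.take (r % w.length)))⁻¹, by group⟩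

theorem conj_min_rotate {S : SimpleGraph ℕ} {x : GT S.Adj} {w : List (ℕ × Bool)}
    (hw : IsMin S (fun y => IsConj x y) w) (r : ℕ) : IsMin S (fun y => IsConj x y) (w.rotate r) :=
  ⟨hw.1.trans (val_rotate S w r), fun w' h' => by rw [List.length_rotate]; exact hw.2 w' h'⟩

theorem conj_min_cyc {S : SimpleGraph ℕ} {x : GT S.Adj} {w : List (ℕ × Bool)}
    (hw : IsMin S (fun y => IsConj x y) w) : FreeGroup.IsCyclicallyReduced w := by
  refine ⟨hw.reduced, ?_⟩
  rcases w.eq_nil_or_concat with rfl | ⟨w1, a, rfl⟩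
  · simp
  cases w1 with
  | nil => simp
  | cons b w1 =>
    intro a' ha b' hb hab
    simp only [List.concat_eq_append, List.getLast?_concat, Option.mem_def, Option.some.injEq] at ha
    simp at hb
    subst ha hb
    have h1 := (conj_min_rotate hw 1).reduced
    rw [List.concat_eq_append, List.cons_append, List.rotate_cons_succ, List.rotate_zero, List.append_assoc] at h1
    have h2 := h1.infix (L₁ := [a, b]) ⟨w1, [], by simp⟩
    rw [FreeGroup.isReduced_cons_cons] at h2
    exact h2.1 hab

theorem coprime_pow {G : Type} [Group G] (x : G) (m n : ℕ) (h : Nat.Coprime m n) (hm : x ^ m = 1)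
    (hn : x ^ n = 1) : x = 1 := by
  rw [← orderOf_eq_one_iff, ← Nat.dvd_one, ← h]
  exact Nat.dvd_gcd (orderOf_dvd_of_pow_eq_one hm) (orderOf_dvd_of_pow_eq_one hn)

theorem torsion (S : SimpleGraph ℕ) (x : GT S.Adj) (hx : x ≠ 1) (h7 : x ^ 7 = 1) :
    ∃ a ε q g, 1 ≤ q ∧ q ≤ 3 ∧ x = g * val S (List.replicate q (a, ε)) * g⁻¹ := by
  obtain ⟨w, hw⟩ := exists_min S (fun y => IsConj x y) x (IsConj.refl x)
  have hpow : ∀ n, ∀ y, IsConj x y → x ^ n = 1 → y ^ n = 1 := by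
    intro n y hy h
    have := hy.pow n
    rwa [h, isConj_one_right] at this
  have hnil : w ≠ [] := by
    rintro rfl
    have := hw.1
    rw [val_nil, isConj_one_left] at this
    exact hx this
  have hlen : 0 < w.length := List.length_pos_iff.2 hnil
  obtain ⟨i, j, ε, hu⟩ := GR S _ ((conj_min_cyc hw).flatten_replicate 7).1 (by simpa using hnil)
    (by rw [val_rep]; exact hpow 7 _ hw.1 h7)
  obtain ⟨r, hr⟩ := infix_rep _ _ _ hu
  rw [alt_length] at hr
  have hw' := conj_min_rotate hw r
  have hlen' : (w.rotate r).length = w.length := List.length_rotate ..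
  set w' := w.rotate r with hw'def
  have hr' : ∀ k, k < (pd S).N i j - 3 → w'[k % w.length]? = some (if Even k then i else j, ε) := by
    intro k hk
    rw [← alt_get i j _ ε k hk, ← hr k hk, hw'def, List.getElem?_rotate (Nat.mod_lt _ hlen)]
    congr 1
    rw [Nat.mod_add_mod, add_comm]
  by_cases hq : (pd S).N i j - 3 ≤ w.length
  · exfalso
    have hinf : alt i j ((pd S).N i j - 3) ε <:+: w' := by
      apply infix_of_get _ _ 0
      intro k hk
      rw [alt_length] at hk
      rw [alt_get _ _ _ _ _ hk, ← hr' k hk, zero_add, Nat.mod_eq_of_lt (by omega)]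
    have := hw'.noLong i j _ ε hinf (by omega)
    have := (pd S).seven i j
    omega
  · push Not at hq
    have hwa : w' = alt i j w.length ε := by
      apply List.ext_getElem?
      intro k
      by_cases hk : k < w.length
      · rw [alt_get _ _ _ _ _ hk, ← hr' k (by omega), Nat.mod_eq_of_lt hk]
      · rw [List.getElem?_eq_none (by omega), List.getElem?_eq_none (by rw [alt_length]; omega)]
    rcases pd_cases S i j with ⟨rfl, h2⟩ | ⟨h1, h2⟩
    · have hc := hw'.1
      rw [hwa, alt_self] at hc
      obtain ⟨g, hg⟩ := isConj_iff.1 hc.symm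
      exact ⟨i, ε, w.length, g, hlen, by omega, hg.symm⟩
    · exfalso
      have e1 := hr' w.length hq
      have e0 := hr' 0 (by omega)
      rw [Nat.mod_self] at e1
      rw [Nat.zero_mod, e1] at e0
      have hev : Even w.length := by
        by_contra hne
        simp [hne] at e0
        exact h1 e0.symm
      obtain ⟨n, hn⟩ := hev
      rw [← two_mul] at hn
      have hc := hw'.1
      rw [hwa, hn, alt_double] at hc
      set y := (val S [(i, ε)] * val S [(j, ε)]) ^ n with hy
      have hy7 : y ^ 7 = 1 := hpow 7 _ hc h7
      have hy1 : y = 1 := by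
        rcases h2 with h2 | h2
        · refine coprime_pow y 7 11 (by norm_num) hy7 ?_
          rw [hy, ← pow_mul, mul_comm, pow_mul, pair_pow S i j 11 ε h2, one_pow]
        · refine coprime_pow y 7 13 (by norm_num) hy7 ?_
          rw [hy, ← pow_mul, mul_comm, pow_mul, pair_pow S i j 13 ε h2, one_pow]
      have hc' : IsConj x y := hc
      rw [hy1, isConj_one_left] at hc'
      exact hx hc'

end WG

namespace WG

theorem window {α : Type} (u L : List α) (h : u <:+: L) :
    ∃ x, x + u.length ≤ L.length ∧ ∀ k, k < u.length → L[x + k]? = u[k]? := by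
  obtain ⟨s, t, rfl⟩ := h
  refine ⟨s.length, by simp, fun k hk => ?_⟩
  rw [List.append_assoc, List.getElem?_append_right (by omega), Nat.add_sub_cancel_left,
    List.getElem?_append_left hk]

theorem three_get {α : Type} (κ μ : ℕ) (l l' : α) (h r : List α) :
    (∀ y, y < κ → (List.replicate κ l ++ h ++ List.replicate μ l' ++ r)[y]? = some l) ∧
    (∀ y, y < h.length → (List.replicate κ l ++ h ++ List.replicate μ l' ++ r)[κ + y]? = h[y]?) ∧
    (∀ y, y < μ → (List.replicate κ l ++ h ++ List.replicate μ l' ++ r)[κ + h.length + y]? = some l') ∧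
    (∀ y, (List.replicate κ l ++ h ++ List.replicate μ l' ++ r)[κ + h.length + μ + y]? = r[y]?) := by
  refine ⟨fun y hy => ?_, fun y hy => ?_, fun y hy => ?_, fun y => ?_⟩
  · rw [List.getElem?_append_left (by simp; omega), List.getElem?_append_left (by simp; omega),
      List.getElem?_append_left (by simp; omega)]
    simp [hy]
  · rw [List.getElem?_append_left (by simp; omega), List.getElem?_append_left (by simp; omega),
      List.getElem?_append_right (by simp)]
    simp
  · rw [List.getElem?_append_left (by simp; omega), List.getElem?_append_right (by simp)]
    simp [hy]
  · rw [List.getElem?_append_right (by simp; omega)]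
    congr 1
    simp only [List.length_append, List.length_replicate]
    omega

theorem core (S : SimpleGraph ℕ) (a b κ μ : ℕ) (α β : Bool) (h : List (ℕ × Bool)) (hκ : κ ≤ 3) (hμ : μ ≤ 3)
    (hne : h ≠ []) (hh : NoLong S h) (ha : ∀ l, h[0]? = some l → l.1 ≠ a)
    (hb : ∀ l, h[h.length - 1]? = some l → l.1 ≠ b) (c d : ℕ) (ε : Bool) :
    ¬ alt c d ((pd S).N c d - 3) ε <:+: List.replicate κ (a, α) ++ h ++ List.replicate μ (b, β) := by
  intro hinf
  have hη : 0 < h.length := List.length_pos_iff.2 hne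
  obtain ⟨g1, g2, g3, -⟩ := three_get κ μ (a, α) (b, β) h []
  rw [List.append_nil] at g1 g2 g3
  obtain ⟨x, hx, hk⟩ := window _ _ hinf
  set L := List.replicate κ (a, α) ++ h ++ List.replicate μ (b, β) with hL
  have hlen : L.length = κ + h.length + μ := by simp [hL]; omega
  rw [alt_length] at hx hk
  rw [hlen] at hx
  have hk' : ∀ k, k < (pd S).N c d - 3 → L[x + k]? = some (if Even k then c else d, ε) := by
    intro k h; rw [hk k h, alt_get _ _ _ _ _ h]
  rcases pd_cases S c d with ⟨rfl, hN⟩ | ⟨hcd, hN⟩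
  · rw [hN] at hx hk'
    simp only [ite_self] at hk'
    have hk2 : ∀ y, x ≤ y → y < x + 4 → L[y]? = some (c, ε) := by
      intro y h1 h2
      rw [← hk' (y - x) (by omega)]; congr 1; omega
    by_cases h1 : x < κ
    · have e1 := hk2 (κ - 1) (by omega) (by omega)
      have e2 := hk2 (κ + 0) (by omega) (by omega)
      rw [g1 _ (by omega)] at e1
      rw [g2 _ hη] at e2
      have := ha _ e2
      simp at e1
      exact this e1.1.symm
    · by_cases h2 : κ + h.length < x + 4
      · have e1 := hk2 (κ + (h.length - 1)) (by omega) (by omega)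
        have e2 := hk2 (κ + h.length + 0) (by omega) (by omega)
        rw [g2 _ (by omega)] at e1
        rw [g3 _ (by omega)] at e2
        have := hb _ e1
        simp at e2
        exact this e2.1.symm
      · have := hh c c 4 ε (infix_of_get _ _ (x - κ) (by
          intro k hk
          rw [alt_length] at hk
          rw [alt_get _ _ _ _ _ hk, ite_self, ← hk2 (x + k) (by omega) (by omega), ← g2 _ (by omega)]
          congr 1; omega)) (by omega)
        omega
  · have hN' := hN
    obtain ⟨k0, hk0, hk1, hk2⟩ : ∃ k0, k0 ≤ 3 ∧ κ ≤ x + k0 ∧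
        x + k0 + ((pd S).N c d - 9) ≤ κ + h.length := ⟨κ - x, by omega, by omega, by omega⟩
    have key : ∀ c' d', (∀ k, (if Even (k0 + k) then c else d) = (if Even k then c' else d')) →
        (pd S).N c' d' = (pd S).N c d → False := by
      intro c' d' hcd' hNN
      have := hh c' d' ((pd S).N c d - 9) ε (infix_of_get _ _ (x + k0 - κ) (by
          intro k hk
          rw [alt_length] at hk
          rw [alt_get _ _ _ _ _ hk, ← hcd', ← hk' _ (by omega), ← g2 _ (by omega)]
          congr 1; omega)) (by omega)
      omega
    by_cases he : Even k0
    · exact key c d (by intro k; simp [Nat.even_add, he]) rfl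
    · refine key d c (fun k => ?_) ((pd S).symm _ _)
      by_cases hk : Even k <;> simp [Nat.even_add, he, hk]

theorem invRev_get (h : List (ℕ × Bool)) (k : ℕ) (hk : k < h.length) :
    (FreeGroup.invRev h)[k]? = (h[h.length - 1 - k]?).map (fun l => (l.1, !l.2)) := by
  unfold FreeGroup.invRev
  rw [List.getElem?_reverse (by simpa using hk), List.getElem?_map, List.length_map]

theorem invRev_alt (i j m : ℕ) (ε : Bool) : ∃ i' j', (i' = i ∧ j' = j ∨ i' = j ∧ j' = i) ∧
    FreeGroup.invRev (alt i j m ε) = alt i' j' m (!ε) := by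
  have key : ∀ i' j', (∀ k, k < m → (if Even (m - 1 - k) then i else j) = (if Even k then i' else j')) →
      FreeGroup.invRev (alt i j m ε) = alt i' j' m (!ε) := by
    intro i' j' h
    apply List.ext_getElem?
    intro k
    by_cases hk : k < m
    · rw [invRev_get _ _ (by rwa [alt_length]), alt_length, alt_get _ _ _ _ _ (by omega), alt_get _ _ _ _ _ hk,
        ← h k hk]
      rfl
    · rw [List.getElem?_eq_none (by rw [FreeGroup.invRev_length, alt_length]; omega),
        List.getElem?_eq_none (by rw [alt_length]; omega)]
  by_cases hm : Even (m - 1)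
  · refine ⟨i, j, Or.inl ⟨rfl, rfl⟩, key i j fun k hk => ?_⟩
    have hs := Nat.even_sub (show k ≤ m - 1 by omega)
    by_cases hk : Even k <;> simp [hs, hm, hk]
  · refine ⟨j, i, Or.inr ⟨rfl, rfl⟩, key j i fun k hk => ?_⟩
    have hs := Nat.even_sub (show k ≤ m - 1 by omega)
    by_cases hk : Even k <;> simp [hs, hm, hk]

theorem NoLong.invRev {S : SimpleGraph ℕ} {h : List (ℕ × Bool)} (hh : NoLong S h) :
    NoLong S (FreeGroup.invRev h) := by
  intro i j m ε hinf hm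
  obtain ⟨s, t, hst⟩ := hinf
  have h1 := congrArg FreeGroup.invRev hst
  rw [FreeGroup.invRev_invRev, FreeGroup.invRev_append, FreeGroup.invRev_append] at h1
  obtain ⟨i', j', hij, he⟩ := invRev_alt i j m ε
  have hN : (pd S).N i' j' = (pd S).N i j := by
    rcases hij with ⟨rfl, rfl⟩ | ⟨rfl, rfl⟩
    · rfl
    · exact (pd S).symm _ _
  rw [he] at h1
  have := hh i' j' m (!ε) ⟨FreeGroup.invRev t, FreeGroup.invRev s, by rw [← h1, List.append_assoc]⟩ (by omega)
  omega

theorem isReduced_invRev (h : List (ℕ × Bool)) (hr : FreeGroup.IsReduced h) :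
    FreeGroup.IsReduced (FreeGroup.invRev h) := by
  rw [FreeGroup.isReduced_iff_reduce_eq] at *
  rw [FreeGroup.reduce_invRev, hr]

end WG

namespace WG

theorem long_case (S : SimpleGraph ℕ) (a b κ μ : ℕ) (α β : Bool) (h : List (ℕ × Bool))
    (hκ1 : 1 ≤ κ) (hκ : κ ≤ 3) (hμ1 : 1 ≤ μ) (hμ : μ ≤ 3)
    (hne : h ≠ []) (hr : FreeGroup.IsReduced h) (hh : NoLong S h)
    (ha : ∀ l, h[0]? = some l → l.1 ≠ a)
    (hb : ∀ l, h[h.length - 1]? = some l → l.1 ≠ b) (n : ℕ) (hn : 0 < n) :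
    val S (List.replicate κ (a, α) ++ h ++ List.replicate μ (b, β) ++ FreeGroup.invRev h) ^ n ≠ 1 := by
  intro h1
  have hη : 0 < h.length := List.length_pos_iff.2 hne
  have hη' : (FreeGroup.invRev h).length = h.length := FreeGroup.invRev_length
  have ha' : ∀ l, (FreeGroup.invRev h)[h.length - 1]? = some l → l.1 ≠ a := by
    intro l hl
    rw [invRev_get _ _ (by omega), Nat.sub_self, Option.map_eq_some_iff] at hl
    obtain ⟨l', hl', rfl⟩ := hl
    exact ha l' hl'
  have hb' : ∀ l, (FreeGroup.invRev h)[0]? = some l → l.1 ≠ b := by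
    intro l hl
    rw [invRev_get _ _ (by omega), Nat.sub_zero, Option.map_eq_some_iff] at hl
    obtain ⟨l', hl', rfl⟩ := hl
    exact hb l' hl'
  obtain ⟨g1, g2, g3, g4⟩ := three_get κ μ (a, α) (b, β) h (FreeGroup.invRev h)
  obtain ⟨f1, f2, f3, -⟩ := three_get μ κ (b, β) (a, α) (FreeGroup.invRev h) []
  rw [List.append_nil] at f1 f2 f3
  obtain ⟨e1, e2, e3, -⟩ := three_get κ μ (a, α) (b, β) h []
  rw [List.append_nil] at e1 e2 e3
  have hcyc : FreeGroup.IsCyclicallyReduced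
      (List.replicate κ (a, α) ++ h ++ List.replicate μ (b, β) ++ FreeGroup.invRev h) := by
    have hrep : ∀ m (l : ℕ × Bool), FreeGroup.IsReduced (List.replicate m l) := by
      intro m l
      exact List.isChain_replicate_of_rel _ (fun _ => rfl)
    constructor
    · unfold FreeGroup.IsReduced
      rw [List.isChain_append, List.isChain_append, List.isChain_append]
      refine ⟨⟨⟨hrep _ _, hr, ?_⟩, hrep _ _, ?_⟩, isReduced_invRev h hr, ?_⟩
      · intro x hx y hy hxy
        rw [List.getLast?_eq_getElem?, List.length_replicate, Option.mem_def, List.getElem?_replicate,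
          if_pos (by omega), Option.some.injEq] at hx
        rw [List.head?_eq_getElem?] at hy
        subst hx
        exact absurd hxy.symm (ha y hy)
      · intro x hx y hy hxy
        rw [List.getLast?_eq_getElem?, List.length_append, List.length_replicate, Option.mem_def,
          List.getElem?_append_right (by simp; omega), List.length_replicate,
          show κ + h.length - 1 - κ = h.length - 1 by omega] at hx
        rw [List.head?_eq_getElem?, Option.mem_def, List.getElem?_replicate,
          if_pos (by omega), Option.some.injEq] at hy
        subst hy
        exact absurd hxy (hb x hx)
      · intro x hx y hy hxy
        rw [List.getLast?_eq_getElem?, Option.mem_def,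
          show (List.replicate κ (a, α) ++ h ++ List.replicate μ (b, β)).length - 1
            = κ + h.length + (μ - 1) by simp only [List.length_append, List.length_replicate]; omega,
          e3 _ (by omega), Option.some.injEq] at hx
        rw [List.head?_eq_getElem?] at hy
        subst hx
        exact absurd hxy.symm (hb' y hy)
    · intro x hx y hy hxy
      rw [List.getLast?_eq_getElem?, Option.mem_def,
          show (List.replicate κ (a, α) ++ h ++ List.replicate μ (b, β) ++ FreeGroup.invRev h).length - 1
            = κ + h.length + μ + (h.length - 1) by
              simp only [List.length_append, List.length_replicate, hη']; omega,
          g4] at hx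
      rw [List.head?_eq_getElem?, Option.mem_def, g1 _ (by omega), Option.some.injEq] at hy
      subst hy
      exact absurd hxy (ha' x hx)
  rw [← val_rep] at h1
  obtain ⟨c, d, ε, hu⟩ := GR S _ (hcyc.flatten_replicate n).1 (by simp [hne]; omega) h1
  obtain ⟨r, hr'⟩ := infix_rep _ _ _ hu
  have hq : (List.replicate κ (a, α) ++ h ++ List.replicate μ (b, β) ++ FreeGroup.invRev h).length
     = κ + h.length + μ + h.length := by
    simp only [List.length_append, List.length_replicate, hη']
  rw [hq, alt_length] at hr'
  set Z := List.replicate κ (a, α) ++ h ++ List.replicate μ (b, β) ++ FreeGroup.invRev h with hZ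
  set q := κ + h.length + μ + h.length with hqdef
  set m := (pd S).N c d - 3 with hm
  obtain ⟨R, hRq, hR⟩ : ∃ R, R < q ∧ ∀ k, k < m → Z[(R + k) % q]? = (alt c d m ε)[k]? :=
    ⟨r % q, Nat.mod_lt _ (by omega), fun k hk => by rw [Nat.mod_add_mod]; exact hr' k hk⟩
  have hsgn : ∀ k, k < m → ∀ l, Z[(R + k) % q]? = some l → l.2 = ε := by
    intro k hk l hl
    rw [hR k hk, alt_get _ _ _ _ _ hk, Option.some.injEq] at hl
    rw [← hl]
  by_cases h1 : R < κ + h.length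
  · by_cases h2 : R + m ≤ κ + h.length + μ
    · refine core S a b κ μ α β h hκ hμ hne hh ha hb c d ε (infix_of_get _ _ R ?_)
      intro k hk
      rw [alt_length] at hk
      rw [← hR k hk, Nat.mod_eq_of_lt (by omega), hZ]
      rw [List.getElem?_append_left (l₂ := FreeGroup.invRev h)]
      simp only [List.length_append, List.length_replicate]
      omega
    · obtain ⟨l, hl⟩ : ∃ l, h[h.length - 1]? = some l := ⟨_, List.getElem?_eq_getElem (by omega)⟩
      have s1 := hsgn (κ + (h.length - 1) - R) (by omega) l (by
        rw [show R + (κ + (h.length - 1) - R) = κ + (h.length - 1) by omega, Nat.mod_eq_of_lt (by omega),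
          g2 _ (by omega), hl])
      have s2 := hsgn (κ + h.length + μ + 0 - R) (by omega) (l.1, !l.2) (by
        rw [show R + (κ + h.length + μ + 0 - R) = κ + h.length + μ + 0 by omega, Nat.mod_eq_of_lt (by omega),
          g4, invRev_get _ _ hη, Nat.sub_zero, hl]
        rfl)
      rw [← s1] at s2
      simp at s2
  · by_cases h2 : R + m ≤ q + κ
    · refine core S b a μ κ β α (FreeGroup.invRev h) hμ hκ (by
          intro e; rw [e] at hη'; simp at hη'; omega) hh.invRev hb' (by rw [hη']; exact ha') c d ε
          (infix_of_get _ _ (R - (κ + h.length)) ?_)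
      intro k hk
      rw [alt_length] at hk
      rw [← hR k hk]
      by_cases h3 : R + k < q
      · rw [Nat.mod_eq_of_lt h3]
        by_cases h4 : R + k < κ + h.length + μ
        · rw [f1 _ (by omega), ← g3 (R + k - (κ + h.length)) (by omega)]
          congr 1; omega
        · rw [show R - (κ + h.length) + k = μ + (R + k - (κ + h.length + μ)) by omega, f2 _ (by omega),
            ← g4]
          congr 1; omega
      · rw [Nat.mod_eq_sub_mod (by omega), Nat.mod_eq_of_lt (by omega), g1 _ (by omega),
          ← f3 (R + k - q) (by omega)]
        congr 1; omega
    · obtain ⟨l, hl⟩ : ∃ l, h[0]? = some l := ⟨_, List.getElem?_eq_getElem (by omega)⟩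
      have s1 := hsgn (q + κ + 0 - R) (by omega) l (by
        rw [show R + (q + κ + 0 - R) = (κ + 0) + q by omega, Nat.add_mod_right, Nat.mod_eq_of_lt (by omega),
          g2 _ (by omega), hl])
      have s2 := hsgn (κ + h.length + μ + (h.length - 1) - R) (by omega) (l.1, !l.2) (by
        rw [show R + (κ + h.length + μ + (h.length - 1) - R) = κ + h.length + μ + (h.length - 1) by omega,
          Nat.mod_eq_of_lt (by omega),
          g4, invRev_get _ _ (by omega), Nat.sub_self, hl]
        rfl)
      rw [← s1] at s2
      simp at s2

theorem short_case (S : SimpleGraph ℕ) (a b κ μ : ℕ) (α β : Bool)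
    (hκ1 : 1 ≤ κ) (hκ : κ ≤ 3) (hμ1 : 1 ≤ μ) (hμ : μ ≤ 3) (n : ℕ) (hn : 0 < n) (hab : a ≠ b)
    (h1 : val S (List.replicate κ (a, α) ++ List.replicate μ (b, β)) ^ n = 1) :
    κ = 1 ∧ μ = 1 ∧ α = β := by
  obtain ⟨g1, -, g3, -⟩ := three_get κ μ (a, α) (b, β) [] []
  simp only [List.append_nil, List.length_nil, Nat.add_zero] at g1 g3
  have hq : (List.replicate κ (a, α) ++ List.replicate μ (b, β)).length = κ + μ := by simp
  have hcyc : FreeGroup.IsCyclicallyReduced (List.replicate κ (a, α) ++ List.replicate μ (b, β)) := by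
    have hrep : ∀ m (l : ℕ × Bool), FreeGroup.IsReduced (List.replicate m l) := by
      intro m l
      exact List.isChain_replicate_of_rel _ (fun _ => rfl)
    constructor
    · unfold FreeGroup.IsReduced
      rw [List.isChain_append]
      refine ⟨hrep _ _, hrep _ _, ?_⟩
      intro x hx y hy hxy
      rw [List.getLast?_eq_getElem?, List.length_replicate, Option.mem_def, List.getElem?_replicate,
        if_pos (by omega), Option.some.injEq] at hx
      rw [List.head?_eq_getElem?, Option.mem_def, List.getElem?_replicate,
        if_pos (by omega), Option.some.injEq] at hy
      subst hx hy
      exact absurd hxy hab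
    · intro x hx y hy hxy
      rw [List.getLast?_eq_getElem?, Option.mem_def, hq, show κ + μ - 1 = κ + (μ - 1) by omega,
        g3 _ (by omega), Option.some.injEq] at hx
      rw [List.head?_eq_getElem?, Option.mem_def, g1 _ (by omega), Option.some.injEq] at hy
      subst hx hy
      exact absurd hxy.symm hab
  rw [← val_rep] at h1
  obtain ⟨c, d, ε, hu⟩ := GR S _ (hcyc.flatten_replicate n).1 (by simp; omega) h1
  obtain ⟨r, hr'⟩ := infix_rep _ _ _ hu
  rw [hq, alt_length] at hr'
  set Z := List.replicate κ (a, α) ++ List.replicate μ (b, β) with hZ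
  have hget : ∀ y, y < κ + μ → Z[y]? = some (if y < κ then (a, α) else (b, β)) := by
    intro y hy
    split_ifs with h
    · exact g1 y h
    · rw [← g3 (y - κ) (by omega)]; congr 1; omega
  obtain ⟨R, hRq, hR⟩ : ∃ R, R < κ + μ ∧ ∀ k, k < (pd S).N c d - 3 →
      (if (R + k) % (κ + μ) < κ then (a, α) else (b, β)) = (if Even k then c else d, ε) := by
    refine ⟨r % (κ + μ), Nat.mod_lt _ (by omega), fun k hk => ?_⟩
    have := hr' k hk
    rw [hget _ (Nat.mod_lt _ (by omega)), alt_get _ _ _ _ _ hk, Option.some.injEq] at this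
    rw [Nat.mod_add_mod]; exact this
  -- positions of prescribed residue
  have hpos : ∀ y, y < κ + μ → ∃ k, k < κ + μ ∧ (R + k) % (κ + μ) = y := by
    intro y hy
    by_cases h : R ≤ y
    · exact ⟨y - R, by omega, by rw [show R + (y - R) = y by omega, Nat.mod_eq_of_lt hy]⟩
    · exact ⟨y + (κ + μ) - R, by omega, by
        rw [show R + (y + (κ + μ) - R) = y + (κ + μ) by omega, Nat.add_mod_right, Nat.mod_eq_of_lt hy]⟩
  rcases pd_cases S c d with ⟨rfl, hN⟩ | ⟨hcd, hN⟩
  · exfalso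
    rw [hN] at hR
    have h0 := hR 0 (by omega)
    have h1 := hR 1 (by omega)
    have h2 := hR 2 (by omega)
    have h3 := hR 3 (by omega)
    simp only [ite_self] at h0 h1 h2 h3
    have key : ∀ x y : ℕ, (if x < κ then (a, α) else (b, β)) = (c, ε) →
        (if y < κ then (a, α) else (b, β)) = (c, ε) → (x < κ ↔ y < κ) := by
      intro x y hx hy
      by_cases h : x < κ <;> by_cases h' : y < κ <;> simp [h, h'] at hx hy ⊢
      · exact hab (hx.1.trans hy.1.symm)
      · exact hab (hy.1.trans hx.1.symm)
    have k1 := key _ _ h0 h1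
    have k2 := key _ _ h0 h2
    have k3 := key _ _ h0 h3
    clear h0 h1 h2 h3 key hR
    interval_cases κ <;> interval_cases μ <;> interval_cases R <;> simp at k1 k2 k3
  · have hnext : ∀ k, k < 7 → ((R + k) % (κ + μ) < κ ↔ ¬ (R + (k + 1)) % (κ + μ) < κ) := by
      intro k hk
      have e1 := hR k (by omega)
      have e2 := hR (k + 1) (by omega)
      have hne : (if Even k then c else d) ≠ (if Even (k + 1) then c else d) := by
        by_cases h : Even k <;> simp [h, Nat.even_add_one]
        · exact hcd
        · exact hcd.symm
      by_cases h : (R + k) % (κ + μ) < κ <;> by_cases h' : (R + (k + 1)) % (κ + μ) < κ <;>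
        simp only [h, h', if_true, if_false, Prod.mk.injEq] at e1 e2 ⊢
      · exact absurd (e1.1.symm.trans e2.1) hne
      · simp
      · simp
      · exact absurd (e1.1.symm.trans e2.1) hne
    have hα : α = ε := by
      obtain ⟨k, hk, hk'⟩ := hpos 0 (by omega)
      have := hR k (by omega)
      rw [hk', if_pos (by omega)] at this
      exact (Prod.mk.inj this).2
    have hβ : β = ε := by
      obtain ⟨k, hk, hk'⟩ := hpos κ (by omega)
      have := hR k (by omega)
      rw [hk', if_neg (by omega)] at this
      exact (Prod.mk.inj this).2
    refine ⟨?_, ?_, hα.trans hβ.symm⟩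
    · by_contra hc
      obtain ⟨k, hk, hk'⟩ := hpos 0 (by omega)
      have := hnext k (by omega)
      have e : (R + (k + 1)) % (κ + μ) = 0 + 1 := by
        rw [← add_assoc, ← Nat.mod_add_mod, hk', Nat.mod_eq_of_lt (by omega)]
      rw [hk', e] at this
      omega
    · by_contra hc
      obtain ⟨k, hk, hk'⟩ := hpos κ (by omega)
      have := hnext k (by omega)
      have e : (R + (k + 1)) % (κ + μ) = κ + 1 := by
        rw [← add_assoc, ← Nat.mod_add_mod, hk', Nat.mod_eq_of_lt (by omega)]
      rw [hk', e] at this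
      omega

end WG

namespace WG

theorem alt_long (S : SimpleGraph ℕ) (w : List (ℕ × Bool)) (hr : FreeGroup.IsReduced w) (hw : w ≠ [])
    (hl : w.length ≤ 2) : val S w ≠ 1 := by
  intro h
  obtain ⟨i, j, ε, hi⟩ := GR S w hr hw h
  have := hi.length_le
  rw [alt_length] at this
  have := (pd S).seven i j
  omega

theorem gen_ne (S : SimpleGraph ℕ) (i : ℕ) : gen S.Adj i ≠ 1 := by
  rw [← val_gen]
  exact alt_long S _ (by simp [FreeGroup.IsReduced]) (by simp) (by simp)

theorem gen_mul_ne (S : SimpleGraph ℕ) (i j : ℕ) : gen S.Adj i * gen S.Adj j ≠ 1 := by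
  rw [← val_gen, ← val_gen, ← val_append]
  exact alt_long S _ (by simp [FreeGroup.IsReduced]) (by simp) (by simp)

theorem val_zpow (S : SimpleGraph ℕ) (a : ℕ) (ε : Bool) :
    ∃ e : ℤ, val S [(a, ε)] = gen S.Adj a ^ e := by
  cases ε
  · exact ⟨-1, by rw [val_gen', zpow_neg_one]⟩
  · exact ⟨1, by rw [val_gen, zpow_one]⟩

theorem comm_zpow (S : SimpleGraph ℕ) (a κ : ℕ) (ε : Bool) (s : ℤ) :
    Commute (val S (List.replicate κ (a, ε))) (gen S.Adj a ^ s) := by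
  obtain ⟨e, he⟩ := val_zpow S a ε
  rw [val_replicate, he]
  exact (((Commute.refl (gen S.Adj a)).zpow_zpow e s)).pow_left κ

theorem product (S : SimpleGraph ℕ) (a b κ μ : ℕ) (α β : Bool) (g g' : GT S.Adj)
    (hκ1 : 1 ≤ κ) (hκ : κ ≤ 3) (hμ1 : 1 ≤ μ) (hμ : μ ≤ 3) (n : ℕ) (hn : n = 11 ∨ n = 13)
    (h1 : ((g * val S (List.replicate κ (a, α)) * g⁻¹) *
      (g' * val S (List.replicate μ (b, β)) * g'⁻¹)) ^ n = 1)
    (hne : (g * val S (List.replicate κ (a, α)) * g⁻¹) *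
      (g' * val S (List.replicate μ (b, β)) * g'⁻¹) ≠ 1) :
    a ≠ b ∧ (pd S).N a b = 2 * n := by
  obtain ⟨h, hmin⟩ := exists_min S (fun z => ∃ s t : ℤ, z = gen S.Adj a ^ s * (g⁻¹ * g') * gen S.Adj b ^ t)
    (g⁻¹ * g') ⟨0, 0, by simp⟩
  obtain ⟨s, t, hst⟩ := hmin.1
  set A := val S (List.replicate κ (a, α)) with hA
  set B := val S (List.replicate μ (b, β)) with hB
  have cA : A * gen S.Adj a ^ s = gen S.Adj a ^ s * A := comm_zpow S a κ α s
  have cB : B * gen S.Adj b ^ t = gen S.Adj b ^ t * B := comm_zpow S b μ β t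
  set p := gen S.Adj a ^ s with hp
  set q := gen S.Adj b ^ t with hq
  have hz : val S (List.replicate κ (a, α) ++ h ++ List.replicate μ (b, β) ++ FreeGroup.invRev h) =
      (p * g⁻¹) * ((g * A * g⁻¹) * (g' * B * g'⁻¹)) * (p * g⁻¹)⁻¹ := by
    rw [val_append, val_append, val_append, val_invRev, hst, ← hA, ← hB]
    have e : q * B * q⁻¹ = B := by rw [← cB]; group
    calc A * (p * (g⁻¹ * g') * q) * B * (p * (g⁻¹ * g') * q)⁻¹
        = (A * p) * (g⁻¹ * g') * (q * B * q⁻¹) * (p * (g⁻¹ * g'))⁻¹ := by group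
      _ = _ := by rw [e, cA]; group
  have hz1 : val S (List.replicate κ (a, α) ++ h ++ List.replicate μ (b, β) ++ FreeGroup.invRev h) ^ n = 1 := by
    rw [hz, conj_pow, h1]; group
  have hzne : val S (List.replicate κ (a, α) ++ h ++ List.replicate μ (b, β) ++ FreeGroup.invRev h) ≠ 1 := by
    rw [hz]; intro h0
    exact hne (by rwa [conj_eq_one_iff] at h0)
  have hn0 : 0 < n := by omega
  by_cases hnil : h = []
  · subst hnil
    have hi : FreeGroup.invRev ([] : List (ℕ × Bool)) = [] := rfl
    rw [hi, List.append_nil, List.append_nil] at hz1 hzne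
    have hab : a ≠ b := by
      rintro rfl
      apply hzne
      refine coprime_pow _ 7 n (by rcases hn with rfl | rfl <;> norm_num) ?_ hz1
      obtain ⟨e, he⟩ := val_zpow S a α
      obtain ⟨e', he'⟩ := val_zpow S a β
      have e2 : ((gen S.Adj a ^ e) ^ κ * (gen S.Adj a ^ e') ^ μ) = gen S.Adj a ^ (e * κ + e' * μ) := by
        rw [zpow_add, zpow_mul, zpow_mul, zpow_natCast, zpow_natCast]
      rw [val_append, val_replicate, val_replicate, he, he', e2, ← zpow_natCast, zpow_comm, zpow_natCast,
        gen_pow, one_zpow]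
    obtain ⟨rfl, rfl, rfl⟩ := short_case S a b κ μ α β hκ1 hκ hμ1 hμ n hn0 hab hz1
    refine ⟨hab, ?_⟩
    have hv : val S (List.replicate 1 (a, α) ++ List.replicate 1 (b, α)) =
      val S [(a, α)] * val S [(b, α)] := by rw [val_append]; rfl
    rw [hv] at hz1 hzne
    rcases pd_cases S a b with ⟨h2, -⟩ | ⟨-, h2⟩
    · exact absurd h2 hab
    · rcases h2 with h2 | h2
      · have := pair_pow S a b 11 α h2
        rcases hn with rfl | rfl
        · exact h2
        · exact absurd (coprime_pow _ 11 13 (by norm_num) this hz1) hzne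
      · have := pair_pow S a b 13 α h2
        rcases hn with rfl | rfl
        · exact absurd (coprime_pow _ 13 11 (by norm_num) this hz1) hzne
        · exact h2
  · exfalso
    refine long_case S a b κ μ α β h hκ1 hκ hμ1 hμ hnil hmin.reduced hmin.noLong ?_ ?_ n hn0 hz1
    · rintro ⟨c, ε⟩ hl rfl
      cases h with
      | nil => exact hnil rfl
      | cons l h' =>
        simp only [List.getElem?_cons_zero, Option.some.injEq] at hl
        subst hl
        obtain ⟨e, he⟩ := val_zpow S c ε
        have := hmin.2 h' ⟨s - e, t, by
          rw [val_cons, he] at hst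
          rw [sub_eq_neg_add, zpow_add, ← hp, ← hq, mul_assoc, mul_assoc, ← mul_assoc p, ← hst]
          simp only [zpow_neg, inv_mul_cancel_left]⟩
        simp at this
    · rintro ⟨c, ε⟩ hl rfl
      rcases h.eq_nil_or_concat with rfl | ⟨h', l, rfl⟩
      · exact hnil rfl
      · simp at hl
        subst hl
        obtain ⟨e, he⟩ := val_zpow S c ε
        have := hmin.2 h' ⟨s, t - e, by
          rw [List.concat_eq_append, val_append, he] at hst
          rw [sub_eq_add_neg, zpow_add, ← hp, ← hq, ← mul_assoc, ← hst]
          simp only [zpow_neg, mul_inv_cancel_right]⟩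
        simp at this

theorem backward (T S : SimpleGraph ℕ) (φ : GT T.Adj →* GT S.Adj) (hφ : Function.Injective φ) :
    ∃ f : ℕ → ℕ, Function.Injective f ∧ ∀ m n, T.Adj m n ↔ S.Adj (f m) (f n) := by
  have ht : ∀ i, ∃ a ε q g, 1 ≤ q ∧ q ≤ 3 ∧
      φ (gen T.Adj i) = g * val S (List.replicate q (a, ε)) * g⁻¹ := fun i =>
    torsion S _ (by rw [Ne, map_eq_one_iff φ hφ]; exact gen_ne T i)
      (by rw [← map_pow, gen_pow, map_one])
  choose F ε q g h1 h3 hF using ht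
  have key : ∀ i j n, (n = 11 ∨ n = 13) → (gen T.Adj i * gen T.Adj j) ^ n = 1 →
      F i ≠ F j ∧ (pd S).N (F i) (F j) = 2 * n := by
    intro i j n hn h
    refine product S _ _ _ _ (ε i) (ε j) (g i) (g j) (h1 i) (h3 i) (h1 j) (h3 j) n hn ?_ ?_
    · rw [← hF, ← hF, ← map_mul, ← map_pow, h, map_one]
    · rw [← hF, ← hF, ← map_mul, Ne, map_eq_one_iff φ hφ]; exact gen_mul_ne T i j
  have hadj : ∀ i j, T.Adj i j → S.Adj (F i) (F j) := by
    intro i j h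
    obtain ⟨k1, k2⟩ := key i j 11 (Or.inl rfl) (gen_adj T i j h)
    by_contra hc
    rw [pd_nadj S _ _ k1 hc] at k2
    omega
  have hnadj : ∀ i j, i ≠ j → ¬ T.Adj i j → F i ≠ F j ∧ ¬ S.Adj (F i) (F j) := by
    intro i j hij h
    obtain ⟨k1, k2⟩ := key i j 13 (Or.inr rfl) (gen_nadj T i j hij h)
    refine ⟨k1, fun hc => ?_⟩
    rw [pd_adj S _ _ hc] at k2
    omega
  refine ⟨F, fun i j hij => ?_, fun m n => ⟨hadj m n, fun h => ?_⟩⟩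
  · by_contra hne
    by_cases h : T.Adj i j
    · exact (hadj i j h).ne hij
    · exact (hnadj i j hne h).1 hij
  · by_contra hc
    by_cases hmn : m = n
    · subst hmn; exact S.loopless.irrefl _ h
    · exact (hnadj m n hmn hc).2 h

end WG

/-- **Williams' reduction.** For simple graphs `T, S` on `ℕ`: `T` embeds into `S` as a
graph iff `G_T` embeds into `G_S` as a group. -/
theorem graph_embeds_iff_group_embeds (T S : SimpleGraph ℕ) :
    (∃ f : ℕ → ℕ, Function.Injective f ∧ ∀ m n, T.Adj m n ↔ S.Adj (f m) (f n)) ↔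
      ∃ φ : GT T.Adj →* GT S.Adj, Function.Injective φ := by
  exact ⟨fun ⟨f, hf, h⟩ => WG.forward T S f hf h, fun ⟨φ, hφ⟩ => WG.backward T S φ hφ⟩
end
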